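/- For every non-negative integer ℓ there exist rational numbers a_L, indexed by L = (L_1,…,L_r) ∈ ℕ_0^r with L_1 + ⋯ + L_r = nℓ + r, such that simultaneously Q_ℓ(x) = Σ_L a_L Π_{i=1}^r x_i^{L_i} and P_ℓ(x) = Σ_L a_L Π_{i=1}^r B_{L_i}(x_i), where B_m denotes the m-th Bernoulli polynomial; i.e. P_ℓ is obtained from the monomial expansion of Q_ℓ by replacing each power x_i^{L_i} by the Bernoulli polynomial B_{L_i}(x_i). -/

import Mathlib

open MeasureTheory Complex RealInnerProductSpace
open scoped Classical

noncomputable section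

/-- The data of a reduced crystallographic root system `Φ` spanning a real inner
product space `E`, together with a choice of positive system `Φ⁺`, an ordering
of the simple roots, and the corresponding fundamental dominant weights. -/
structure RootSystemData (r : ℕ) (E : Type*) [NormedAddCommGroup E] [InnerProductSpace ℝ E] where
  /-- the set of roots -/
  roots : Finset E
  /-- the set of positive roots -/
  pos : Finset E
  /-- the (ordered) simple roots of the positive system -/
  simple : Fin r → E
  /-- the fundamental dominant weights -/
  weight : Fin r → E
  ne_zero : ∀ α ∈ roots, α ≠ (0 : E)
  span_eq : Submodule.span ℝ (roots : Set E) = ⊤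
  reduced : ∀ α ∈ roots, ∀ c : ℝ, c • α ∈ roots → c = 1 ∨ c = -1
  crystallographic : ∀ α ∈ roots, ∀ β ∈ roots, ∃ z : ℤ, 2 * ⟪β, α⟫ / ⟪α, α⟫ = (z : ℝ)
  reflection_mem : ∀ α ∈ roots, ∀ β ∈ roots, β - (2 * ⟪β, α⟫ / ⟪α, α⟫) • α ∈ roots
  pos_subset : pos ⊆ roots
  mem_pos_or : ∀ α ∈ roots, α ∈ pos ∨ -α ∈ pos
  not_both : ∀ α ∈ pos, -α ∉ pos
  simple_mem_pos : ∀ i, simple i ∈ pos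
  simple_inj : Function.Injective simple
  simple_base : ∀ α ∈ pos, ∃ c : Fin r → ℕ, α = ∑ i, (c i : ℝ) • simple i
  weight_dual : ∀ i j, ⟪weight i, (2 / ⟪simple j, simple j⟫) • simple j⟫ = (if i = j then (1:ℝ) else 0)

variable {r : ℕ} {E : Type*} [NormedAddCommGroup E] [InnerProductSpace ℝ E]

/-- The pairing `(λ_i, α^∨)` of the `i`-th fundamental weight with the coroot of `α`. -/
def RootSystemData.pairing (S : RootSystemData r E) (i : Fin r) (α : E) : ℝ :=
  ⟪S.weight i, (2 / ⟪α, α⟫) • α⟫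

/-- The zeta series `ζ_Φ(s,x)` attached to the root system data. -/
def zetaRS (S : RootSystemData r E) (s : ℂ) (x : Fin r → ℝ) : ℂ :=
  ∑' m : Fin r → ℕ, ∏ α ∈ S.pos,
    (((∑ i, ((m i : ℝ) + x i) * S.pairing i α : ℝ)) : ℂ) ^ (-s)

/-- The zeta integral `𝒵_Φ(s,x)` attached to the root system data. -/
def zetaIntRS (S : RootSystemData r E) (s : ℂ) (x : Fin r → ℝ) : ℂ :=
  ∫ t in {t : Fin r → ℝ | ∀ i, 0 < t i}, ∏ α ∈ S.pos,
    (((∑ i, (t i + x i) * S.pairing i α : ℝ)) : ℂ) ^ (-s)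

/-- `v` is the value `P_ℓ(x) = ζ_Φ(-ℓ,x)` of the meromorphic continuation of the
zeta series at `s = -ℓ`. -/
def IsPValue (S : RootSystemData r E) (l : ℕ) (x : Fin r → ℝ) (v : ℂ) : Prop :=
  ∃ F : ℂ → ℂ, (∀ s : ℂ, (r : ℝ) < s.re → F s = zetaRS S s x) ∧
    MeromorphicOn F Set.univ ∧ AnalyticAt ℂ F (-(l : ℂ)) ∧ F (-(l : ℂ)) = v

/-- `v` is the value `Q_ℓ(x) = 𝒵_Φ(-ℓ,x)` of the meromorphic continuation of the
zeta integral at `s = -ℓ`. -/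
def IsQValue (S : RootSystemData r E) (l : ℕ) (x : Fin r → ℝ) (v : ℂ) : Prop :=
  ∃ F : ℂ → ℂ, (∀ s : ℂ, (r : ℝ) < s.re → F s = zetaIntRS S s x) ∧
    MeromorphicOn F Set.univ ∧ AnalyticAt ℂ F (-(l : ℂ)) ∧ F (-(l : ℂ)) = v

/-- The box on which the coordinates in `p` run through `(0, 1)` and the others through
`(1, ∞)`. -/
def poleBox {n : ℕ} (p : Finset (Fin n)) : Set (Fin n → ℝ) :=
  {t | ∀ k, if k ∈ p then t k ∈ Set.Ioo (0 : ℝ) 1 else 1 < t k}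

lemma poleBox_pos {n : ℕ} {p : Finset (Fin n)} {t : Fin n → ℝ} (ht : t ∈ poleBox p) (k : Fin n) :
    0 < t k := by
  have := ht k
  split_ifs at this with h
  · exact this.1
  · linarith

/-- The growth of an elementary function in the `k`-th coordinate: in the coordinates of `P` it is
bounded, in the other coordinates of `p` it is flat of order `N` at zero, and in the coordinates
outside `p` it has polynomial growth. -/
def growth {n : ℕ} (p P : Finset (Fin n)) (N K : ℕ) (k : Fin n) (x : ℝ) : ℝ :=
  if k ∈ p then (if k ∈ P then 1 else x ^ N) else x ^ K

lemma growth_nonneg {n : ℕ} {p P : Finset (Fin n)} {N K : ℕ} {t : Fin n → ℝ}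
    (ht : t ∈ poleBox p) (k : Fin n) : 0 ≤ growth p P N K k (t k) := by
  have := poleBox_pos ht k
  unfold growth
  split_ifs <;> positivity

lemma growth_mul_le {n : ℕ} {p P P' : Finset (Fin n)} {N K K' : ℕ} {t : Fin n → ℝ}
    (ht : t ∈ poleBox p) (k : Fin n) :
    growth p P N K k (t k) * growth p P' N K' k (t k) ≤
      growth p (P ∩ P') N (K + K') k (t k) := by
  have h0 := poleBox_pos ht k
  have := ht k
  unfold growth
  by_cases hp : k ∈ p
  · rw [if_pos hp] at this
    have h1 : t k ^ N ≤ 1 := pow_le_one₀ h0.le this.2.le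
    have h2 : 0 ≤ t k ^ N := by positivity
    by_cases hP : k ∈ P <;> by_cases hP' : k ∈ P' <;>
      (simp [hp, hP, hP']; try nlinarith)
  · simp [hp, pow_add]

/-- Elementary functions with a parameter `ξ`: a monomial times a function that does not depend
on the coordinates in `P` and is flat of order `N` in the remaining coordinates of `p`. The
parameter enters with at most polynomial growth in `B ξ`. -/
def IsElem {Ξ : Type} [MeasurableSpace Ξ] {m : ℕ} (p : Finset (Fin (m + 1))) (N : ℕ) (B : Ξ → ℝ)
    (d : ℕ) (G : Ξ → (Fin (m + 1) → ℝ) → ℂ) : Prop :=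
  ∃ (P : Finset (Fin (m + 1))) (e : Fin (m + 1) → ℕ) (g : Ξ → (Fin (m + 1) → ℝ) → ℂ)
    (C : ℝ) (K : ℕ), P ⊆ p ∧ 0 ≤ C ∧ Measurable (Function.uncurry g) ∧
    (∀ ξ, ∀ k ∈ P, ∀ t x, g ξ (Function.update t k x) = g ξ t) ∧
    (∀ ξ, ∀ t ∈ poleBox p, ‖g ξ t‖ ≤ C * B ξ ^ K * ∏ k, growth p P N K k (t k)) ∧
    (0 ∈ P → d ≤ e 0) ∧
    ∀ ξ, ∀ t ∈ poleBox p, G ξ t = (∏ k, (t k : ℂ) ^ e k) * g ξ t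

/-- Finite sums of elementary functions on `poleBox p`. -/
inductive IsTame {Ξ : Type} [MeasurableSpace Ξ] {m : ℕ} (p : Finset (Fin (m + 1))) (N : ℕ)
    (B : Ξ → ℝ) (d : ℕ) : (Ξ → (Fin (m + 1) → ℝ) → ℂ) → Prop
  | elem {G : Ξ → (Fin (m + 1) → ℝ) → ℂ} : IsElem p N B d G → IsTame p N B d G
  | add {G₁ G₂ G : Ξ → (Fin (m + 1) → ℝ) → ℂ} : IsTame p N B d G₁ → IsTame p N B d G₂ →
      (∀ ξ, ∀ t ∈ poleBox p, G ξ t = G₁ ξ t + G₂ ξ t) → IsTame p N B d G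

namespace IsTame

variable {Ξ : Type} [MeasurableSpace Ξ] {m : ℕ} {p : Finset (Fin (m + 1))} {N : ℕ}
  {B : Ξ → ℝ} {d d' : ℕ} {G G₁ G₂ : Ξ → (Fin (m + 1) → ℝ) → ℂ}

lemma congr (h : IsTame p N B d G₁) (h' : ∀ ξ, ∀ t ∈ poleBox p, G ξ t = G₁ ξ t) :
    IsTame p N B d G := by
  cases h with
  | elem h =>
    obtain ⟨P, e, g, C, K, h1, h2, h3, h4, h5, h6, h7⟩ := h
    exact .elem ⟨P, e, g, C, K, h1, h2, h3, h4, h5, h6,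
      fun ξ t ht => by rw [h' ξ t ht, h7 ξ t ht]⟩
  | add h1 h2 h3 => exact .add h1 h2 fun ξ t ht => by rw [h' ξ t ht, h3 ξ t ht]

lemma mono (h : IsTame p N B d G) (hd : d' ≤ d) : IsTame p N B d' G := by
  induction h with
  | elem h =>
    obtain ⟨P, e, g, C, K, h1, h2, h3, h4, h5, h6, h7⟩ := h
    exact .elem ⟨P, e, g, C, K, h1, h2, h3, h4, h5, fun h => hd.trans (h6 h), h7⟩
  | add _ _ h3 ih1 ih2 => exact .add ih1 ih2 h3

lemma zero : IsTame p N B d (fun _ _ => 0) :=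
  .elem ⟨∅, 0, fun _ _ => 0, 0, 0, by simp, le_rfl, measurable_const, by simp, by simp, by simp,
    by simp⟩

lemma add' (h₁ : IsTame p N B d G₁) (h₂ : IsTame p N B d G₂) :
    IsTame p N B d (fun ξ t => G₁ ξ t + G₂ ξ t) := .add h₁ h₂ fun _ _ _ => rfl

lemma sum {ι : Type*} (s : Finset ι) {G : ι → Ξ → (Fin (m + 1) → ℝ) → ℂ}
    (h : ∀ i ∈ s, IsTame p N B d (G i)) : IsTame p N B d (fun ξ t => ∑ i ∈ s, G i ξ t) := by
  induction s using Finset.induction_on with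
  | empty => simpa using zero
  | insert a s ha ih =>
    simp only [Finset.sum_insert ha]
    exact (h a (by simp)).add' (ih fun i hi => h i (by simp [hi]))

end IsTame

lemma IsElem.mul {Ξ : Type} [MeasurableSpace Ξ] {m : ℕ} {p : Finset (Fin (m + 1))} {N : ℕ}
    {B : Ξ → ℝ} {d d' : ℕ} {G₁ G₂ : Ξ → (Fin (m + 1) → ℝ) → ℂ} (hB : ∀ ξ, 1 ≤ B ξ)
    (h₁ : IsElem p N B d G₁) (h₂ : IsElem p N B d' G₂) :
    IsElem p N B (d + d') (fun ξ t => G₁ ξ t * G₂ ξ t) := by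
  obtain ⟨P, e, g, C, K, h1, h2, h3, h4, h5, h6, h7⟩ := h₁
  obtain ⟨P', e', g', C', K', h1', h2', h3', h4', h5', h6', h7'⟩ := h₂
  refine ⟨P ∩ P', e + e', fun ξ t => g ξ t * g' ξ t, C * C', K + K',
    Finset.inter_subset_left.trans h1, mul_nonneg h2 h2', h3.mul h3', ?_, ?_, ?_, ?_⟩
  · intro ξ k hk t x
    rw [Finset.mem_inter] at hk
    simp only [h4 ξ k hk.1, h4' ξ k hk.2]
  · intro ξ t ht
    have hB0 : 0 ≤ B ξ := zero_le_one.trans (hB ξ)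
    have hg : ∀ P : Finset (Fin (m + 1)), ∀ K, 0 ≤ ∏ k, growth p P N K k (t k) :=
      fun P K => Finset.prod_nonneg fun k _ => growth_nonneg ht k
    calc ‖g ξ t * g' ξ t‖ = ‖g ξ t‖ * ‖g' ξ t‖ := norm_mul _ _
      _ ≤ (C * B ξ ^ K * ∏ k, growth p P N K k (t k)) *
          (C' * B ξ ^ K' * ∏ k, growth p P' N K' k (t k)) :=
        mul_le_mul (h5 ξ t ht) (h5' ξ t ht) (norm_nonneg _)
          (mul_nonneg (mul_nonneg h2 (by positivity)) (hg _ _))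
      _ = C * C' * B ξ ^ (K + K') *
          ∏ k, (growth p P N K k (t k) * growth p P' N K' k (t k)) := by
        rw [Finset.prod_mul_distrib]; ring
      _ ≤ _ := by
        refine mul_le_mul_of_nonneg_left ?_ (mul_nonneg (mul_nonneg h2 h2') (by positivity))
        exact Finset.prod_le_prod
          (fun k _ => mul_nonneg (growth_nonneg ht k) (growth_nonneg ht k))
          fun k _ => growth_mul_le ht k
  · intro h
    rw [Finset.mem_inter] at h
    exact add_le_add (h6 h.1) (h6' h.2)
  · intro ξ t ht
    simp only [h7 ξ t ht, h7' ξ t ht, Pi.add_apply, pow_add, Finset.prod_mul_distrib]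
    ring

namespace IsTame

variable {Ξ : Type} [MeasurableSpace Ξ] {m : ℕ} {p : Finset (Fin (m + 1))} {N : ℕ}
  {B : Ξ → ℝ} {d d' : ℕ} {G G₁ G₂ : Ξ → (Fin (m + 1) → ℝ) → ℂ}

lemma mul (hB : ∀ ξ, 1 ≤ B ξ) (h₁ : IsTame p N B d G₁) (h₂ : IsTame p N B d' G₂) :
    IsTame p N B (d + d') (fun ξ t => G₁ ξ t * G₂ ξ t) := by
  induction h₁ with
  | elem h₁ =>
    induction h₂ with
    | elem h₂ => exact .elem (h₁.mul hB h₂)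
    | add _ _ h ih1 ih2 => exact .add ih1 ih2 fun ξ t ht => by rw [h ξ t ht, mul_add]
  | add _ _ h ih1 ih2 => exact .add ih1 ih2 fun ξ t ht => by rw [h ξ t ht, add_mul]

/-- A monomial with a coefficient depending on the parameter. -/
lemma monomial (hB : ∀ ξ, 1 ≤ B ξ) {c : Ξ → ℂ} (hc : Measurable c) {C : ℝ} {K : ℕ}
    (hC : ∀ ξ, ‖c ξ‖ ≤ C * B ξ ^ K) (e : Fin (m + 1) → ℕ) (hd : d ≤ e 0) :
    IsTame p N B d (fun ξ t => c ξ * ∏ k, (t k : ℂ) ^ e k) := by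
  refine .elem ⟨p, e, fun ξ _ => c ξ, |C|, K, le_rfl, abs_nonneg C, by fun_prop, by simp, ?_,
    fun _ => hd, fun ξ t _ => mul_comm _ _⟩
  intro ξ t ht
  have hB0 : 0 ≤ B ξ := zero_le_one.trans (hB ξ)
  have h1 : 1 ≤ ∏ k, growth p p N K k (t k) := by
    rw [← Finset.prod_const_one (s := (Finset.univ : Finset (Fin (m + 1))))]
    refine Finset.prod_le_prod (fun _ _ => zero_le_one) fun k _ => ?_
    have := ht k
    unfold growth
    split_ifs with h
    · exact le_rfl
    · rw [if_neg h] at this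
      exact one_le_pow₀ this.le
  calc ‖c ξ‖ ≤ C * B ξ ^ K := hC ξ
    _ ≤ |C| * B ξ ^ K := by gcongr; exact le_abs_self C
    _ ≤ _ := le_mul_of_one_le_right (by positivity) h1

lemma const (hB : ∀ ξ, 1 ≤ B ξ) (c : ℂ) : IsTame p N B 0 (fun _ _ => c) :=
  (monomial hB (c := fun _ => c) measurable_const (C := ‖c‖) (K := 0) (by simp) 0 le_rfl).congr
    (by simp)

lemma const_mul (hB : ∀ ξ, 1 ≤ B ξ) (c : ℂ) (h : IsTame p N B d G) :
    IsTame p N B d (fun ξ t => c * G ξ t) :=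
  ((const hB c).mul hB h).mono (by simp)

lemma pow (hB : ∀ ξ, 1 ≤ B ξ) (h : IsTame p N B d G) (j : ℕ) :
    IsTame p N B (j * d) (fun ξ t => G ξ t ^ j) := by
  induction j with
  | zero => simpa using const hB 1
  | succ j ih =>
    simp only [pow_succ, Nat.succ_mul]
    exact ih.mul hB h

lemma prod (hB : ∀ ξ, 1 ≤ B ξ) {ι : Type*} (s : Finset ι)
    {G : ι → Ξ → (Fin (m + 1) → ℝ) → ℂ} (h : ∀ i ∈ s, IsTame p N B 0 (G i)) :
    IsTame p N B 0 (fun ξ t => ∏ i ∈ s, G i ξ t) := by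
  induction s using Finset.induction_on with
  | empty => simpa using const hB 1
  | insert a s ha ih =>
    simp only [Finset.prod_insert ha]
    exact ((h a (by simp)).mul hB (ih fun i hi => h i (by simp [hi])))

end IsTame

/-- The remainder of the Taylor expansion of the exponential function. -/
def expRem (N : ℕ) (w : ℂ) : ℂ := exp w - ∑ j ∈ Finset.range N, w ^ j / j.factorial

lemma norm_expRem_le (N : ℕ) {w : ℂ} (hw : w.re ≤ 0) :
    ‖expRem N w‖ ≤ (N + 3) * ‖w‖ ^ N := by
  rcases le_total ‖w‖ 1 with h | h
  · have h1 := norm_exp_sub_sum_le_norm_mul_exp w N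
    have h2 : Real.exp ‖w‖ ≤ 3 :=
      (Real.exp_le_exp.2 h).trans Real.exp_one_lt_three.le
    have h3 : 0 ≤ ‖w‖ ^ N := by positivity
    have h4 : (0 : ℝ) ≤ N := by positivity
    calc _ ≤ ‖w‖ ^ N * Real.exp ‖w‖ := h1
      _ ≤ _ := by nlinarith
  · have h1 : ‖exp w‖ ≤ ‖w‖ ^ N := by
      rw [norm_exp]
      exact (Real.exp_le_one_iff.2 hw).trans (one_le_pow₀ h)
    have h2 : ‖∑ j ∈ Finset.range N, w ^ j / j.factorial‖ ≤ N * ‖w‖ ^ N := by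
      refine (norm_sum_le_of_le (Finset.range N) (f := fun j => w ^ j / (j.factorial : ℂ))
        (n := fun _ => ‖w‖ ^ N) fun j hj => ?_).trans (by simp)
      rw [norm_div, norm_pow, norm_natCast]
      refine (div_le_self (by positivity) (by exact_mod_cast j.factorial_pos)).trans ?_
      exact pow_le_pow_right₀ h (Finset.mem_range.1 hj).le
    have h3 : 0 ≤ ‖w‖ ^ N := by positivity
    calc _ ≤ _ := norm_sub_le _ _
      _ ≤ _ := by nlinarith

lemma measurable_expRem (N : ℕ) : Measurable (expRem N) := by
  unfold expRem
  fun_prop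

namespace IsTame

variable {Ξ : Type} [MeasurableSpace Ξ] {m : ℕ} {p : Finset (Fin (m + 1))} {N : ℕ}
  {B : Ξ → ℝ} {d d' : ℕ} {G G₁ G₂ : Ξ → (Fin (m + 1) → ℝ) → ℂ}

lemma expRem_prod (hB : ∀ ξ, 1 ≤ B ξ) {κ : Ξ → ℂ} (hκ : Measurable κ) {C : ℝ}
    (hC : ∀ ξ, ‖κ ξ‖ ≤ C * B ξ) (hre : ∀ ξ, (κ ξ).re ≤ 0) (s : Finset (Fin (m + 1)))
    (hd : 0 ∉ s → d = 0) :
    IsTame p N B d (fun ξ t => expRem N (κ ξ * ∏ k ∈ s, (t k : ℂ))) := by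
  refine .elem ⟨p \ s, 0, fun ξ t => expRem N (κ ξ * ∏ k ∈ s, (t k : ℂ)), (N + 3) * |C| ^ N, N,
    Finset.sdiff_subset, by positivity, ?_, ?_, ?_, ?_, by simp⟩
  · refine (measurable_expRem N).comp ?_
    refine (hκ.comp measurable_fst).mul ?_
    refine Finset.measurable_prod _ fun k _ => ?_
    fun_prop
  · intro ξ k hk t x
    rw [Finset.mem_sdiff] at hk
    dsimp only
    congr 2
    refine Finset.prod_congr rfl fun j hj => ?_
    rw [Function.update_of_ne]
    rintro rfl
    exact hk.2 hj
  · intro ξ t ht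
    have hB0 : 0 ≤ B ξ := zero_le_one.trans (hB ξ)
    have hpos : 0 ≤ ∏ k ∈ s, t k := Finset.prod_nonneg fun k _ => (poleBox_pos ht k).le
    have hre' : (κ ξ * ∏ k ∈ s, (t k : ℂ)).re ≤ 0 := by
      rw [← ofReal_prod, re_mul_ofReal]
      exact mul_nonpos_of_nonpos_of_nonneg (hre ξ) hpos
    have h1 : (∏ k ∈ s, t k) ^ N ≤ ∏ k, growth p (p \ s) N N k (t k) := by
      rw [← Finset.prod_pow, ← Fintype.prod_ite_mem]
      refine Finset.prod_le_prod (fun k _ => ?_) fun k _ => ?_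
      · have := poleBox_pos ht k
        split_ifs <;> positivity
      · have := ht k
        unfold growth
        by_cases hp : k ∈ p <;> by_cases hs : k ∈ s <;> simp [hp, hs] at this ⊢
        exact one_le_pow₀ this.le
    calc _ ≤ (N + 3) * ‖κ ξ * ∏ k ∈ s, (t k : ℂ)‖ ^ N := norm_expRem_le N hre'
      _ = (N + 3) * (‖κ ξ‖ ^ N * (∏ k ∈ s, t k) ^ N) := by
        rw [norm_mul, mul_pow, ← ofReal_prod, norm_real, Real.norm_of_nonneg hpos]
      _ ≤ (N + 3) * ((|C| * B ξ) ^ N * ∏ k, growth p (p \ s) N N k (t k)) := by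
        gcongr
        exact (hC ξ).trans (by gcongr; exact le_abs_self C)
      _ = _ := by rw [mul_pow]; ring
  · intro h
    rw [Finset.mem_sdiff] at h
    simp [hd h.2]

end IsTame

/-- Truncation of a product of two sums. -/
lemma sum_range_mul_sum_range {R : Type*} [CommRing R] (N : ℕ) (a b : ℕ → R) :
    (∑ i ∈ Finset.range N, a i) * (∑ j ∈ Finset.range N, b j) =
      (∑ k ∈ Finset.range N, ∑ q ∈ Finset.HasAntidiagonal.antidiagonal k, a q.1 * b q.2) +
      ∑ q ∈ (Finset.range N ×ˢ Finset.range N).filter (fun q => N ≤ q.1 + q.2),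
        a q.1 * b q.2 := by
  rw [Finset.sum_mul_sum, ← Finset.sum_product',
    ← Finset.sum_filter_add_sum_filter_not _ (fun q : ℕ × ℕ => q.1 + q.2 < N)]
  congr 1
  · rw [Finset.sum_sigma']
    refine Finset.sum_bij' (fun q _ => ⟨q.1 + q.2, q⟩) (fun q _ => q.2) ?_ ?_ ?_ ?_ ?_
    · intro q hq
      simp at hq ⊢
      omega
    · rintro ⟨k, q⟩ hq
      simp at hq ⊢
      omega
    · intro q _; rfl
    · rintro ⟨k, q⟩ hq
      simp at hq ⊢
      omega
    · intro q _; rfl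
  · simp

lemma sum_antidiagonal_pow_div_factorial (k : ℕ) (u v : ℂ) :
    ∑ q ∈ Finset.HasAntidiagonal.antidiagonal k, (u ^ q.1 / q.1.factorial) * (v ^ q.2 / q.2.factorial) =
      (u + v) ^ k / k.factorial := by
  rw [(Commute.all u v).add_pow', Finset.sum_div]
  refine Finset.sum_congr rfl fun q hq => ?_
  rw [← Finset.HasAntidiagonal.mem_antidiagonal.1 hq, Nat.choose_symm_add, Nat.add_choose, nsmul_eq_mul,
    Nat.cast_div (Nat.factorial_mul_factorial_dvd_factorial_add _ _)
      (by exact_mod_cast (mul_pos q.1.factorial_pos q.2.factorial_pos).ne')]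
  have h1 : (q.1.factorial : ℂ) ≠ 0 := by exact_mod_cast q.1.factorial_pos.ne'
  have h2 : (q.2.factorial : ℂ) ≠ 0 := by exact_mod_cast q.2.factorial_pos.ne'
  have h3 : ((q.1 + q.2).factorial : ℂ) ≠ 0 := by exact_mod_cast (q.1 + q.2).factorial_pos.ne'
  push_cast
  field_simp

namespace IsTame

variable {Ξ : Type} [MeasurableSpace Ξ] {m : ℕ} {p : Finset (Fin (m + 1))} {N : ℕ}
  {B : Ξ → ℝ} {d d' : ℕ} {G G₁ G₂ : Ξ → (Fin (m + 1) → ℝ) → ℂ}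

lemma sum_pow (hB : ∀ ξ, 1 ≤ B ξ) (h : IsTame p N B 1 G) (a : ℕ → ℂ) :
    IsTame p N B 0 (fun ξ t => ∑ j ∈ Finset.range N, a j * G ξ t ^ j) :=
  sum _ fun j _ => ((h.mono zero_le_one).pow hB j |>.mono (by simp)).const_mul hB (a j)

/-- If `G₁` and `G₂` are known up to flat terms then so is their product. -/
lemma mul_of_sub (hB : ∀ ξ, 1 ≤ B ξ) {A₁ A₂ F₁ F₂ : Ξ → (Fin (m + 1) → ℝ) → ℂ} {a b : ℕ → ℂ}
    (h₁ : IsTame p N B 1 A₁) (h₂ : IsTame p N B 1 A₂)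
    (hF₁ : IsTame p N B N (fun ξ t => F₁ ξ t - ∑ j ∈ Finset.range N, a j * A₁ ξ t ^ j))
    (hF₂ : IsTame p N B N (fun ξ t => F₂ ξ t - ∑ j ∈ Finset.range N, b j * A₂ ξ t ^ j)) :
    IsTame p N B N (fun ξ t => F₁ ξ t * F₂ ξ t - ∑ k ∈ Finset.range N,
      ∑ q ∈ Finset.HasAntidiagonal.antidiagonal k, a q.1 * A₁ ξ t ^ q.1 * (b q.2 * A₂ ξ t ^ q.2)) := by
  have hT₁ := sum_pow hB h₁ a
  have hT₂ := sum_pow hB h₂ b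
  have hR : IsTame p N B N (fun ξ t =>
      ∑ q ∈ (Finset.range N ×ˢ Finset.range N).filter (fun q => N ≤ q.1 + q.2),
        a q.1 * A₁ ξ t ^ q.1 * (b q.2 * A₂ ξ t ^ q.2)) := by
    refine sum _ fun q hq => ?_
    refine (((h₁.pow hB q.1).const_mul hB (a q.1)).mul hB
      ((h₂.pow hB q.2).const_mul hB (b q.2))).mono ?_
    simpa using (Finset.mem_filter.1 hq).2
  refine (((hF₁.mul hB hF₂).mono (d' := N) (by omega)).add'
    ((((hF₁.mul hB hT₂).mono (d' := N) (by omega)).add'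
      ((hT₁.mul hB hF₂).mono (d' := N) (by omega))).add' hR)).congr ?_
  intro ξ t _
  have := sum_range_mul_sum_range N (fun j => a j * A₁ ξ t ^ j) (fun j => b j * A₂ ξ t ^ j)
  linear_combination this

lemma expRem_add (hB : ∀ ξ, 1 ≤ B ξ) (h₁ : IsTame p N B 1 G₁) (h₂ : IsTame p N B 1 G₂)
    (hG₁ : IsTame p N B N (fun ξ t => expRem N (G₁ ξ t)))
    (hG₂ : IsTame p N B N (fun ξ t => expRem N (G₂ ξ t))) :
    IsTame p N B N (fun ξ t => expRem N (G₁ ξ t + G₂ ξ t)) := by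
  have := mul_of_sub hB (a := fun j => (j.factorial : ℂ)⁻¹) (b := fun j => (j.factorial : ℂ)⁻¹)
    h₁ h₂ (F₁ := fun ξ t => exp (G₁ ξ t)) (F₂ := fun ξ t => exp (G₂ ξ t))
    (hG₁.congr fun ξ t _ => by simp only [expRem, div_eq_inv_mul])
    (hG₂.congr fun ξ t _ => by simp only [expRem, div_eq_inv_mul])
  refine this.congr fun ξ t _ => ?_
  simp only [expRem, exp_add]
  congr 1
  refine Finset.sum_congr rfl fun k _ => ?_
  rw [← sum_antidiagonal_pow_div_factorial]
  refine Finset.sum_congr rfl fun q _ => ?_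
  ring

lemma mul_prod (hB : ∀ ξ, 1 ≤ B ξ) {κ : Ξ → ℂ} (hκ : Measurable κ) {C : ℝ}
    (hC : ∀ ξ, ‖κ ξ‖ ≤ C * B ξ) (s : Finset (Fin (m + 1))) (hd : d ≤ if 0 ∈ s then 1 else 0) :
    IsTame p N B d (fun ξ t => κ ξ * ∏ k ∈ s, (t k : ℂ)) := by
  refine (monomial (d := d) hB hκ (C := C) (K := 1) (by simpa using hC)
    (fun k => if k ∈ s then 1 else 0) hd).congr ?_
  intro ξ t _
  congr 1
  simp [pow_ite, Finset.prod_ite_mem]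

lemma exp_prod (hB : ∀ ξ, 1 ≤ B ξ) {κ : Ξ → ℂ} (hκ : Measurable κ) {C : ℝ}
    (hC : ∀ ξ, ‖κ ξ‖ ≤ C * B ξ) (hre : ∀ ξ, (κ ξ).re ≤ 0) (s : Finset (Fin (m + 1))) :
    IsTame p N B 0 (fun ξ t => exp (κ ξ * ∏ k ∈ s, (t k : ℂ))) := by
  refine (IsTame.add' (expRem_prod (N := N) hB hκ hC hre s (fun _ => rfl))
    (sum (Finset.range N) (G := fun j ξ t =>
      (j.factorial : ℂ)⁻¹ * (κ ξ * ∏ k ∈ s, (t k : ℂ)) ^ j) fun j _ => ?_)).congr ?_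
  · exact (((mul_prod hB hκ hC s (Nat.zero_le _)).pow hB j).const_mul hB _).mono (by simp)
  · intro ξ t _
    simp only [expRem]
    rw [sub_add_eq_add_sub, eq_sub_iff_add_eq]
    congr 1
    exact Finset.sum_congr rfl fun j _ => by ring

end IsTame

/-- A linear combination with non-negative coefficients of square-free monomials. -/
def multilin {m : ℕ} {ι : Type*} (b : Finset ι) (c : ι → ℝ) (s : ι → Finset (Fin (m + 1)))
    (t : Fin (m + 1) → ℝ) : ℝ := ∑ i ∈ b, c i * ∏ k ∈ s i, t k

namespace IsTame

variable {Ξ : Type} [MeasurableSpace Ξ] {m : ℕ} {p : Finset (Fin (m + 1))} {N : ℕ}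
  {B : Ξ → ℝ} {d d' : ℕ} {G G₁ G₂ : Ξ → (Fin (m + 1) → ℝ) → ℂ} {ι : Type*} {b : Finset ι}
  {c : ι → ℝ} {s : ι → Finset (Fin (m + 1))}

lemma mul_multilin (hB : ∀ ξ, 1 ≤ B ξ) {κ : Ξ → ℂ} (hκ : Measurable κ) {C : ℝ}
    (hC : ∀ ξ, ‖κ ξ‖ ≤ C * B ξ) (hd : ∀ i ∈ b, d ≤ if 0 ∈ s i then 1 else 0) :
    IsTame p N B d (fun ξ t => κ ξ * multilin b c s t) := by
  refine (sum b (G := fun i ξ t => (c i : ℂ) * (κ ξ * ∏ k ∈ s i, (t k : ℂ))) fun i hi =>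
    (mul_prod hB hκ hC (s i) (hd i hi)).const_mul hB _).congr fun ξ t _ => ?_
  simp only [multilin, ofReal_sum, ofReal_mul, ofReal_prod, Finset.mul_sum]
  exact Finset.sum_congr rfl fun i _ => by ring

lemma exp_multilin (hB : ∀ ξ, 1 ≤ B ξ) {κ : Ξ → ℂ} (hκ : Measurable κ) {C : ℝ}
    (hC : ∀ ξ, ‖κ ξ‖ ≤ C * B ξ) (hre : ∀ ξ, (κ ξ).re ≤ 0) (hc : ∀ i ∈ b, 0 ≤ c i) :
    IsTame p N B 0 (fun ξ t => exp (κ ξ * multilin b c s t)) := by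
  refine (prod hB b (G := fun i ξ t => exp ((κ ξ * c i) * ∏ k ∈ s i, (t k : ℂ))) fun i hi =>
    exp_prod hB (hκ.mul_const _) (C := C * |c i|) (fun ξ => ?_) (fun ξ => ?_) (s i)).congr
      fun ξ t _ => ?_
  · rw [norm_mul, norm_real, Real.norm_eq_abs, mul_right_comm]
    exact mul_le_mul_of_nonneg_right (hC ξ) (abs_nonneg _)
  · rw [re_mul_ofReal]
    exact mul_nonpos_of_nonpos_of_nonneg (hre ξ) (hc i hi)
  · rw [← exp_sum]
    simp only [multilin, ofReal_sum, ofReal_mul, ofReal_prod, Finset.mul_sum, mul_assoc]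

lemma expRem_multilin (hB : ∀ ξ, 1 ≤ B ξ) {κ : Ξ → ℂ} (hκ : Measurable κ) {C : ℝ}
    (hC : ∀ ξ, ‖κ ξ‖ ≤ C * B ξ) (hre : ∀ ξ, (κ ξ).re ≤ 0) (hc : ∀ i ∈ b, 0 ≤ c i)
    (hs : ∀ i ∈ b, 0 ∈ s i) :
    IsTame p N B N (fun ξ t => expRem N (κ ξ * multilin b c s t)) := by
  induction b using Finset.induction_on with
  | empty =>
    refine (expRem_prod (N := N) (d := N) hB (κ := fun _ => 0) measurable_const (C := 1) ?_ ?_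
      Finset.univ (by simp)).congr ?_
    · intro ξ; simpa using zero_le_one.trans (hB ξ)
    · simp
    · simp [multilin]
  | insert i b hi ih =>
    have h1 : IsTame p N B 1 (fun ξ t => κ ξ * multilin {i} c s t) :=
      mul_multilin hB hκ hC (by simp [hs i])
    have h2 : IsTame p N B 1 (fun ξ t => κ ξ * multilin b c s t) :=
      mul_multilin hB hκ hC fun j hj => by simp [hs j (by simp [hj])]
    refine (expRem_add hB h1 h2 ?_ (ih (fun j hj => hc j (by simp [hj]))
      (fun j hj => hs j (by simp [hj])))).congr ?_
    · refine (expRem_prod (N := N) (d := N) hB (hκ.mul_const (c i : ℂ)) (C := C * |c i|)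
        (fun ξ => ?_) (fun ξ => ?_) (s i) (by simp [hs i])).congr fun ξ t _ => ?_
      · rw [norm_mul, norm_real, Real.norm_eq_abs, mul_right_comm]
        exact mul_le_mul_of_nonneg_right (hC ξ) (abs_nonneg _)
      · rw [re_mul_ofReal]
        exact mul_nonpos_of_nonpos_of_nonneg (hre ξ) (hc i (by simp))
      · simp [multilin, mul_assoc]
    · intro ξ t _
      simp [multilin, Finset.sum_insert hi, mul_add]

end IsTame

/-- Tame functions without parameter. -/
def Tame {m : ℕ} (p : Finset (Fin (m + 1))) (N d : ℕ) (G : (Fin (m + 1) → ℝ) → ℂ) : Prop :=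
  IsTame p N (fun _ : Unit => (1 : ℝ)) d (fun _ => G)

section Integral

variable {Ξ : Type} [MeasurableSpace Ξ] {m : ℕ} {p : Finset (Fin (m + 1))} {N : ℕ}
  {B : Ξ → ℝ} {d : ℕ} {G : Ξ → (Fin (m + 1) → ℝ) → ℂ}

/-- The weight `w` has moments of all orders with respect to `B`. -/
def HasMoments (ν : Measure Ξ) (w : Ξ → ℂ) (B : Ξ → ℝ) : Prop :=
  Measurable w ∧ ∀ K : ℕ, Integrable (fun ξ => ‖w ξ‖ * B ξ ^ K) ν

lemma IsTame.integral_aux {ν : Measure Ξ} [SFinite ν] (hB : ∀ ξ, 1 ≤ B ξ)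
    {w : Ξ → ℂ} (hw : HasMoments ν w B) (h : IsTame p N B d G) :
    (∀ t ∈ poleBox p, Integrable (fun ξ => w ξ * G ξ t) ν) ∧
      Tame p N d (fun t => ∫ ξ, w ξ * G ξ t ∂ν) := by
  induction h with
  | @elem G h =>
    obtain ⟨P, e, g, C, K, h1, h2, h3, h4, h5, h6, h7⟩ := h
    have key : ∀ t ∈ poleBox p, Integrable (fun ξ => w ξ * g ξ t) ν := by
      intro t ht
      have hm : Measurable (fun ξ => w ξ * g ξ t) :=
        hw.1.mul (h3.comp (measurable_id.prodMk measurable_const))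
      refine ((hw.2 K).const_mul (C * ∏ k, growth p P N K k (t k))).mono'
        hm.aestronglyMeasurable (.of_forall fun ξ => ?_)
      rw [norm_mul]
      calc _ ≤ ‖w ξ‖ * (C * B ξ ^ K * ∏ k, growth p P N K k (t k)) := by
            gcongr; exact h5 ξ t ht
        _ = _ := by ring
    refine ⟨fun t ht => ?_, .elem ⟨P, e, fun _ t => ∫ ξ, w ξ * g ξ t ∂ν,
      C * ∫ ξ, ‖w ξ‖ * B ξ ^ K ∂ν, K, h1, ?_, ?_, ?_, ?_, h6, ?_⟩⟩
    · refine ((key t ht).const_mul (∏ k, (t k : ℂ) ^ e k)).congr (.of_forall fun ξ => ?_)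
      simp only [h7 ξ t ht]
      ring
    · refine mul_nonneg h2 (integral_nonneg fun ξ => ?_)
      have : 0 ≤ B ξ := zero_le_one.trans (hB ξ)
      positivity
    · have hm : Measurable (fun q : (Unit × (Fin (m + 1) → ℝ)) × Ξ => w q.2 * g q.2 q.1.2) :=
        (hw.1.comp measurable_snd).mul
          (h3.comp (measurable_snd.prodMk (measurable_snd.comp measurable_fst)))
      exact hm.stronglyMeasurable.integral_prod_right.measurable
    · intro _ k hk t x
      simp only [h4 _ k hk]
    · intro _ t ht
      refine (norm_integral_le_integral_norm _).trans ?_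
      calc ∫ ξ, ‖w ξ * g ξ t‖ ∂ν
          ≤ ∫ ξ, (C * ∏ k, growth p P N K k (t k)) * (‖w ξ‖ * B ξ ^ K) ∂ν := by
            refine integral_mono (key t ht).norm ((hw.2 K).const_mul _) fun ξ => ?_
            simp only [norm_mul]
            calc _ ≤ ‖w ξ‖ * (C * B ξ ^ K * ∏ k, growth p P N K k (t k)) := by
                  gcongr; exact h5 ξ t ht
              _ = _ := by ring
        _ = _ := by rw [integral_const_mul]; ring
    · intro _ t ht
      rw [← integral_const_mul]
      refine integral_congr_ae (.of_forall fun ξ => ?_)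
      simp only [h7 ξ t ht]
      ring
  | add _ _ h ih1 ih2 =>
    refine ⟨fun t ht => ?_, .add ih1.2 ih2.2 fun _ t ht => ?_⟩
    · simp only [h _ t ht, mul_add]
      exact (ih1.1 t ht).add (ih2.1 t ht)
    · simp only [h _ t ht, mul_add]
      exact integral_add (ih1.1 t ht) (ih2.1 t ht)

end Integral

section Tame

variable {m : ℕ} {p : Finset (Fin (m + 1))} {N d d' : ℕ} {G G₁ G₂ : (Fin (m + 1) → ℝ) → ℂ}

lemma Tame.congr (h : Tame p N d G₁) (h' : ∀ t ∈ poleBox p, G t = G₁ t) : Tame p N d G :=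
  IsTame.congr h fun _ => h'

lemma Tame.mono (h : Tame p N d G) (hd : d' ≤ d) : Tame p N d' G := IsTame.mono h hd

lemma Tame.mul (h₁ : Tame p N d G₁) (h₂ : Tame p N d' G₂) :
    Tame p N (d + d') (fun t => G₁ t * G₂ t) := IsTame.mul (fun _ => le_rfl) h₁ h₂

lemma Tame.add (h₁ : Tame p N d G₁) (h₂ : Tame p N d G₂) :
    Tame p N d (fun t => G₁ t + G₂ t) := IsTame.add' h₁ h₂

lemma Tame.const_mul (c : ℂ) (h : Tame p N d G) : Tame p N d (fun t => c * G t) :=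
  IsTame.const_mul (fun _ => le_rfl) c h

lemma Tame.const (c : ℂ) : Tame p N 0 (fun _ => c) := IsTame.const (fun _ => le_rfl) c

lemma Tame.sum {ι : Type*} (s : Finset ι) {G : ι → (Fin (m + 1) → ℝ) → ℂ}
    (h : ∀ i ∈ s, Tame p N d (G i)) : Tame p N d (fun t => ∑ i ∈ s, G i t) := IsTame.sum s h

lemma Tame.pow (h : Tame p N d G) (j : ℕ) : Tame p N (j * d) (fun t => G t ^ j) :=
  IsTame.pow (fun _ => le_rfl) h j

lemma Tame.prod {ι : Type*} (s : Finset ι) {G : ι → (Fin (m + 1) → ℝ) → ℂ}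
    (h : ∀ i ∈ s, Tame p N 0 (G i)) : Tame p N 0 (fun t => ∏ i ∈ s, G i t) :=
  IsTame.prod (fun _ => le_rfl) s h

lemma Tame.multilin {ι : Type*} {b : Finset ι} {c : ι → ℝ} {s : ι → Finset (Fin (m + 1))}
    (hd : ∀ i ∈ b, d ≤ if 0 ∈ s i then 1 else 0) :
    Tame p N d (fun t => (multilin b c s t : ℂ)) :=
  (IsTame.mul_multilin (b := b) (c := c) (fun _ => le_rfl) (κ := fun _ : Unit => 1)
    measurable_const (C := 1) (by simp) hd).congr (by simp)

lemma multilin_nonneg {ι : Type*} {b : Finset ι} {c : ι → ℝ} {s : ι → Finset (Fin (m + 1))}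
    (hc : ∀ i ∈ b, 0 ≤ c i) {t : Fin (m + 1) → ℝ} (ht : t ∈ poleBox p) :
    0 ≤ _root_.multilin b c s t :=
  Finset.sum_nonneg fun i hi => mul_nonneg (hc i hi)
    (Finset.prod_nonneg fun k _ => (poleBox_pos ht k).le)

end Tame

/-- The function `f` on `[0, ∞)` has the asymptotic expansion `A` at zero, in a form that can be
substituted into tame functions. -/
def HasExpansion (f : ℝ → ℂ) (A : PowerSeries ℂ) : Prop :=
  ∀ (m : ℕ) (p : Finset (Fin (m + 1))) (N : ℕ) (ι : Type) (b : Finset ι) (c : ι → ℝ)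
    (s : ι → Finset (Fin (m + 1))), (∀ i ∈ b, 0 ≤ c i) → (∀ i ∈ b, 0 ∈ s i) →
    Tame p N N (fun t => f (multilin b c s t) -
      ∑ j ∈ Finset.range N, PowerSeries.coeff j A * (multilin b c s t : ℂ) ^ j)

namespace HasExpansion

variable {f g : ℝ → ℂ} {A A' : PowerSeries ℂ}

lemma congr (h : HasExpansion f A) (hfg : ∀ y, 0 ≤ y → g y = f y) : HasExpansion g A := by
  intro m p N ι b c s hc hs
  exact (h m p N ι b c s hc hs).congr fun t ht => by rw [hfg _ (multilin_nonneg hc ht)]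

lemma add (hf : HasExpansion f A) (hg : HasExpansion g A') :
    HasExpansion (fun y => f y + g y) (A + A') := by
  intro m p N ι b c s hc hs
  refine ((hf m p N ι b c s hc hs).add (hg m p N ι b c s hc hs)).congr fun t _ => ?_
  simp only [map_add, add_mul, Finset.sum_add_distrib]
  ring

lemma mul (hf : HasExpansion f A) (hg : HasExpansion g A') :
    HasExpansion (fun y => f y * g y) (A * A') := by
  intro m p N ι b c s hc hs
  have hY : Tame p N 1 (fun t => (multilin b c s t : ℂ)) :=
    Tame.multilin fun i hi => by simp [hs i hi]
  refine (IsTame.mul_of_sub (fun _ => le_rfl) hY hY (hf m p N ι b c s hc hs)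
    (hg m p N ι b c s hc hs)).congr fun _ t _ => ?_
  congr 1
  refine Finset.sum_congr rfl fun k _ => ?_
  rw [PowerSeries.coeff_mul, Finset.sum_mul]
  refine Finset.sum_congr rfl fun q hq => ?_
  rw [← Finset.HasAntidiagonal.mem_antidiagonal.1 hq, pow_add]
  ring

lemma const (a : ℂ) : HasExpansion (fun _ => a) (PowerSeries.C a) := by
  intro m p N ι b c s hc hs
  rcases N with - | N
  · simpa using Tame.const a
  · refine (IsTame.zero : Tame p (N + 1) (N + 1) fun _ => 0).congr fun t _ => ?_
    rw [Finset.sum_range_succ']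
    simp [PowerSeries.coeff_C]

lemma id : HasExpansion (fun y => (y : ℂ)) PowerSeries.X := by
  intro m p N ι b c s hc hs
  rcases N with - | - | N
  · simpa using Tame.multilin (d := 0) fun _ _ => Nat.zero_le _
  · simpa using Tame.multilin (d := 1) fun i hi => by simp [hs i hi]
  · refine (IsTame.zero : Tame p (N + 2) (N + 2) fun _ => 0).congr fun t _ => ?_
    rw [Finset.sum_range_succ', Finset.sum_range_succ']
    simp [PowerSeries.coeff_X]

lemma integral_exp {Ξ : Type} [MeasurableSpace Ξ] {ν : Measure Ξ} [SFinite ν] {B : Ξ → ℝ}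
    (hB : ∀ ξ, 1 ≤ B ξ) {w : Ξ → ℂ} (hw : HasMoments ν w B)
    {κ : Ξ → ℂ} (hκ : Measurable κ) {C : ℝ} (hC : ∀ ξ, ‖κ ξ‖ ≤ C * B ξ)
    (hre : ∀ ξ, (κ ξ).re ≤ 0) :
    HasExpansion (fun y => ∫ ξ, w ξ * exp (κ ξ * y) ∂ν)
      (PowerSeries.mk fun j => (∫ ξ, w ξ * κ ξ ^ j ∂ν) / j.factorial) := by
  intro m p N ι b c s hc hs
  have h1 := IsTame.expRem_multilin (p := p) (N := N) hB hκ hC hre hc hs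
  have h2 := IsTame.exp_multilin (p := p) (N := N) (s := s) hB hκ hC hre hc
  refine (h1.integral_aux (ν := ν) hB hw).2.congr fun t ht => ?_
  have hi1 := (h2.integral_aux (ν := ν) hB hw).1 t ht
  have hi2 : ∀ j, Integrable (fun ξ => w ξ * κ ξ ^ j) ν := by
    intro j
    refine ((hw.2 j).const_mul (C ^ j)).mono' (hw.1.mul (hκ.pow_const j)).aestronglyMeasurable
      (.of_forall fun ξ => ?_)
    rw [norm_mul, norm_pow]
    calc _ ≤ ‖w ξ‖ * (C * B ξ) ^ j := by gcongr; exact hC ξ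
      _ = _ := by ring
  have hi3 : ∀ j ∈ Finset.range N, Integrable (fun ξ => w ξ * κ ξ ^ j *
      ((multilin b c s t : ℂ) ^ j / j.factorial)) ν := fun j _ => (hi2 j).mul_const _
  have : ∀ ξ, w ξ * expRem N (κ ξ * multilin b c s t) = w ξ * exp (κ ξ * multilin b c s t) -
      ∑ j ∈ Finset.range N, w ξ * κ ξ ^ j * ((multilin b c s t : ℂ) ^ j / j.factorial) := by
    intro ξ
    rw [expRem, mul_sub, Finset.mul_sum]
    congr 1
    exact Finset.sum_congr rfl fun j _ => by rw [mul_pow]; ring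
  simp only [this]
  rw [integral_sub hi1 (integrable_finsetSum _ hi3), integral_finsetSum _ hi3]
  congr 1
  refine Finset.sum_congr rfl fun j _ => ?_
  rw [integral_mul_const, PowerSeries.coeff_mk]
  ring

lemma exp {κ : ℂ} (hκ : κ.re ≤ 0) :
    HasExpansion (fun y => Complex.exp (κ * y)) (PowerSeries.mk fun j => κ ^ j / j.factorial) := by
  have := integral_exp (Ξ := Unit) (ν := Measure.dirac ()) (B := fun _ => 1) (fun _ => le_rfl)
    (w := fun _ => 1) ⟨measurable_const, by simp⟩ (κ := fun _ => κ) measurable_const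
    (C := ‖κ‖) (by simp) (fun _ => hκ)
  simpa using this

lemma tame (h : HasExpansion f A) {m : ℕ} (p : Finset (Fin (m + 1))) (N : ℕ) {ι : Type}
    {b : Finset ι} {c : ι → ℝ} {s : ι → Finset (Fin (m + 1))} (hc : ∀ i ∈ b, 0 ≤ c i)
    (hs : ∀ i ∈ b, 0 ∈ s i) : Tame p N 0 (fun t => f (multilin b c s t)) := by
  have hY : Tame p N 1 (fun t => (multilin b c s t : ℂ)) :=
    Tame.multilin fun i hi => by simp [hs i hi]
  refine (((h m p N ι b c s hc hs).mono (Nat.zero_le _)).add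
    (IsTame.sum_pow (fun _ => le_rfl) hY fun j => PowerSeries.coeff j A)).congr fun t _ => ?_
  ring

end HasExpansion

lemma one_add_pow_mul_exp_le {a : ℝ} (ha : 0 < a) (K : ℕ) :
    ∃ C : ℝ, 0 ≤ C ∧ ∀ a', a ≤ a' → ∀ v, 0 ≤ v →
      Real.exp (-(a' * v)) * (1 + v) ^ K ≤ C * Real.exp (-(a' / 2 * v)) := by
  refine ⟨K.factorial * (2 / a) ^ K * Real.exp (a / 2), by positivity, fun a' ha' v hv => ?_⟩
  have h1 := Real.pow_div_factorial_le_exp (a / 2 * (1 + v)) (by positivity) K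
  rw [div_le_iff₀ (by positivity), mul_pow] at h1
  have h2 : (1 + v) ^ K = (2 / a) ^ K * ((a / 2) ^ K * (1 + v) ^ K) := by
    rw [← mul_assoc, ← mul_pow]
    field_simp
    simp
  have h3 : Real.exp (a / 2 * (1 + v)) ≤ Real.exp (a / 2) * Real.exp (a' / 2 * v) := by
    rw [← Real.exp_add]
    refine Real.exp_le_exp.2 ?_
    nlinarith
  have h4 : Real.exp (-(a' / 2 * v)) = Real.exp (-(a' * v)) * Real.exp (a' / 2 * v) := by
    rw [← Real.exp_add]; ring_nf
  rw [h4]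
  calc _ ≤ Real.exp (-(a' * v)) * ((2 / a) ^ K *
        (Real.exp (a / 2) * Real.exp (a' / 2 * v) * K.factorial)) := by
        rw [h2]
        refine mul_le_mul_of_nonneg_left (mul_le_mul_of_nonneg_left ?_ (by positivity))
          (Real.exp_pos _).le
        exact h1.trans (by gcongr)
    _ = _ := by ring

lemma integrableOn_exp_neg_mul {a : ℝ} (ha : 0 < a) :
    IntegrableOn (fun v => Real.exp (-(a * v))) (Set.Ioi 0) := by
  simpa using integrableOn_exp_mul_Ioi (a := -a) (by linarith) 0

lemma hasMoments_exp {a : ℝ} (ha : 0 < a) :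
    HasMoments (volume.restrict (Set.Ioi (0 : ℝ))) (fun v => ((Real.exp (-(a * v)) : ℝ) : ℂ))
      (fun v => 1 + |v|) := by
  refine ⟨by fun_prop, fun K => ?_⟩
  obtain ⟨C, hC, h⟩ := one_add_pow_mul_exp_le ha K
  refine ((integrableOn_exp_neg_mul (half_pos ha)).const_mul C).mono'
    (by fun_prop) ?_
  filter_upwards [ae_restrict_mem measurableSet_Ioi] with v hv
  have hv' : 0 ≤ v := le_of_lt hv
  have := h a le_rfl v hv'
  rw [norm_real, Real.norm_of_nonneg (Real.exp_pos _).le, abs_of_nonneg hv',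
    Real.norm_of_nonneg (by positivity)]
  exact this

/-- The reciprocal of a positive constant plus a non-negative combination of monomials. -/
lemma Tame.inv_multilin {m : ℕ} (p : Finset (Fin (m + 1))) (N : ℕ) {ι : Type*} {b : Finset ι}
    {c : ι → ℝ} {s : ι → Finset (Fin (m + 1))} {a : ℝ} (ha : 0 < a) (hc : ∀ i ∈ b, 0 ≤ c i) :
    Tame p N 0 (fun t => ((a + _root_.multilin b c s t : ℝ) : ℂ)⁻¹) := by
  have h := IsTame.exp_multilin (p := p) (N := N) (s := s) (B := fun v : ℝ => 1 + |v|)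
    (fun v => by simp) (κ := fun v => ((-max v 0 : ℝ) : ℂ)) (by fun_prop) (C := 1) (fun v => by
      rw [norm_real, norm_neg, Real.norm_of_nonneg (le_max_right _ _), one_mul]
      exact max_le ((le_abs_self v).trans (by linarith)) (by positivity)) (fun v => by
      simp) hc
  refine (h.integral_aux (fun v => by simp) (hasMoments_exp ha)).2.congr fun t ht => ?_
  have hY := multilin_nonneg (s := s) hc ht
  set Y := _root_.multilin b c s t
  have h1 : ∫ v in Set.Ioi (0 : ℝ), Real.exp (-(a + Y) * v) = (a + Y)⁻¹ := by
    rw [integral_exp_mul_Ioi (by linarith)]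
    rw [mul_zero, Real.exp_zero, neg_div_neg_eq, one_div]
  rw [← ofReal_inv, ← h1, ← integral_complex_ofReal]
  refine setIntegral_congr_fun measurableSet_Ioi fun v hv => ?_
  rw [Set.mem_Ioi] at hv
  simp only [max_eq_left hv.le]
  rw [← ofReal_mul, ← ofReal_exp, ← ofReal_mul, ← Real.exp_add]
  ring_nf

/-- Holomorphic dependence on a parameter of a locally dominated integral. -/
lemma differentiableOn_integral_of_locally_bounded {α : Type*} [MeasurableSpace α]
    {μ : Measure α} {Ω : Set ℂ} (hΩ : IsOpen Ω) {f : ℂ → α → ℂ}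
    (hm : ∀ s ∈ Ω, AEStronglyMeasurable (f s) μ)
    (hd : ∀ᵐ t ∂μ, DifferentiableOn ℂ (fun s => f s t) Ω)
    (hb : ∀ s₀ ∈ Ω, ∃ ε > 0, ∃ bound : α → ℝ, Integrable bound μ ∧
      ∀ᵐ t ∂μ, ∀ s ∈ Ω, s ∈ Metric.ball s₀ ε → ‖f s t‖ ≤ bound t) :
    DifferentiableOn ℂ (fun s => ∫ t, f s t ∂μ) Ω := by
  intro s₀ hs₀
  obtain ⟨ε, hε, bound, hbi, hbound⟩ := hb s₀ hs₀
  obtain ⟨δ', hδ', hδΩ⟩ := Metric.isOpen_iff.1 hΩ s₀ hs₀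
  set δ := min ε δ' / 3 with hδdef
  have hmin : 0 < min ε δ' := lt_min hε hδ'
  have hδ : 0 < δ := by positivity
  have h1 : ∀ s ∈ Metric.ball s₀ δ, Metric.closedBall s δ ⊆ Ω ∩ Metric.ball s₀ ε := by
    intro s hs z hz
    rw [Metric.mem_ball] at hs
    rw [Metric.mem_closedBall] at hz
    have h2 : dist z s₀ < min ε δ' := by
      have := dist_triangle z s s₀
      linarith
    exact ⟨hδΩ (h2.trans_le (min_le_right _ _)), h2.trans_le (min_le_left _ _)⟩
  have hsub : Metric.ball s₀ δ ⊆ Ω := fun s hs =>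
    (h1 s hs (Metric.mem_closedBall_self hδ.le)).1
  have hdiff : ∀ᵐ t ∂μ, ∀ s ∈ Metric.ball s₀ δ,
      HasDerivAt (fun s => f s t) (deriv (fun s => f s t) s) s := by
    filter_upwards [hd] with t ht s hs
    exact ((ht s (hsub hs)).differentiableAt (hΩ.mem_nhds (hsub hs))).hasDerivAt
  have hmem₀ : s₀ ∈ Metric.ball s₀ δ := Metric.mem_ball_self hδ
  refine (hasDerivAt_integral_of_dominated_loc_of_deriv_le (s := Metric.ball s₀ δ)
    (Metric.ball_mem_nhds s₀ hδ) (F' := fun s t => deriv (fun s => f s t) s)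
    (bound := fun t => bound t / δ) ?_ ?_ ?_ ?_ (hbi.div_const _) hdiff).2
      |>.differentiableAt.differentiableWithinAt
  · filter_upwards [hΩ.mem_nhds hs₀] with s hs using hm s hs
  · refine hbi.mono' (hm s₀ hs₀) ?_
    filter_upwards [hbound] with t ht
    exact ht s₀ hs₀ (Metric.mem_ball_self hε)
  · set u : ℕ → ℂ := fun k => ((δ / 2 * (1 / ((k : ℝ) + 1)) : ℝ) : ℂ) with hu
    have hu0 : ∀ k, u k ≠ 0 := fun k => by
      simp only [hu, ne_eq, ofReal_eq_zero]
      positivity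
    have hulim : Filter.Tendsto u Filter.atTop (nhdsWithin 0 {0}ᶜ) := by
      refine tendsto_nhdsWithin_iff.2 ⟨?_, .of_forall hu0⟩
      have := (tendsto_one_div_add_atTop_nhds_zero_nat (𝕜 := ℝ)).const_mul (δ / 2)
      rw [mul_zero] at this
      exact (continuous_ofReal.tendsto 0).comp this |>.trans (by simp)
    have humem : ∀ k, s₀ + u k ∈ Ω := by
      intro k
      refine hsub ?_
      rw [Metric.mem_ball, dist_self_add_left, norm_real, Real.norm_of_nonneg (by positivity)]
      have : 1 / ((k : ℝ) + 1) ≤ 1 := by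
        rw [div_le_one (by positivity)]
        linarith [(Nat.cast_nonneg k : (0 : ℝ) ≤ k)]
      nlinarith
    refine aestronglyMeasurable_of_tendsto_ae Filter.atTop
      (f := fun k t => (u k)⁻¹ • (f (s₀ + u k) t - f s₀ t)) (fun k => ?_) ?_
    · exact ((hm _ (humem k)).sub (hm s₀ hs₀)).const_smul ((u k)⁻¹)
    · filter_upwards [hdiff] with t ht
      exact (hasDerivAt_iff_tendsto_slope_zero.1 (ht s₀ hmem₀)).comp hulim
  · filter_upwards [hd, hbound] with t ht hbt s hs
    refine norm_deriv_le_of_forall_mem_sphere_norm_le hδ ?_ fun z hz => ?_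
    · refine DifferentiableOn.diffContOnCl ?_
      rw [closure_ball s hδ.ne']
      exact ht.mono fun z hz => (h1 s hs hz).1
    · have := h1 s hs (Metric.sphere_subset_closedBall hz)
      exact hbt z this.1 this.2

lemma integral_pi_mul_of_indep {m : ℕ} {μ : Fin (m + 1) → Measure ℝ} [∀ i, SigmaFinite (μ i)]
    (k : Fin (m + 1)) [IsProbabilityMeasure (μ k)] (φ : ℝ → ℂ) {A : (Fin (m + 1) → ℝ) → ℂ}
    (hA : ∀ t x, A (Function.update t k x) = A t) :
    ∫ t, φ (t k) * A t ∂Measure.pi μ = (∫ x, φ x ∂μ k) * ∫ t, A t ∂Measure.pi μ ∧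
    (Integrable φ (μ k) → Integrable A (Measure.pi μ) →
      Integrable (fun t => φ (t k) * A t) (Measure.pi μ)) := by
  have hmp := measurePreserving_piFinSuccAbove μ k
  set e := MeasurableEquiv.piFinSuccAbove (fun _ : Fin (m + 1) => ℝ) k
  set A' : (Fin m → ℝ) → ℂ := fun u => A (k.insertNth 0 u) with hA'
  have hAe : ∀ t, A t = A' (e t).2 := by
    intro t
    have : (e t).2 = k.removeNth t := rfl
    rw [hA', this]
    simp only [Fin.insertNth_removeNth, hA]
  have hφe : ∀ t, φ (t k) = φ (e t).1 := fun t => rfl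
  have h1 : ∀ φ : ℝ → ℂ, ∫ t, φ (t k) * A t ∂Measure.pi μ =
      (∫ x, φ x ∂μ k) * ∫ u, A' u ∂Measure.pi fun j => μ (k.succAbove j) := by
    intro φ
    rw [← integral_prod_mul, ← hmp.integral_comp e.measurableEmbedding]
    exact integral_congr_ae (.of_forall fun t => by
      simp only [hAe t]; rfl)
  have h2 := h1 fun _ => 1
  simp only [one_mul, integral_const, probReal_univ, one_smul] at h2
  refine ⟨by rw [h1, h2], fun hφ hInt => ?_⟩
  have h3 : Integrable A' (Measure.pi fun j => μ (k.succAbove j)) := by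
    have h4 : Integrable (fun q : ℝ × (Fin m → ℝ) => A' q.2)
        ((μ k).prod (Measure.pi fun j => μ (k.succAbove j))) := by
      rw [← hmp.integrable_comp_emb e.measurableEmbedding]
      exact hInt.congr (.of_forall fun t => by simp only [hAe t]; rfl)
    exact (h4.prod_right_ae).exists.choose_spec
  have h5 := hφ.mul_prod h3
  rw [← hmp.integrable_comp_emb e.measurableEmbedding] at h5
  exact h5.congr (.of_forall fun t => by simp only [hAe t]; rfl)

lemma integral_pi_prod_mul_of_indep {m : ℕ} {μ : Fin (m + 1) → Measure ℝ}
    [∀ i, SigmaFinite (μ i)] (P : Finset (Fin (m + 1)))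
    (hμ : ∀ k ∈ P, IsProbabilityMeasure (μ k)) (φ : Fin (m + 1) → ℝ → ℂ)
    {A : (Fin (m + 1) → ℝ) → ℂ} (hA : ∀ k ∈ P, ∀ t x, A (Function.update t k x) = A t) :
    ∫ t, (∏ k ∈ P, φ k (t k)) * A t ∂Measure.pi μ =
      (∏ k ∈ P, ∫ x, φ k x ∂μ k) * ∫ t, A t ∂Measure.pi μ ∧
    ((∀ k ∈ P, Integrable (φ k) (μ k)) → Integrable A (Measure.pi μ) →
      Integrable (fun t => (∏ k ∈ P, φ k (t k)) * A t) (Measure.pi μ)) := by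
  induction P using Finset.induction_on with
  | empty => simp
  | insert k P hk ih =>
    have ih := ih (fun j hj => hμ j (by simp [hj])) (fun j hj => hA j (by simp [hj]))
    have := hμ k (by simp)
    have h := integral_pi_mul_of_indep (μ := μ) k (φ k)
      (A := fun t => (∏ k ∈ P, φ k (t k)) * A t) (fun t x => by
        rw [hA k (by simp)]
        congr 1
        refine Finset.prod_congr rfl fun j hj => ?_
        rw [Function.update_of_ne]
        rintro rfl
        exact hk hj)
    simp only [Finset.prod_insert hk, mul_assoc]
    exact ⟨by rw [h.1, ih.1], fun h1 h2 => h.2 (h1 k (by simp))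
      (ih.2 (fun j hj => h1 j (by simp [hj])) h2)⟩

section Val

variable {m : ℕ}

/-- Lebesgue measure on `poleBox p`. -/
def boxMeasure (p : Finset (Fin (m + 1))) : Measure (Fin (m + 1) → ℝ) :=
  Measure.pi fun k => volume.restrict (if k ∈ p then Set.Ioo 0 1 else Set.Ioi 1)

lemma ae_mem_poleBox (p : Finset (Fin (m + 1))) : ∀ᵐ t ∂boxMeasure p, t ∈ poleBox p := by
  have : boxMeasure p = (volume : Measure (Fin (m + 1) → ℝ)).restrict
      (Set.univ.pi fun k => if k ∈ p then Set.Ioo 0 1 else Set.Ioi 1) :=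
    (Measure.restrict_pi_pi _ _).symm
  rw [this]
  filter_upwards [ae_restrict_mem (MeasurableSet.univ_pi fun k => by
    split_ifs
    · exact measurableSet_Ioo
    · exact measurableSet_Ioi)] with t ht k
  have := ht k (Set.mem_univ k)
  split_ifs with h <;> simpa [h] using this

/-- The monomial with exponents affine in `s`. -/
def mellinKernel (a b : Fin (m + 1) → ℕ) (s : ℂ) (t : Fin (m + 1) → ℝ) : ℂ :=
  ∏ k, (t k : ℂ) ^ ((a k : ℂ) * s - b k - 1)

/-- Admissible weights on `poleBox p`: they do not depend on the coordinates in `p` and decay fast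
in the other coordinates. -/
structure IsWeight (p : Finset (Fin (m + 1))) (ω : (Fin (m + 1) → ℝ) → ℝ) : Prop where
  measurable : Measurable ω
  nonneg : ∀ t, 0 ≤ ω t
  indep : ∀ k ∈ p, ∀ t x, ω (Function.update t k x) = ω t
  integrable : ∀ K, Integrable (fun t => ω t * ∏ k, growth p p 0 K k (t k)) (boxMeasure p)

/-- The half plane to the right of `-(ℓ + 1)`. -/
def rightHalf (l : ℕ) : Set ℂ := {s | -((l : ℝ) + 1) < s.re}

lemma isOpen_rightHalf (l : ℕ) : IsOpen (rightHalf l) :=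
  isOpen_lt continuous_const continuous_re

lemma neg_mem_rightHalf (l : ℕ) : -(l : ℂ) ∈ rightHalf l := by
  simp [rightHalf]

/-- `F`, given by values on a right half plane, has a meromorphic continuation to a neighbourhood
of `-ℓ` with a pole of order at most `n` there, and `c` is the coefficient of `(s + ℓ)⁻ⁿ`. -/
def HasPolarCoeff (l n : ℕ) (F : ℂ → ℂ) (c : ℂ) : Prop :=
  ∃ (R : ℝ) (Φ : ℂ → ℂ), MeromorphicOn Φ (rightHalf l) ∧ (∀ s : ℂ, R < s.re → Φ s = F s) ∧
    Filter.Tendsto (fun s => (s + l) ^ n * Φ s) (nhdsWithin (-(l : ℂ)) {-(l : ℂ)}ᶜ) (nhds c)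

lemma HasPolarCoeff.congr {l n : ℕ} {F F' : ℂ → ℂ} {c : ℂ} (h : HasPolarCoeff l n F c)
    (R' : ℝ) (h' : ∀ s : ℂ, R' < s.re → F' s = F s) : HasPolarCoeff l n F' c := by
  obtain ⟨R, Φ, h1, h2, h3⟩ := h
  refine ⟨max R R', Φ, h1, fun s hs => ?_, h3⟩
  rw [h2 s ((le_max_left _ _).trans_lt hs), h' s ((le_max_right _ _).trans_lt hs)]

lemma HasPolarCoeff.add {l n : ℕ} {F F' : ℂ → ℂ} {c c' : ℂ} (h : HasPolarCoeff l n F c)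
    (h' : HasPolarCoeff l n F' c') : HasPolarCoeff l n (fun s => F s + F' s) (c + c') := by
  obtain ⟨R, Φ, h1, h2, h3⟩ := h
  obtain ⟨R', Φ', h1', h2', h3'⟩ := h'
  refine ⟨max R R', fun s => Φ s + Φ' s, h1.add h1', fun s hs => ?_, ?_⟩
  · simp only
    rw [h2 s ((le_max_left _ _).trans_lt hs), h2' s ((le_max_right _ _).trans_lt hs)]
  · simpa only [mul_add] using h3.add h3'

lemma HasPolarCoeff.const_mul {l n : ℕ} {F : ℂ → ℂ} {c : ℂ} (a : ℂ) (h : HasPolarCoeff l n F c) :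
    HasPolarCoeff l n (fun s => a * F s) (a * c) := by
  obtain ⟨R, Φ, h1, h2, h3⟩ := h
  refine ⟨R, fun s => a * Φ s, (MeromorphicOn.const a).mul h1,
    fun s hs => by simp only [h2 s hs], ?_⟩
  refine (h3.const_mul a).congr fun s => ?_
  ring

lemma HasPolarCoeff.zero {l n : ℕ} : HasPolarCoeff l n (fun _ => 0) 0 :=
  ⟨0, fun _ => 0, MeromorphicOn.const 0, fun _ _ => rfl, by simp⟩

lemma HasPolarCoeff.sum {l n : ℕ} {ι : Type*} (u : Finset ι) {F : ι → ℂ → ℂ} {c : ι → ℂ}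
    (h : ∀ i ∈ u, HasPolarCoeff l n (F i) (c i)) :
    HasPolarCoeff l n (fun s => ∑ i ∈ u, F i s) (∑ i ∈ u, c i) := by
  induction u using Finset.induction_on with
  | empty => simpa using HasPolarCoeff.zero
  | insert i u hi ih =>
    simp only [Finset.sum_insert hi]
    exact (h i (by simp)).add (ih fun j hj => h j (by simp [hj]))

/-- `c` is the leading polar coefficient at `s = -ℓ` of the integral of `G` against the kernel. -/
def HasVal (p : Finset (Fin (m + 1))) (ω : (Fin (m + 1) → ℝ) → ℝ) (a b : Fin (m + 1) → ℕ) (l : ℕ)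
    (G : (Fin (m + 1) → ℝ) → ℂ) (c : ℂ) : Prop :=
  (∃ R : ℝ, ∀ s : ℂ, R < s.re →
    Integrable (fun t => mellinKernel a b s t * ((ω t : ℂ) * G t)) (boxMeasure p)) ∧
  HasPolarCoeff l (m + 1)
    (fun s => ∫ t, mellinKernel a b s t * ((ω t : ℂ) * G t) ∂boxMeasure p) c

namespace HasVal

variable {p : Finset (Fin (m + 1))} {ω : (Fin (m + 1) → ℝ) → ℝ} {a b : Fin (m + 1) → ℕ} {l : ℕ}
  {G G' : (Fin (m + 1) → ℝ) → ℂ} {c c' : ℂ}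

lemma congr_weight {ω' : (Fin (m + 1) → ℝ) → ℝ} (h : HasVal p ω a b l G c)
    (h' : ∀ t ∈ poleBox p, (ω' t : ℂ) * G' t = ω t * G t) : HasVal p ω' a b l G' c := by
  have key : ∀ s, (fun t => mellinKernel a b s t * ((ω t : ℂ) * G t)) =ᵐ[boxMeasure p]
      (fun t => mellinKernel a b s t * ((ω' t : ℂ) * G' t)) := fun s => by
    filter_upwards [ae_mem_poleBox p] with t ht
    rw [h' t ht]
  obtain ⟨⟨R, hR⟩, h2⟩ := h
  exact ⟨⟨R, fun s hs => (hR s hs).congr (key s)⟩,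
    h2.congr 0 fun s _ => (integral_congr_ae (key s)).symm⟩

lemma congr (h : HasVal p ω a b l G c) (h' : ∀ t ∈ poleBox p, G' t = G t) :
    HasVal p ω a b l G' c := h.congr_weight fun t ht => by rw [h' t ht]

lemma add (h : HasVal p ω a b l G c) (h' : HasVal p ω a b l G' c') :
    HasVal p ω a b l (fun t => G t + G' t) (c + c') := by
  obtain ⟨⟨R, hR⟩, h2⟩ := h
  obtain ⟨⟨R', hR'⟩, h2'⟩ := h'
  refine ⟨⟨max R R', fun s hs => ?_⟩, (h2.add h2').congr (max R R') fun s hs => ?_⟩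
  all_goals
    have h3 := hR s ((le_max_left _ _).trans_lt hs)
    have h3' := hR' s ((le_max_right _ _).trans_lt hs)
    simp only [mul_add]
  · exact h3.add h3'
  · exact integral_add h3 h3'

lemma const_mul (z : ℂ) (h : HasVal p ω a b l G c) :
    HasVal p ω a b l (fun t => z * G t) (z * c) := by
  obtain ⟨⟨R, hR⟩, h2⟩ := h
  have key : ∀ s t, mellinKernel a b s t * ((ω t : ℂ) * (z * G t)) =
      z * (mellinKernel a b s t * ((ω t : ℂ) * G t)) := fun s t => by ring
  refine ⟨⟨R, fun s hs => ?_⟩, (h2.const_mul z).congr 0 fun s _ => ?_⟩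
  · simpa only [key] using (hR s hs).const_mul z
  · simp only [key, integral_const_mul]

lemma zero : HasVal p ω a b l (fun _ => 0) 0 :=
  ⟨⟨0, fun s _ => by simp⟩, by simpa using HasPolarCoeff.zero⟩

lemma sum {ι : Type*} (u : Finset ι) {G : ι → (Fin (m + 1) → ℝ) → ℂ} {c : ι → ℂ}
    (h : ∀ i ∈ u, HasVal p ω a b l (G i) (c i)) :
    HasVal p ω a b l (fun t => ∑ i ∈ u, G i t) (∑ i ∈ u, c i) := by
  induction u using Finset.induction_on with
  | empty => simpa using zero
  | insert i u hi ih =>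
    simp only [Finset.sum_insert hi]
    exact (h i (by simp)).add (ih fun j hj => h j (by simp [hj]))

end HasVal

lemma integral_Ioo_cpow {z : ℂ} (hz : -1 < z.re) :
    ∫ x in Set.Ioo (0 : ℝ) 1, (x : ℂ) ^ z = (z + 1)⁻¹ ∧
      IntegrableOn (fun x : ℝ => (x : ℂ) ^ z) (Set.Ioo 0 1) := by
  constructor
  · rw [← integral_Ioc_eq_integral_Ioo, ← intervalIntegral.integral_of_le zero_le_one,
      integral_cpow (Or.inl hz)]
    have : z + 1 ≠ 0 := fun h => by
      have := congrArg re h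
      simp at this
      linarith
    simp [zero_cpow this]
  · have := (intervalIntegral.intervalIntegrable_cpow' (a := 0) (b := 1) hz)
    rw [intervalIntegrable_iff_integrableOn_Ioc_of_le zero_le_one] at this
    exact this.mono_set Set.Ioo_subset_Ioc_self

/-- The value of an elementary integral. -/
lemma hasVal_elem {p P : Finset (Fin (m + 1))} {ω : (Fin (m + 1) → ℝ) → ℝ} (hω : IsWeight p ω)
    {a b e : Fin (m + 1) → ℕ} {l N K : ℕ} (ha : ∀ k, 1 ≤ a k)
    (hN : ∀ k, a k * (l + 1) + b k + 1 ≤ N) (hP : P ⊆ p) {g : (Fin (m + 1) → ℝ) → ℂ} {C : ℝ}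
    (hgm : Measurable g)
    (hgi : ∀ k ∈ P, ∀ t x, g (Function.update t k x) = g t)
    (hgb : ∀ t ∈ poleBox p, ‖g t‖ ≤ C * ∏ k, growth p P N K k (t k)) :
    HasVal p ω a b l (fun t => (∏ k, (t k : ℂ) ^ e k) * g t)
      ((∏ k, if k ∈ P ∧ e k = a k * l + b k then ((a k : ℂ))⁻¹ else 0) *
        ∫ t, (∏ k ∈ Pᶜ, (t k : ℂ) ^ ((a k : ℂ) * (-(l : ℂ)) - b k - 1 + e k)) * (ω t * g t)
          ∂boxMeasure p) := by
  set z : Fin (m + 1) → ℂ → ℂ := fun k s => (a k : ℂ) * s - b k - 1 + e k with hz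
  set A : ℂ → (Fin (m + 1) → ℝ) → ℂ :=
    fun s t => (∏ k ∈ Pᶜ, (t k : ℂ) ^ z k s) * (ω t * g t) with hA
  have hωm := hω.measurable
  have hAm : ∀ s, Measurable (A s) := fun s => by fun_prop
  have hAi : ∀ s, ∀ k ∈ P, ∀ t x, A s (Function.update t k x) = A s t := by
    intro s k hk t x
    simp only [hA, hgi k hk, hω.indep k (hP hk)]
    congr 1
    refine Finset.prod_congr rfl fun j hj => ?_
    rw [Function.update_of_ne]
    rintro rfl
    exact (Finset.mem_compl.1 hj) hk
  have hbound : ∀ T : ℝ, ∃ K' : ℕ, ∀ t ∈ poleBox p, ∀ s ∈ rightHalf l, s.re ≤ T →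
      ‖A s t‖ ≤ |C| * (ω t * ∏ k, growth p p 0 K' k (t k)) := by
    intro T
    obtain ⟨T', hT'⟩ := exists_nat_ge T
    refine ⟨K + ∑ k, (a k * T' + e k), fun t ht s hs hsT => ?_⟩
    have h1 : (∏ k ∈ Pᶜ, ‖(t k : ℂ) ^ z k s‖) * ∏ k, growth p P N K k (t k) ≤
        ∏ k, growth p p 0 (K + ∑ k, (a k * T' + e k)) k (t k) := by
      have h2 : ∏ k ∈ Pᶜ, ‖(t k : ℂ) ^ z k s‖ =
          ∏ k, if k ∈ Pᶜ then ‖(t k : ℂ) ^ z k s‖ else 1 := by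
        rw [Finset.prod_ite_mem, Finset.univ_inter]
      rw [h2, ← Finset.prod_mul_distrib]
      refine Finset.prod_le_prod (fun k _ => mul_nonneg (by split_ifs <;> positivity)
        (growth_nonneg ht k)) fun k _ => ?_
      have h0 := poleBox_pos ht k
      have hre : (z k s).re = a k * s.re - b k - 1 + e k := by simp [hz]
      have htk := ht k
      have ha0 : (0 : ℝ) ≤ a k := Nat.cast_nonneg _
      have hs' : -((l : ℝ) + 1) < s.re := hs
      rw [norm_cpow_eq_rpow_re_of_pos h0, hre]
      unfold growth
      by_cases hkP : k ∈ P
      · simp [hkP, hP hkP]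
      by_cases hkp : k ∈ p
      · simp only [hkp, if_true, Finset.mem_compl, hkP, not_false_eq_true, if_false] at htk ⊢
        rw [← Real.rpow_natCast, ← Real.rpow_add h0]
        refine Real.rpow_le_one h0.le htk.2.le ?_
        have h3 : (a k : ℝ) * (l + 1) + b k + 1 ≤ N := by exact_mod_cast hN k
        have h4 : (0 : ℝ) ≤ e k := Nat.cast_nonneg _
        nlinarith
      · simp only [hkp, if_false, Finset.mem_compl, hkP, not_false_eq_true, if_true] at htk ⊢
        rw [← Real.rpow_natCast, ← Real.rpow_add h0, ← Real.rpow_natCast]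
        refine Real.rpow_le_rpow_of_exponent_le htk.le ?_
        have h3 : (a k * T' + e k : ℝ) ≤ ∑ k, (a k * T' + e k : ℝ) :=
          Finset.single_le_sum (f := fun k => (a k * T' + e k : ℝ))
            (fun k _ => by positivity) (Finset.mem_univ k)
        have h4 : (0 : ℝ) ≤ b k := Nat.cast_nonneg _
        push_cast
        nlinarith
    have h5 : 0 ≤ ∏ k, growth p P N K k (t k) :=
      Finset.prod_nonneg fun k _ => growth_nonneg ht k
    simp only [hA, norm_mul, norm_prod, norm_real, Real.norm_of_nonneg (hω.nonneg t)]
    calc (∏ k ∈ Pᶜ, ‖(t k : ℂ) ^ z k s‖) * (ω t * ‖g t‖)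
        ≤ (∏ k ∈ Pᶜ, ‖(t k : ℂ) ^ z k s‖) * (ω t * (|C| * ∏ k, growth p P N K k (t k))) := by
          have h6 := (hgb t ht).trans (mul_le_mul_of_nonneg_right (le_abs_self C) h5)
          have h7 := hω.nonneg t
          gcongr
      _ = |C| * (ω t * ((∏ k ∈ Pᶜ, ‖(t k : ℂ) ^ z k s‖) * ∏ k, growth p P N K k (t k))) := by
          ring
      _ ≤ _ := by
          have h7 := hω.nonneg t
          gcongr
  have hholo : DifferentiableOn ℂ (fun s => ∫ t, A s t ∂boxMeasure p) (rightHalf l) := by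
    refine differentiableOn_integral_of_locally_bounded (isOpen_rightHalf l)
      (fun s _ => (hAm s).aestronglyMeasurable) ?_ fun s₀ hs₀ => ?_
    · filter_upwards [ae_mem_poleBox p] with t ht
      refine DifferentiableOn.mul ?_ (differentiableOn_const _)
      refine DifferentiableOn.fun_finsetProd fun k _ => Differentiable.differentiableOn ?_
      refine Differentiable.const_cpow (by fun_prop) (Or.inl ?_)
      exact_mod_cast (poleBox_pos ht k).ne'
    · obtain ⟨K', hK'⟩ := hbound (s₀.re + 1)
      refine ⟨1, one_pos, _, (hω.integrable K').const_mul |C|, ?_⟩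
      filter_upwards [ae_mem_poleBox p] with t ht s hs hss
      refine hK' t ht s hs ?_
      have h1 := (abs_re_le_norm (s - s₀)).trans (mem_ball_iff_norm.1 hss).le
      have h2 := (le_abs_self _).trans h1
      rw [sub_re] at h2
      linarith
  have hsplit : ∀ s, (fun t => mellinKernel a b s t *
      ((ω t : ℂ) * ((∏ k, (t k : ℂ) ^ e k) * g t))) =ᵐ[boxMeasure p]
      fun t => (∏ k ∈ P, (t k : ℂ) ^ z k s) * A s t := by
    intro s
    filter_upwards [ae_mem_poleBox p] with t ht
    have h1 : mellinKernel a b s t * ∏ k, (t k : ℂ) ^ e k = ∏ k, (t k : ℂ) ^ z k s := by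
      rw [mellinKernel, ← Finset.prod_mul_distrib]
      refine Finset.prod_congr rfl fun k _ => ?_
      have : (t k : ℂ) ≠ 0 := by exact_mod_cast (poleBox_pos ht k).ne'
      rw [hz, cpow_add _ _ this, cpow_natCast]
    rw [← Finset.prod_mul_prod_compl P fun k => (t k : ℂ) ^ z k s] at h1
    simp only [hA]
    linear_combination (ω t * g t : ℂ) * h1
  have hre : ∀ s : ℂ, (∑ k, (b k : ℝ)) < s.re → ∀ k, -1 < (z k s).re := by
    intro s hs k
    have h1 : (b k : ℝ) ≤ ∑ k, (b k : ℝ) :=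
      Finset.single_le_sum (f := fun k => (b k : ℝ)) (fun k _ => by positivity)
        (Finset.mem_univ k)
    have h2 : (z k s).re = a k * s.re - b k - 1 + e k := by simp [hz]
    have h3 : (1 : ℝ) ≤ a k := by exact_mod_cast ha k
    have h4 : (0 : ℝ) ≤ b k := Nat.cast_nonneg _
    have h5 : (0 : ℝ) ≤ e k := Nat.cast_nonneg _
    rw [h2]
    nlinarith
  have hmem : ∀ s : ℂ, (∑ k, (b k : ℝ)) < s.re → s ∈ rightHalf l := by
    intro s hs
    have h1 : 0 ≤ ∑ k, (b k : ℝ) := Finset.sum_nonneg fun k _ => by positivity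
    have h2 : (0 : ℝ) ≤ l := Nat.cast_nonneg _
    simp only [rightHalf, Set.mem_ofPred_eq]
    linarith
  have hprob : ∀ k ∈ P, IsProbabilityMeasure
      ((volume : Measure ℝ).restrict (if k ∈ p then Set.Ioo 0 1 else Set.Ioi 1)) := by
    intro k hk
    rw [if_pos (hP hk)]
    exact ⟨by simp⟩
  have hfub := fun s => integral_pi_prod_mul_of_indep P hprob (fun k x => (x : ℂ) ^ z k s) (hAi s)
  refine ⟨⟨∑ k, (b k : ℝ), fun s hs => ?_⟩, ∑ k, (b k : ℝ),
    fun s => (∏ k ∈ P, (z k s + 1)⁻¹) * ∫ t, A s t ∂boxMeasure p, ?_, fun s hs => ?_, ?_⟩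
  · refine Integrable.congr ((hfub s).2 (fun k hk => ?_) ?_) (hsplit s).symm
    · rw [if_pos (hP hk)]
      exact (integral_Ioo_cpow (hre s hs k)).2
    · obtain ⟨K', hK'⟩ := hbound s.re
      refine ((hω.integrable K').const_mul |C|).mono' (hAm s).aestronglyMeasurable ?_
      filter_upwards [ae_mem_poleBox p] with t ht
      exact hK' t ht s (hmem s hs) le_rfl
  · refine MeromorphicOn.mul ?_ (hholo.analyticOnNhd (isOpen_rightHalf l)).meromorphicOn
    refine MeromorphicOn.fun_prod fun k _ => MeromorphicOn.inv ?_
    intro s _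
    refine AnalyticAt.meromorphicAt ?_
    fun_prop
  · beta_reduce
    rw [integral_congr_ae (hsplit s)]
    refine Eq.trans ?_ (hfub s).1.symm
    congr 1
    refine Finset.prod_congr rfl fun k hk => ?_
    rw [if_pos (hP hk), (integral_Ioo_cpow (hre s hs k)).1]
  · have hH : Filter.Tendsto (fun s => ∫ t, A s t ∂boxMeasure p)
        (nhdsWithin (-(l : ℂ)) {-(l : ℂ)}ᶜ) (nhds (∫ t, A (-l) t ∂boxMeasure p)) :=
      ((hholo.differentiableAt ((isOpen_rightHalf l).mem_nhds
        (neg_mem_rightHalf l))).continuousAt.tendsto).mono_left nhdsWithin_le_nhds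
    have hfac : ∀ k, Filter.Tendsto
        (fun s : ℂ => if k ∈ P then (s + l) * (z k s + 1)⁻¹ else (s + l))
        (nhdsWithin (-(l : ℂ)) {-(l : ℂ)}ᶜ)
        (nhds (if k ∈ P ∧ e k = a k * l + b k then ((a k : ℂ))⁻¹ else 0)) := by
      intro k
      have h0 : Filter.Tendsto (fun s : ℂ => s + l) (nhdsWithin (-(l : ℂ)) {-(l : ℂ)}ᶜ)
          (nhds 0) := by
        have : Filter.Tendsto (fun s : ℂ => s + l) (nhds (-(l : ℂ))) (nhds (-l + l)) :=
          Continuous.tendsto (by fun_prop) _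
        rw [neg_add_cancel] at this
        exact this.mono_left nhdsWithin_le_nhds
      by_cases hkP : k ∈ P
      · simp only [hkP, if_true, true_and]
        have hak : (a k : ℂ) ≠ 0 := by
          have := ha k
          exact_mod_cast (by omega : a k ≠ 0)
        have hzk : ∀ s : ℂ, z k s + 1 = a k * (s + l) + (e k - (a k * l + b k)) := fun s => by
          simp only [hz]
          ring
        split_ifs with he
        · refine Filter.Tendsto.congr' ?_ tendsto_const_nhds
          filter_upwards [self_mem_nhdsWithin] with s hs
          have hs' : s + l ≠ 0 := fun h => hs (eq_neg_of_add_eq_zero_left h)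
          rw [hzk, he]
          push_cast
          rw [sub_self, add_zero]
          field_simp
        · have he' : (e k : ℂ) - (a k * l + b k) ≠ 0 := by
            rw [sub_ne_zero]
            exact_mod_cast he
          have h1 : Filter.Tendsto (fun s : ℂ => (z k s + 1)⁻¹)
              (nhdsWithin (-(l : ℂ)) {-(l : ℂ)}ᶜ)
              (nhds ((e k : ℂ) - (a k * l + b k))⁻¹) := by
            refine Filter.Tendsto.inv₀ ?_ he'
            simp only [hzk]
            simpa using (h0.const_mul (a k : ℂ)).add_const ((e k : ℂ) - (a k * l + b k))
          simpa using h0.mul h1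
      · simpa [hkP] using h0
    refine ((tendsto_finsetProd Finset.univ fun k _ => hfac k).mul hH).congr fun s => ?_
    have h1 : (s + (l : ℂ)) ^ (m + 1) * ∏ k ∈ P, (z k s + 1)⁻¹ =
        ∏ k, if k ∈ P then (s + l) * (z k s + 1)⁻¹ else (s + l) := by
      have h2 : ∏ k ∈ P, (z k s + 1)⁻¹ = ∏ k, if k ∈ P then (z k s + 1)⁻¹ else 1 := by
        rw [Finset.prod_ite_mem, Finset.univ_inter]
      have h3 : (s + (l : ℂ)) ^ (m + 1) = ∏ _k : Fin (m + 1), (s + (l : ℂ)) := by simp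
      rw [h2, h3, ← Finset.prod_mul_distrib]
      refine Finset.prod_congr rfl fun k _ => ?_
      split_ifs <;> simp
    rw [← h1]
    ring

lemma Tame.hasVal {p : Finset (Fin (m + 1))} {ω : (Fin (m + 1) → ℝ) → ℝ} (hω : IsWeight p ω)
    {a b : Fin (m + 1) → ℕ} {l N d : ℕ} (ha : ∀ k, 1 ≤ a k)
    (hN : ∀ k, a k * (l + 1) + b k + 1 ≤ N) {G : (Fin (m + 1) → ℝ) → ℂ} (hG : Tame p N d G)
    (L : Fin (m + 1) → ℕ) :
    ∃ c, HasVal p ω a b l (fun t => (∏ k, (t k : ℂ) ^ L k) * G t) c ∧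
      (((∃ k, k ∉ p ∨ a k * l + b k < L k) ∨ a 0 * l + b 0 < L 0 + d) → c = 0) := by
  unfold Tame at hG
  generalize hG' : (fun _ : Unit => G) = G' at hG
  replace hG' : G = G' () := by rw [← hG']
  subst hG'
  induction hG with
  | @elem G' h =>
    obtain ⟨P, e, g, C, K, h1, h2, h3, h4, h5, h6, h7⟩ := h
    have hg : Measurable (g ()) := h3.of_uncurry_left
    refine ⟨_, (hasVal_elem hω ha hN h1 hg (h4 ()) (e := L + e) (C := C) (K := K)
      fun t ht => by simpa using h5 () t ht).congr fun t ht => ?_, fun hc => ?_⟩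
    · rw [h7 () t ht, ← mul_assoc, ← Finset.prod_mul_distrib]
      simp only [Pi.add_apply, pow_add]
    · rw [mul_eq_zero]
      left
      rcases hc with ⟨k, hk⟩ | hc
      · refine Finset.prod_eq_zero (Finset.mem_univ k) (if_neg ?_)
        rintro ⟨hkP, hk'⟩
        rcases hk with hk | hk
        · exact hk (h1 hkP)
        · simp only [Pi.add_apply] at hk'
          omega
      · refine Finset.prod_eq_zero (Finset.mem_univ 0) (if_neg ?_)
        rintro ⟨hkP, hk'⟩
        have := h6 hkP
        simp only [Pi.add_apply] at hk'
        omega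
  | add _ _ h ih1 ih2 =>
    obtain ⟨c₁, h1, h1'⟩ := ih1
    obtain ⟨c₂, h2, h2'⟩ := ih2
    refine ⟨c₁ + c₂, (h1.add h2).congr fun t ht => by rw [h () t ht, mul_add], fun hc => ?_⟩
    rw [h1' hc, h2' hc, add_zero]

instance : IsProbabilityMeasure (boxMeasure (Finset.univ : Finset (Fin (m + 1)))) := by
  unfold boxMeasure
  have : ∀ k : Fin (m + 1), IsProbabilityMeasure ((volume : Measure ℝ).restrict
      (if k ∈ (Finset.univ : Finset (Fin (m + 1))) then Set.Ioo 0 1 else Set.Ioi 1)) :=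
    fun k => by simpa using (⟨by simp⟩ : IsProbabilityMeasure
      ((volume : Measure ℝ).restrict (Set.Ioo 0 1)))
  infer_instance

lemma isWeight_one : IsWeight (Finset.univ : Finset (Fin (m + 1))) (fun _ => 1) where
  measurable := measurable_const
  nonneg _ := zero_le_one
  indep _ _ _ _ := rfl
  integrable K := by simp [growth]

lemma isWeight_exp {c : ℝ} (hc : 0 < c) :
    IsWeight ((Finset.univ : Finset (Fin (m + 1))).erase 0)
      (fun t => Real.exp (-(c * t 0))) where
  measurable := by fun_prop
  nonneg _ := (Real.exp_pos _).le
  indep k hk t x := by rw [Function.update_of_ne (Finset.ne_of_mem_erase hk).symm]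
  integrable K := by
    have h1 : ∀ t : Fin (m + 1) → ℝ, Real.exp (-(c * t 0)) *
        ∏ k, growth (Finset.univ.erase 0) (Finset.univ.erase 0) 0 K k (t k) =
        ∏ k, if k = 0 then Real.exp (-(c * t k)) * t k ^ K else 1 := by
      intro t
      rw [Finset.prod_ite_eq' Finset.univ (0 : Fin (m + 1))]
      simp only [Finset.mem_univ, if_true, growth, Finset.mem_erase, and_true]
      rw [Finset.prod_eq_single 0 (fun k _ hk => by simp [hk]) (by simp)]
      simp
    simp only [h1]
    refine Integrable.fintype_prod (f := fun k x => if k = 0 then Real.exp (-(c * x)) * x ^ K else 1)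
      (μ := fun k => (volume : Measure ℝ).restrict
        (if k ∈ (Finset.univ : Finset (Fin (m + 1))).erase 0 then Set.Ioo 0 1 else Set.Ioi 1))
      fun k => ?_
    by_cases hk : k = 0
    · simp only [hk, if_true, Finset.mem_erase, ne_eq, not_true_eq_false, false_and, if_false]
      obtain ⟨C, hC, h⟩ := one_add_pow_mul_exp_le hc K
      refine (((integrableOn_exp_neg_mul (half_pos hc)).mono_set
        (Set.Ioi_subset_Ioi zero_le_one)).const_mul C).mono' (by fun_prop) ?_
      filter_upwards [ae_restrict_mem measurableSet_Ioi] with v hv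
      have hv' : (0 : ℝ) ≤ v := zero_le_one.trans (le_of_lt hv)
      rw [Real.norm_of_nonneg (by positivity)]
      refine le_trans ?_ (h c le_rfl v hv')
      gcongr
      linarith
    · simp only [hk, if_false, Finset.mem_erase, ne_eq, not_false_eq_true, Finset.mem_univ,
        and_self, if_true]
      simp

lemma hasVal_monomial {a b : Fin (m + 1) → ℕ} {l : ℕ} (ha : ∀ k, 1 ≤ a k)
    (L : Fin (m + 1) → ℕ) :
    HasVal Finset.univ (fun _ => 1) a b l (fun t => ∏ k, (t k : ℂ) ^ L k)
      ((if ∀ k, L k = a k * l + b k then ∏ k, ((a k : ℚ))⁻¹ else 0 : ℚ) : ℂ) := by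
  have h := hasVal_elem (P := Finset.univ) isWeight_one (e := L) (l := l)
    (N := ∑ k, (a k * (l + 1) + b k + 1)) (K := 0) (C := 1) (g := fun _ => 1) ha
    (fun k => Finset.single_le_sum (f := fun k => a k * (l + 1) + b k + 1)
      (fun _ _ => Nat.zero_le _) (Finset.mem_univ k)) le_rfl measurable_const
    (fun _ _ _ _ => rfl) (fun t _ => by simp [growth])
  convert h.congr (fun t _ => (mul_one _).symm) using 1
  have : ∫ t, (∏ k ∈ (Finset.univ : Finset (Fin (m + 1)))ᶜ,
      (t k : ℂ) ^ ((a k : ℂ) * (-(l : ℂ)) - b k - 1 + L k)) * (((1 : ℝ) : ℂ) * 1)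
      ∂boxMeasure Finset.univ = 1 := by
    simp
  rw [this, mul_one]
  split_ifs with hL
  · push_cast
    exact Finset.prod_congr rfl fun k _ => by simp [hL k]
  · simp only [not_forall] at hL
    obtain ⟨k, hk⟩ := hL
    rw [Finset.prod_eq_zero (Finset.mem_univ k) (if_neg fun h => hk h.2)]
    simp

end Val

section RatVal

variable {m : ℕ} {a b : Fin (m + 1) → ℕ} {l N : ℕ} {G G' : (Fin (m + 1) → ℝ) → ℂ}

/-- All monomial multiples of the tame function `G` have rational leading polar coefficients, and
these vanish unless the exponent of the `0`-th coordinate is the critical one. -/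
def RatVal (a b : Fin (m + 1) → ℕ) (l N : ℕ) (G : (Fin (m + 1) → ℝ) → ℂ) : Prop :=
  Tame Finset.univ N 0 G ∧ ∀ L : Fin (m + 1) → ℕ, ∃ ρ : ℚ,
    HasVal Finset.univ (fun _ => 1) a b l (fun t => (∏ k, (t k : ℂ) ^ L k) * G t) ρ ∧
      (L 0 ≠ a 0 * l + b 0 → ρ = 0)

lemma RatVal.congr (h : RatVal a b l N G) (h' : ∀ t ∈ poleBox Finset.univ, G' t = G t) :
    RatVal a b l N G' := by
  refine ⟨h.1.congr h', fun L => ?_⟩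
  obtain ⟨ρ, h1, h2⟩ := h.2 L
  exact ⟨ρ, h1.congr fun t ht => by rw [h' t ht], h2⟩

lemma ratVal_one (ha : ∀ k, 1 ≤ a k) : RatVal a b l N (fun _ => 1) := by
  refine ⟨Tame.const 1, fun L => ⟨_, (hasVal_monomial (l := l) (b := b) ha L).congr fun t _ => mul_one _,
    fun hL => if_neg fun h => hL (h 0)⟩⟩

/-- The monomial `∏_{k ∈ s} t_k`, as an exponent vector. -/
lemma prod_pow_add_indicator (L : Fin (m + 1) → ℕ) (s : Finset (Fin (m + 1)))
    (t : Fin (m + 1) → ℝ) :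
    ∏ k, (t k : ℂ) ^ (L k + if k ∈ s then 1 else 0) =
      (∏ k, (t k : ℂ) ^ L k) * ∏ k ∈ s, (t k : ℂ) := by
  simp only [pow_add, Finset.prod_mul_distrib]
  congr 1
  rw [← Finset.univ_inter s, ← Finset.prod_ite_mem]
  refine Finset.prod_congr rfl fun k _ => ?_
  simp

variable {ι : Type} {u : Finset ι} {c₀ : ℚ} {c : ι → ℚ} {s : ι → Finset (Fin (m + 1))}

lemma RatVal.mul_multilin (h : RatVal a b l N G) (hs0 : ∀ i ∈ u, 0 ∉ s i) :
    RatVal a b l N (fun t => ((c₀ + multilin u (fun i => (c i : ℝ)) s t : ℝ) : ℂ) * G t) := by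
  refine ⟨?_, fun L => ?_⟩
  · refine ((((Tame.const (c₀ : ℂ)).add (Tame.multilin (b := u) (c := fun i => (c i : ℝ)) (s := s)
      fun _ _ => Nat.zero_le _)).mul h.1).mono (by simp)).congr fun t _ => ?_
    push_cast
    rfl
  · obtain ⟨ρ₀, h1, h1'⟩ := h.2 L
    choose ρ h2 h2' using fun i => h.2 (fun k => L k + if k ∈ s i then 1 else 0)
    refine ⟨c₀ * ρ₀ + ∑ i ∈ u, c i * ρ i, ?_, fun hL => ?_⟩
    · have := ((h1.const_mul (c₀ : ℂ)).add (HasVal.sum u fun i _ => (h2 i).const_mul (c i : ℂ)))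
      push_cast
      refine this.congr fun t _ => ?_
      simp only [prod_pow_add_indicator, multilin]
      push_cast
      rw [add_mul, Finset.sum_mul, mul_add, Finset.mul_sum]
      congr 1
      · ring
      · exact Finset.sum_congr rfl fun i _ => by ring
    · rw [h1' hL, Finset.sum_eq_zero, mul_zero, zero_add]
      intro i hi
      rw [h2' i (by simpa [hs0 i hi] using hL), mul_zero]

lemma RatVal.div_multilin (ha : ∀ k, 1 ≤ a k) (hN : ∀ k, a k * (l + 1) + b k + 1 ≤ N)
    (h : RatVal a b l N G) (hc₀ : 0 < c₀)
    (hc : ∀ i ∈ u, 0 ≤ c i) (hs : ∀ i ∈ u, (s i).Nonempty) (hs0 : ∀ i ∈ u, 0 ∉ s i) :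
    RatVal a b l N (fun t => ((c₀ + multilin u (fun i => (c i : ℝ)) s t : ℝ) : ℂ)⁻¹ * G t) := by
  have hT : Tame Finset.univ N 0
      (fun t => ((c₀ + multilin u (fun i => (c i : ℝ)) s t : ℝ) : ℂ)⁻¹ * G t) :=
    (Tame.inv_multilin Finset.univ N (s := s) (a := (c₀ : ℝ)) (by exact_mod_cast hc₀)
      (fun i hi => by exact_mod_cast hc i hi)).mul h.1
  refine ⟨hT, fun L => ?_⟩
  generalize hμ : ∑ k, (a k * l + b k + 1 - L k) = μ
  induction μ using Nat.strong_induction_on generalizing L with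
  | _ μ ih =>
    by_cases hL : ∃ k, a k * l + b k < L k
    · obtain ⟨k, hk⟩ := hL
      obtain ⟨ρ, h1, h2⟩ := hT.hasVal isWeight_one ha hN L
      rw [h2 (.inl ⟨k, .inr hk⟩)] at h1
      exact ⟨0, by simpa using h1, fun _ => rfl⟩
    · simp only [not_exists, not_lt] at hL
      obtain ⟨ρ₀, h1, h1'⟩ := h.2 L
      have h3 : ∀ i ∈ u, ∃ ρ : ℚ, HasVal Finset.univ (fun _ => 1) a b l
          (fun t => (∏ k, (t k : ℂ) ^ (L k + if k ∈ s i then 1 else 0)) *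
            (((c₀ + multilin u (fun i => (c i : ℝ)) s t : ℝ) : ℂ)⁻¹ * G t)) ρ ∧
          (L 0 ≠ a 0 * l + b 0 → ρ = 0) := by
        intro i hi
        have hlt : ∑ k, (a k * l + b k + 1 - (L k + if k ∈ s i then 1 else 0)) < μ := by
          rw [← hμ]
          obtain ⟨k, hk⟩ := hs i hi
          refine Finset.sum_lt_sum (fun j _ => by split_ifs <;> omega)
            ⟨k, Finset.mem_univ k, ?_⟩
          have := hL k
          simp only [hk, if_true]
          omega
        obtain ⟨ρ, h4, h5⟩ := ih _ hlt (fun k => L k + if k ∈ s i then 1 else 0) rfl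
        exact ⟨ρ, h4, fun hL => h5 (by simpa [hs0 i hi] using hL)⟩
      choose! ρ h2 h2' using h3
      refine ⟨c₀⁻¹ * (ρ₀ + ∑ i ∈ u, -c i * ρ i), ?_, fun hL => ?_⟩
      · have := ((h1.add (HasVal.sum u fun i hi => (h2 i hi).const_mul (-c i : ℂ)))).const_mul
          (c₀⁻¹ : ℂ)
        rw [show ((c₀⁻¹ * (ρ₀ + ∑ i ∈ u, -c i * ρ i) : ℚ) : ℂ) =
          (c₀⁻¹ : ℂ) * (ρ₀ + ∑ i ∈ u, -(c i : ℂ) * ρ i) by push_cast; rfl]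
        refine this.congr fun t ht => ?_
        have hY := multilin_nonneg (b := u) (c := fun i => (c i : ℝ)) (s := s)
          (fun i hi => by exact_mod_cast hc i hi) ht
        have hc₀' : (0 : ℝ) < c₀ := by exact_mod_cast hc₀
        have hU : ((c₀ + multilin u (fun i => (c i : ℝ)) s t : ℝ) : ℂ) ≠ 0 := by
          exact_mod_cast (by positivity : (c₀ + multilin u (fun i => (c i : ℝ)) s t : ℝ) ≠ 0)
        have hUs : ((c₀ + multilin u (fun i => (c i : ℝ)) s t : ℝ) : ℂ) =
            c₀ + ∑ i ∈ u, (c i : ℂ) * ∏ k ∈ s i, (t k : ℂ) := by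
          simp [multilin]
        have hc₀'' : (c₀ : ℂ) ≠ 0 := by exact_mod_cast hc₀.ne'
        simp only [prod_pow_add_indicator]
        set V := ((c₀ + multilin u (fun i => (c i : ℝ)) s t : ℝ) : ℂ) with hV
        have h6 : ∑ i ∈ u, -(c i : ℂ) * ((∏ k, (t k : ℂ) ^ L k) * (∏ k ∈ s i, (t k : ℂ)) *
            (V⁻¹ * G t)) = -(V - c₀) * ((∏ k, (t k : ℂ) ^ L k) * (V⁻¹ * G t)) := by
          rw [hUs, add_sub_cancel_left, ← Finset.sum_neg_distrib, Finset.sum_mul]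
          exact Finset.sum_congr rfl fun i _ => by ring
        rw [h6]
        field_simp
        ring
      · rw [h1' hL, Finset.sum_eq_zero, add_zero, mul_zero]
        intro i hi
        rw [h2' i hi hL, mul_zero]

end RatVal

section Sector

variable {m : ℕ} {I : Type} [Fintype I]

/-- The linear form with coefficients `c` in the products `t_0 ⋯ t_k`. -/
def sectorForm (c : Fin (m + 1) → ℚ) (t : Fin (m + 1) → ℝ) : ℝ :=
  multilin Finset.univ (fun k => (c k : ℝ)) Finset.Iic t

/-- The quotient of `sectorForm c` by its first monomial `t_0 ⋯ t_κ`. -/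
def sectorUnit (c : Fin (m + 1) → ℚ) (κ : Fin (m + 1)) (t : Fin (m + 1) → ℝ) : ℝ :=
  c κ + multilin (Finset.Ioi κ) (fun k => (c k : ℝ)) (fun k => Finset.Ioc κ k) t

lemma sectorForm_eq {c : Fin (m + 1) → ℚ} {κ : Fin (m + 1)} (hκ : ∀ k < κ, c k = 0)
    (t : Fin (m + 1) → ℝ) :
    sectorForm c t = (∏ k ∈ Finset.Iic κ, t k) * sectorUnit c κ t := by
  unfold sectorForm sectorUnit multilin
  rw [mul_add, Finset.mul_sum]
  have h1 : (Finset.univ : Finset (Fin (m + 1))) = Finset.Iio κ ∪ insert κ (Finset.Ioi κ) := by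
    ext k
    simpa [eq_comm, le_iff_eq_or_lt] using lt_or_ge k κ
  rw [h1, Finset.sum_union, Finset.sum_eq_zero, zero_add, Finset.sum_insert (by simp)]
  · congr 1
    · ring
    · refine Finset.sum_congr rfl fun k hk => ?_
      have hk' : κ < k := Finset.mem_Ioi.1 hk
      have h2 : Finset.Iic k = Finset.Iic κ ∪ Finset.Ioc κ k := by
        ext j
        simp only [Finset.mem_Iic, Finset.mem_union, Finset.mem_Ioc]
        constructor
        · intro h
          rcases le_or_gt j κ with h' | h'
          exacts [.inl h', .inr ⟨h', h⟩]
        · rintro (h | h)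
          exacts [h.trans hk'.le, h.2]
      rw [h2, Finset.prod_union]
      · ring
      · rw [Finset.disjoint_left]
        intro j hj hj'
        exact absurd (Finset.mem_Iic.1 hj) (not_le.2 (Finset.mem_Ioc.1 hj').1)
  · intro k hk
    simp [hκ k (Finset.mem_Iio.1 hk)]
  · rw [Finset.disjoint_left]
    intro k hk
    simpa using hk

lemma tame_prod_sub_prod {p : Finset (Fin (m + 1))} {N : ℕ} {ι : Type*} (u : Finset ι)
    {X Y : ι → (Fin (m + 1) → ℝ) → ℂ} (hX : ∀ i ∈ u, Tame p N 0 (X i))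
    (hY : ∀ i ∈ u, Tame p N 0 (Y i)) (hXY : ∀ i ∈ u, Tame p N N (fun t => X i t - Y i t)) :
    Tame p N N (fun t => ∏ i ∈ u, X i t - ∏ i ∈ u, Y i t) := by
  induction u using Finset.induction_on with
  | empty => exact IsTame.zero.congr fun _ t _ => by simp
  | insert i u hi ih =>
    have h1 := ih (fun j hj => hX j (by simp [hj])) (fun j hj => hY j (by simp [hj]))
      (fun j hj => hXY j (by simp [hj]))
    have h2 : Tame p N 0 (fun t => ∏ i ∈ u, Y i t) := Tame.prod u fun j hj => hY j (by simp [hj])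
    refine ((((hX i (by simp)).mul h1).mono (by simp)).add
      (((hXY i (by simp)).mul h2).mono (by simp))).congr fun t _ => ?_
    rw [Finset.prod_insert hi, Finset.prod_insert hi]
    ring

variable {c : I → Fin (m + 1) → ℚ} {κ : I → Fin (m + 1)} {a b : Fin (m + 1) → ℕ} {l N : ℕ}

lemma ratVal_prod_sectorUnit (ha : ∀ k, 1 ≤ a k) (hN : ∀ k, a k * (l + 1) + b k + 1 ≤ N)
    (hc : ∀ i k, 0 ≤ c i k) (hκ : ∀ i, 0 < c i (κ i)) (L : I → ℕ) :
    RatVal a b l N (fun t => ∏ i, (sectorUnit (c i) (κ i) t : ℂ)⁻¹ *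
      (sectorUnit (c i) (κ i) t : ℂ) ^ L i) := by
  suffices ∀ u : Finset I, RatVal a b l N (fun t => ∏ i ∈ u, (sectorUnit (c i) (κ i) t : ℂ)⁻¹ *
      (sectorUnit (c i) (κ i) t : ℂ) ^ L i) from this Finset.univ
  intro u
  induction u using Finset.induction_on with
  | empty => simpa using ratVal_one ha
  | insert i u hi ih =>
    have hs0 : ∀ k ∈ Finset.Ioi (κ i), (0 : Fin (m + 1)) ∉ Finset.Ioc (κ i) k := by simp
    have h1 : ∀ j, RatVal a b l N (fun t => (sectorUnit (c i) (κ i) t : ℂ) ^ j *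
        ∏ i ∈ u, (sectorUnit (c i) (κ i) t : ℂ)⁻¹ * (sectorUnit (c i) (κ i) t : ℂ) ^ L i) := by
      intro j
      induction j with
      | zero => simpa using ih
      | succ j ih' =>
        refine (ih'.mul_multilin (c₀ := c i (κ i)) (u := Finset.Ioi (κ i)) (c := c i)
          (s := fun k => Finset.Ioc (κ i) k) hs0).congr fun t _ => ?_
        rw [pow_succ]
        unfold sectorUnit
        ring
    refine ((h1 (L i)).div_multilin ha hN (c₀ := c i (κ i)) (u := Finset.Ioi (κ i)) (c := c i)
      (s := fun k => Finset.Ioc (κ i) k) (hκ i) (fun k _ => hc i k) (fun k hk => ?_)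
      hs0).congr fun t _ => ?_
    · exact ⟨k, by simpa using hk⟩
    · rw [Finset.prod_insert hi, ← mul_assoc]
      rfl

lemma prod_sectorForm_pow (hκ : ∀ i, ∀ k < κ i, c i k = 0) (L : I → ℕ) (t : Fin (m + 1) → ℝ) :
    ∏ i, (sectorForm (c i) t : ℂ) ^ L i =
      (∏ k, (t k : ℂ) ^ (∑ i, if k ≤ κ i then L i else 0)) *
        ∏ i, (sectorUnit (c i) (κ i) t : ℂ) ^ L i := by
  have h1 : ∀ i, (sectorForm (c i) t : ℂ) ^ L i =
      (∏ k, (t k : ℂ) ^ (if k ≤ κ i then L i else 0)) * (sectorUnit (c i) (κ i) t : ℂ) ^ L i := by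
    intro i
    rw [sectorForm_eq (hκ i)]
    push_cast
    rw [mul_pow]
    congr 1
    rw [← Finset.univ_inter (Finset.Iic (κ i)), ← Finset.prod_ite_mem, ← Finset.prod_pow]
    refine Finset.prod_congr rfl fun k _ => ?_
    simp only [Finset.mem_Iic]
    split_ifs <;> simp
  simp only [h1, Finset.prod_mul_distrib]
  rw [Finset.prod_comm]
  simp only [Finset.prod_pow_eq_pow_sum]

/-- The contribution of the part `(0, 1)^n` of a sector. -/
lemma hasVal_sector_main (ha : ∀ k, 1 ≤ a k) (hc : ∀ i k, 0 ≤ c i k)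
    (hκ : ∀ i, 0 < c i (κ i)) (hκ' : ∀ i, ∀ k < κ i, c i k = 0) :
    ∃ ρ : (I → ℕ) → ℚ, ∀ (ψ : I → ℝ → ℂ) (A : I → PowerSeries ℂ),
      (∀ i, HasExpansion (ψ i) (A i)) →
      HasVal Finset.univ (fun _ => 1) a b l
        (fun t => ∏ i, (sectorUnit (c i) (κ i) t : ℂ)⁻¹ * ψ i (sectorForm (c i) t))
        (∑ L ∈ Finset.piAntidiag Finset.univ (a 0 * l + b 0),
          (∏ i, PowerSeries.coeff (L i) (A i)) * ρ L) := by
  set N := ∑ k, (a k * (l + 1) + b k + 1) with hNdef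
  have hN : ∀ k, a k * (l + 1) + b k + 1 ≤ N := fun k =>
    Finset.single_le_sum (f := fun k => a k * (l + 1) + b k + 1)
      (fun _ _ => Nat.zero_le _) (Finset.mem_univ k)
  have hmono : ∀ L : I → ℕ, ∃ ρ : ℚ, HasVal Finset.univ (fun _ => 1) a b l
      (fun t => (∏ i, (sectorUnit (c i) (κ i) t : ℂ)⁻¹) * ∏ i, (sectorForm (c i) t : ℂ) ^ L i) ρ ∧
      (∑ i, L i ≠ a 0 * l + b 0 → ρ = 0) := by
    intro L
    obtain ⟨ρ, h1, h2⟩ := (ratVal_prod_sectorUnit ha hN hc hκ L).2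
      (fun k => ∑ i, if k ≤ κ i then L i else 0)
    refine ⟨ρ, h1.congr fun t _ => ?_, fun hL => h2 (by simpa using hL)⟩
    simp only [prod_sectorForm_pow hκ', Finset.prod_mul_distrib]
    ring
  choose ρ hρ hρ' using hmono
  refine ⟨ρ, fun ψ A hψ => ?_⟩
  have hψT := fun i => (hψ i).tame Finset.univ N (b := Finset.univ)
    (c := fun k => (c i k : ℝ)) (s := Finset.Iic) (fun k _ => by exact_mod_cast hc i k) (by simp)
  have hψN := fun i => hψ i m Finset.univ N _ Finset.univ
    (fun k => (c i k : ℝ)) Finset.Iic (fun k _ => by exact_mod_cast hc i k) (by simp)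
  have hpT : ∀ i, Tame Finset.univ N 0 (fun t => ∑ j ∈ Finset.range N,
      PowerSeries.coeff j (A i) * (sectorForm (c i) t : ℂ) ^ j) := fun i =>
    Tame.sum _ fun j _ => ((((Tame.multilin (d := 0) (b := Finset.univ)
      (c := fun k => (c i k : ℝ)) (s := Finset.Iic) (fun _ _ => Nat.zero_le _)).pow j).mono
        (by simp)).const_mul _)
  have hU : Tame Finset.univ N 0 (fun t => ∏ i, (sectorUnit (c i) (κ i) t : ℂ)⁻¹) :=
    Tame.prod _ fun i _ => Tame.inv_multilin _ _ (by exact_mod_cast hκ i)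
      (fun k _ => by exact_mod_cast hc i k)
  have hrem := (hU.mul (tame_prod_sub_prod (p := Finset.univ) (N := N) Finset.univ
    (fun i _ => hψT i) (fun i _ => hpT i) (fun i _ => hψN i))).hasVal
    (b := b) (l := l) isWeight_one ha hN 0
  obtain ⟨v, hv, hv0⟩ := hrem
  have hv1 : v = 0 := hv0 (.inr (by have := hN 0; simp; nlinarith))
  rw [hv1] at hv
  have hmain := HasVal.sum (Fintype.piFinset fun _ : I => Finset.range N) fun L _ =>
    (hρ L).const_mul (∏ i, PowerSeries.coeff (L i) (A i))
  have hsum : ∑ L ∈ Fintype.piFinset fun _ : I => Finset.range N,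
        (∏ i, PowerSeries.coeff (L i) (A i)) * (ρ L : ℂ) =
      ∑ L ∈ Finset.piAntidiag Finset.univ (a 0 * l + b 0),
        (∏ i, PowerSeries.coeff (L i) (A i)) * (ρ L : ℂ) := by
    symm
    refine Finset.sum_subset (fun L hL => ?_) fun L _ hL => ?_
    · rw [Fintype.mem_piFinset]
      intro i
      have h1 := (Finset.mem_piAntidiag.1 hL).1
      have h2 : L i ≤ ∑ i, L i := Finset.single_le_sum (fun _ _ => Nat.zero_le _)
        (Finset.mem_univ i)
      have := hN 0
      rw [Finset.mem_range]
      nlinarith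
    · rw [hρ' L, Rat.cast_zero, mul_zero]
      intro h
      exact hL (Finset.mem_piAntidiag.2 ⟨h, by simp⟩)
  rw [hsum] at hmain
  have := hmain.add hv
  rw [add_zero] at this
  refine this.congr fun t _ => ?_
  have h3 : ∏ i, ∑ j ∈ Finset.range N, PowerSeries.coeff j (A i) * (sectorForm (c i) t : ℂ) ^ j =
      ∑ L ∈ Fintype.piFinset fun _ : I => Finset.range N,
        (∏ i, PowerSeries.coeff (L i) (A i)) * ∏ i, (sectorForm (c i) t : ℂ) ^ L i := by
    rw [Finset.prod_univ_sum]
    simp only [Finset.prod_mul_distrib]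
  have h4 : ∑ L ∈ Fintype.piFinset fun _ : I => Finset.range N,
      (∏ i, PowerSeries.coeff (L i) (A i)) * ((∏ i, (sectorUnit (c i) (κ i) t : ℂ)⁻¹) *
        ∏ i, (sectorForm (c i) t : ℂ) ^ L i) = (∏ i, (sectorUnit (c i) (κ i) t : ℂ)⁻¹) *
      ∏ i, ∑ j ∈ Finset.range N, PowerSeries.coeff j (A i) * (sectorForm (c i) t : ℂ) ^ j := by
    rw [h3, Finset.mul_sum]
    exact Finset.sum_congr rfl fun L _ => by ring
  rw [h4, Finset.prod_mul_distrib]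
  simp only [Pi.zero_apply, pow_zero, Finset.prod_const_one, one_mul]
  unfold sectorForm
  ring

/-- The contribution of the part `(1, ∞) × (0, 1)^(n-1)` of a sector vanishes. -/
lemma hasVal_sector_tail (ha : ∀ k, 1 ≤ a k) (hc : ∀ i k, 0 ≤ c i k)
    (hκ : ∀ i, 0 < c i (κ i)) (hc0 : ∃ i, 0 < c i 0) {δ : ℝ} (hδ : 0 < δ) (ψ : I → ℝ → ℂ)
    (hψ : ∀ i, ∃ A, HasExpansion (fun y => Complex.exp (δ * y) * ψ i y) A) :
    HasVal (Finset.univ.erase 0) (fun _ => 1) a b l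
      (fun t => ∏ i, (sectorUnit (c i) (κ i) t : ℂ)⁻¹ * ψ i (sectorForm (c i) t)) 0 := by
  set N := ∑ k, (a k * (l + 1) + b k + 1) with hNdef
  have hN : ∀ k, a k * (l + 1) + b k + 1 ≤ N := fun k =>
    Finset.single_le_sum (f := fun k => a k * (l + 1) + b k + 1)
      (fun _ _ => Nat.zero_le _) (Finset.mem_univ k)
  set C : Fin (m + 1) → ℝ := fun k => ∑ i, (c i k : ℝ) with hC
  have hC0 : 0 < C 0 := by
    obtain ⟨i, hi⟩ := hc0
    exact Finset.sum_pos' (fun i _ => by exact_mod_cast hc i 0)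
      ⟨i, Finset.mem_univ i, by exact_mod_cast hi⟩
  have hψT : ∀ i, Tame (Finset.univ.erase 0) N 0 (fun t =>
      Complex.exp (δ * sectorForm (c i) t) * ψ i (sectorForm (c i) t)) := fun i => by
    obtain ⟨A, hA⟩ := hψ i
    exact hA.tame (Finset.univ.erase 0) N (b := Finset.univ)
      (c := fun k => (c i k : ℝ)) (s := Finset.Iic) (fun k _ => by exact_mod_cast hc i k) (by simp)
  have hU : Tame (Finset.univ.erase 0) N 0 (fun t => ∏ i, (sectorUnit (c i) (κ i) t : ℂ)⁻¹) :=
    Tame.prod _ fun i _ => Tame.inv_multilin _ _ (by exact_mod_cast hκ i)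
      (fun k _ => by exact_mod_cast hc i k)
  have hE := (HasExpansion.exp (κ := -(δ : ℂ)) (by simpa using hδ.le)).tame
    (Finset.univ.erase 0) N (b := Finset.Ioi (0 : Fin (m + 1))) (c := C) (s := Finset.Iic)
    (fun k _ => Finset.sum_nonneg fun i _ => by exact_mod_cast hc i k) (by simp)
  obtain ⟨v, hv, hv0⟩ := ((hE.mul (hU.mul (Tame.prod Finset.univ fun i _ => hψT i))).mono
    (Nat.zero_le _)).hasVal (b := b) (l := l) (isWeight_exp (mul_pos hδ hC0)) ha hN 0
  rw [hv0 (.inl ⟨0, .inl (by simp)⟩)] at hv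
  refine hv.congr_weight fun t _ => ?_
  have h1 : ∑ i, sectorForm (c i) t = C 0 * t 0 + multilin (Finset.Ioi 0) C Finset.Iic t := by
    have h2 : (Finset.univ : Finset (Fin (m + 1))) = insert 0 (Finset.Ioi 0) := by
      ext k
      simpa using em (k = 0)
    have h3 : (Finset.Iic (0 : Fin (m + 1))) = {0} := by
      ext k
      simp
    unfold sectorForm multilin
    rw [Finset.sum_comm]
    simp only [← Finset.sum_mul]
    rw [h2, Finset.sum_insert (by simp), h3, Finset.prod_singleton, hC]
  have h4 : ((Real.exp (-(δ * C 0 * t 0)) : ℝ) : ℂ) *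
      (Complex.exp (-(δ : ℂ) * (multilin (Finset.Ioi 0) C Finset.Iic t : ℝ)) *
        ∏ i, Complex.exp (δ * sectorForm (c i) t)) = 1 := by
    rw [← Complex.exp_sum, ← Finset.mul_sum, ← ofReal_sum, h1, ofReal_exp, ← Complex.exp_add,
      ← Complex.exp_add]
    push_cast
    rw [← Complex.exp_zero]
    congr 1
    ring
  simp only [Pi.zero_apply, pow_zero, Finset.prod_const_one, one_mul, Finset.prod_mul_distrib,
    ofReal_one]
  linear_combination (-(∏ i, (sectorUnit (c i) (κ i) t : ℂ)⁻¹) *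
    ∏ i, ψ i (sectorForm (c i) t)) * h4

end Sector

section Sectors

variable {m : ℕ}

/-- The monomial parametrisation `t ↦ (t_0, t_0 t_1, t_0 t_1 t_2, …)` of the sector
`u_0 > u_1 > ⋯ > 0`. -/
def sectorMap (t : Fin (m + 1) → ℝ) (k : Fin (m + 1)) : ℝ := ∏ j ∈ Finset.Iic k, t j

/-- The domain of `sectorMap`. -/
def sectorDomain (m : ℕ) : Set (Fin (m + 1) → ℝ) :=
  {t | 0 < t 0 ∧ ∀ k, k ≠ 0 → t k ∈ Set.Ioo (0 : ℝ) 1}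

/-- The Jacobian of `sectorMap`. -/
def sectorJacobian (t : Fin (m + 1) → ℝ) : ℝ := ∏ k, ∏ j ∈ Finset.Iio k, t j

lemma sectorMap_zero (t : Fin (m + 1) → ℝ) : sectorMap t 0 = t 0 := by
  have : Finset.Iic (0 : Fin (m + 1)) = {0} := by ext; simp
  simp [sectorMap, this]

lemma sectorMap_succ (t : Fin (m + 1) → ℝ) (k : Fin m) :
    sectorMap t k.succ = sectorMap t k.castSucc * t k.succ := by
  have : Finset.Iic k.succ = insert k.succ (Finset.Iic k.castSucc) := by
    ext j
    simp only [Finset.mem_insert, Finset.mem_Iic, Fin.le_def, Fin.ext_iff, Fin.val_succ,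
      Fin.val_castSucc]
    omega
  rw [sectorMap, this, Finset.prod_insert (by simp [Fin.le_def]), mul_comm, sectorMap]

lemma sectorMap_pos {t : Fin (m + 1) → ℝ} (ht : ∀ k, 0 < t k) (k : Fin (m + 1)) :
    0 < sectorMap t k := Finset.prod_pos fun j _ => ht j

lemma sectorDomain_pos {t : Fin (m + 1) → ℝ} (ht : t ∈ sectorDomain m) (k : Fin (m + 1)) :
    0 < t k := by
  by_cases hk : k = 0
  · exact hk ▸ ht.1
  · exact (ht.2 k hk).1

lemma injOn_sectorMap : Set.InjOn (sectorMap (m := m)) (sectorDomain m) := by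
  intro t ht t' ht' h
  funext k
  refine Fin.cases ?_ (fun k => ?_) k
  · rw [← sectorMap_zero t, ← sectorMap_zero t', h]
  · have h1 := sectorMap_succ t k
    rw [h, sectorMap_succ t' k] at h1
    exact (mul_left_cancel₀ (sectorMap_pos (sectorDomain_pos ht') _).ne' h1).symm

lemma image_sectorMap :
    sectorMap '' sectorDomain m = {u : Fin (m + 1) → ℝ | (∀ k, 0 < u k) ∧ StrictAnti u} := by
  ext u
  constructor
  · rintro ⟨t, ht, rfl⟩
    refine ⟨sectorMap_pos (sectorDomain_pos ht), Fin.strictAnti_iff_succ_lt.2 fun k => ?_⟩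
    rw [sectorMap_succ]
    exact mul_lt_of_lt_one_right (sectorMap_pos (sectorDomain_pos ht) _)
      (ht.2 _ (Fin.succ_ne_zero k)).2
  · rintro ⟨h1, h2⟩
    refine ⟨Fin.cons (u 0) fun k => u k.succ / u k.castSucc, ⟨by simpa using h1 0, fun k hk => ?_⟩,
      ?_⟩
    · obtain ⟨k, rfl⟩ := Fin.exists_succ_eq.2 hk
      simp only [Fin.cons_succ]
      exact ⟨div_pos (h1 _) (h1 _), (div_lt_one (h1 _)).2 (h2 (Fin.castSucc_lt_succ))⟩
    · funext k
      induction k using Fin.induction with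
      | zero => simp [sectorMap_zero]
      | succ k ih =>
        rw [sectorMap_succ, ih, Fin.cons_succ, mul_div_cancel₀ _ (h1 _).ne']

lemma measurableSet_sectorDomain : MeasurableSet (sectorDomain m) := by
  have : sectorDomain m = {t | 0 < t 0} ∩ ⋂ k, ⋂ (_ : k ≠ 0), {t | t k ∈ Set.Ioo (0 : ℝ) 1} := by
    ext t; simp [sectorDomain]
  rw [this]
  refine (measurableSet_lt measurable_const (measurable_pi_apply 0)).inter
    (MeasurableSet.iInter fun k => MeasurableSet.iInter fun _ => ?_)
  exact measurable_pi_apply k measurableSet_Ioo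

/-- The matrix of partial derivatives of `sectorMap`. -/
def sectorMatrix (t : Fin (m + 1) → ℝ) : Matrix (Fin (m + 1)) (Fin (m + 1)) ℝ :=
  Matrix.of fun k j => if j ≤ k then ∏ i ∈ (Finset.Iic k).erase j, t i else 0

lemma hasFDerivAt_sectorMap (t : Fin (m + 1) → ℝ) :
    HasFDerivAt sectorMap (LinearMap.toContinuousLinearMap (Matrix.toLin' (sectorMatrix t))) t := by
  refine hasFDerivAt_pi'' fun k => ?_
  have h := hasFDerivAt_finsetProd (𝕜 := ℝ) (u := Finset.Iic k) (x := t)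
  refine h.congr_fderiv ?_
  ext v
  simp only [FunLike.coe_sum, Finset.sum_apply, FunLike.coe_smul,
    Pi.smul_apply, ContinuousLinearMap.proj_apply, smul_eq_mul, ContinuousLinearMap.comp_apply,
    LinearMap.coe_toContinuousLinearMap', Matrix.toLin'_apply, Matrix.mulVec, dotProduct,
    sectorMatrix, Matrix.of_apply, ite_mul, zero_mul]
  rw [← Finset.sum_filter]
  congr 1
  ext; simp

lemma det_sectorMatrix (t : Fin (m + 1) → ℝ) : (sectorMatrix t).det = sectorJacobian t := by
  rw [Matrix.det_of_isLowerTriangular]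
  · refine Finset.prod_congr rfl fun k _ => ?_
    simp only [sectorMatrix, Matrix.of_apply, le_refl, if_true]
    refine Finset.prod_congr ?_ fun _ _ => rfl
    ext j
    simp [lt_iff_le_and_ne, and_comm]
  · intro k j hkj
    simp only [sectorMatrix, Matrix.of_apply]
    exact if_neg (not_le.2 (by simpa using hkj))

lemma sectorJacobian_pos {t : Fin (m + 1) → ℝ} (ht : ∀ k, 0 < t k) : 0 < sectorJacobian t :=
  Finset.prod_pos fun _ _ => Finset.prod_pos fun j _ => ht j

lemma boxMeasure_eq_restrict (p : Finset (Fin (m + 1))) :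
    boxMeasure p = (volume : Measure (Fin (m + 1) → ℝ)).restrict
      (Set.univ.pi fun k => if k ∈ p then Set.Ioo 0 1 else Set.Ioi 1) :=
  (Measure.restrict_pi_pi _ _).symm

lemma restrict_sectorDomain :
    ((volume : Measure (Fin (m + 1) → ℝ)).restrict (sectorDomain m)) =
      boxMeasure Finset.univ + boxMeasure (Finset.univ.erase 0) := by
  have hm : ∀ p : Finset (Fin (m + 1)), MeasurableSet
      (Set.univ.pi fun k => if k ∈ p then Set.Ioo (0 : ℝ) 1 else Set.Ioi 1) := fun p =>
    MeasurableSet.univ_pi fun k => by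
      split_ifs
      · exact measurableSet_Ioo
      · exact measurableSet_Ioi
  rw [boxMeasure_eq_restrict, boxMeasure_eq_restrict, ← Measure.restrict_union _ (hm _)]
  · refine Measure.restrict_congr_set ?_
    have h := Measure.ae_eval_ne (fun _ : Fin (m + 1) => (volume : Measure ℝ)) 0 1
    filter_upwards [show ∀ᵐ y : Fin (m + 1) → ℝ, y 0 ≠ 1 from h] with t ht
    refine propext ⟨fun h => ?_, ?_⟩
    · rcases lt_or_gt_of_ne ht with h0 | h0
      · refine Or.inl fun k _ => ?_
        simp only [Finset.mem_univ, if_true]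
        by_cases hk : k = 0
        · exact hk ▸ ⟨h.1, h0⟩
        · exact h.2 k hk
      · refine Or.inr fun k _ => ?_
        by_cases hk : k = 0
        · simpa [hk] using h0
        · simpa [hk] using h.2 k hk
    · rintro (h | h)
      · have h' : ∀ k, t k ∈ Set.Ioo (0 : ℝ) 1 := fun k => by simpa using h k trivial
        exact ⟨(h' 0).1, fun k _ => h' k⟩
      · refine ⟨?_, fun k hk => by simpa [hk] using h k trivial⟩
        have : 1 < t 0 := by simpa using h 0 trivial
        linarith
  · rw [Set.disjoint_left]
    intro t h1 h2
    have h1' := h1 0 trivial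
    have h2' := h2 0 trivial
    simp at h1' h2'
    linarith

lemma integral_strictAnti {F : (Fin (m + 1) → ℝ) → ℂ}
    (hF : IntegrableOn F {u | (∀ k, 0 < u k) ∧ StrictAnti u}) :
    ∫ u in {u | (∀ k, 0 < u k) ∧ StrictAnti u}, F u =
      ∫ t, (sectorJacobian t : ℂ) * F (sectorMap t) ∂boxMeasure Finset.univ +
      ∫ t, (sectorJacobian t : ℂ) * F (sectorMap t) ∂boxMeasure (Finset.univ.erase 0) := by
  rw [← image_sectorMap] at hF ⊢
  have hd : ∀ t ∈ sectorDomain m, HasFDerivWithinAt sectorMap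
      (LinearMap.toContinuousLinearMap (Matrix.toLin' (sectorMatrix t))) (sectorDomain m) t :=
    fun t _ => (hasFDerivAt_sectorMap t).hasFDerivWithinAt
  have hdet : ∀ t ∈ sectorDomain m,
      |(LinearMap.toContinuousLinearMap (Matrix.toLin' (sectorMatrix t))).det| •
        F (sectorMap t) = (sectorJacobian t : ℂ) * F (sectorMap t) := fun t ht => by
    rw [LinearMap.det_toContinuousLinearMap, LinearMap.det_toLin', det_sectorMatrix,
      abs_of_pos (sectorJacobian_pos (sectorDomain_pos ht)), real_smul]
  have hi := (integrableOn_image_iff_integrableOn_abs_det_fderiv_smul volume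
    measurableSet_sectorDomain hd injOn_sectorMap F).1 hF
  rw [integral_image_eq_integral_abs_det_fderiv_smul volume measurableSet_sectorDomain hd
    injOn_sectorMap, setIntegral_congr_fun measurableSet_sectorDomain hdet]
  have hi' := hi.congr_fun hdet measurableSet_sectorDomain
  rw [IntegrableOn, restrict_sectorDomain, integrable_add_measure] at hi'
  rw [restrict_sectorDomain, integral_add_measure hi'.1 hi'.2]

lemma measurableSet_strictAnti :
    MeasurableSet {u : Fin (m + 1) → ℝ | (∀ k, 0 < u k) ∧ StrictAnti u} := by
  rw [← image_sectorMap]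
  exact measurable_image_of_fderivWithin measurableSet_sectorDomain
    (fun t _ => (hasFDerivAt_sectorMap t).hasFDerivWithinAt) injOn_sectorMap

lemma ae_injective : ∀ᵐ u : Fin (m + 1) → ℝ, Function.Injective u := by
  have h : ∀ i j : Fin (m + 1), i ≠ j → ∀ᵐ u : Fin (m + 1) → ℝ, u i ≠ u j := fun i j hij => by
    obtain ⟨φ, hφ⟩ : ∃ φ : (Fin (m + 1) → ℝ) →ₗ[ℝ] ℝ, ∀ u, φ u = u i - u j :=
      ⟨(LinearMap.proj i : (Fin (m + 1) → ℝ) →ₗ[ℝ] ℝ) - (LinearMap.proj j : (Fin (m + 1) → ℝ) →ₗ[ℝ] ℝ),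
        fun u => rfl⟩
    have h1 : LinearMap.ker φ ≠ ⊤ := fun h => by
      have h2 : (Pi.single i 1 : Fin (m + 1) → ℝ) ∈ LinearMap.ker φ := by rw [h]; trivial
      rw [LinearMap.mem_ker, hφ] at h2
      simp [hij.symm] at h2
    have h3 := Measure.addHaar_submodule volume _ h1
    refine measure_mono_null (fun u hu => ?_) h3
    have hu' : u i = u j := not_not.1 hu
    simp [hφ, hu']
  have h' : ∀ᵐ u : Fin (m + 1) → ℝ, ∀ i j : Fin (m + 1), i ≠ j → u i ≠ u j := by
    simp only [ae_all_iff]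
    exact h
  filter_upwards [h'] with u hu i j hij
  by_contra hne
  exact hu i j hne hij

/-- An integral over the positive orthant, decomposed according to the order of the coordinates
and written in the monomial coordinates of each sector. -/
lemma integral_sectors {F : (Fin (m + 1) → ℝ) → ℂ} (hF : IntegrableOn F {u | ∀ k, 0 < u k}) :
    ∫ u in {u | ∀ k, 0 < u k}, F u = ∑ σ : Equiv.Perm (Fin (m + 1)),
      (∫ t, (sectorJacobian t : ℂ) * F (sectorMap t ∘ σ) ∂boxMeasure Finset.univ +
      ∫ t, (sectorJacobian t : ℂ) * F (sectorMap t ∘ σ) ∂boxMeasure (Finset.univ.erase 0)) := by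
  set A : Set (Fin (m + 1) → ℝ) := {u | (∀ k, 0 < u k) ∧ StrictAnti u} with hA
  set e : Equiv.Perm (Fin (m + 1)) → ((Fin (m + 1) → ℝ) ≃ᵐ (Fin (m + 1) → ℝ)) := fun σ =>
    MeasurableEquiv.piCongrLeft (fun _ => ℝ) σ.symm with he
  have he' : ∀ σ u, e σ u = u ∘ σ := fun σ u => by
    funext k
    obtain ⟨k, rfl⟩ := σ.symm.surjective k
    simp only [he, MeasurableEquiv.coe_piCongrLeft, Function.comp, Equiv.apply_symm_apply]
    exact Equiv.piCongrLeft_apply_apply (fun _ => ℝ) σ.symm u k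
  have hmp : ∀ σ, MeasurePreserving (e σ) volume volume := fun σ =>
    volume_measurePreserving_piCongrLeft (fun _ : Fin (m + 1) => ℝ) σ.symm
  have hcov : ({u | ∀ k, 0 < u k} : Set (Fin (m + 1) → ℝ)) =ᵐ[volume] ⋃ σ, e σ '' A := by
    filter_upwards [ae_injective] with u hu
    refine propext ⟨fun h => ?_, fun h => ?_⟩
    · refine Set.mem_iUnion.2 ⟨(Tuple.sort (-u)).symm, u ∘ Tuple.sort (-u), ⟨fun k => h _, ?_⟩, ?_⟩
      · have h1 := Tuple.monotone_sort (-u)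
        have h2 : Antitone (u ∘ Tuple.sort (-u)) := fun i j hij => by
          have := h1 hij
          simpa using this
        exact h2.strictAnti_of_injective (hu.comp (Equiv.injective _))
      · rw [he']; funext k; simp
    · obtain ⟨σ, v, hv, rfl⟩ := Set.mem_iUnion.1 h
      rw [he']
      exact fun k => hv.1 _
  have hdisj : Pairwise (Function.onFun Disjoint fun σ => e σ '' A) := by
    intro σ τ hne
    rw [Function.onFun, Set.disjoint_left]
    rintro _ ⟨v, hv, rfl⟩ ⟨w, hw, h⟩
    rw [he', he'] at h
    refine hne ?_
    have h1 : w = v ∘ (σ * τ⁻¹ : Equiv.Perm (Fin (m + 1))) := by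
      funext k
      have := congrFun h (τ⁻¹ k)
      simpa using this
    have h2 : v ∘ (σ * τ⁻¹ : Equiv.Perm (Fin (m + 1))) = v ∘ (1 : Equiv.Perm (Fin (m + 1))) :=
      Tuple.unique_antitone (h1 ▸ hw.2.antitone) (by simpa using hv.2.antitone)
    have h3 : σ * τ⁻¹ = 1 := Equiv.ext fun k => hv.2.injective (congrFun h2 k)
    exact mul_inv_eq_one.1 h3
  have hms : ∀ σ, MeasurableSet (e σ '' A) := fun σ =>
    (e σ).measurableSet_image.2 measurableSet_strictAnti
  have hsub : ∀ σ, IntegrableOn F (e σ '' A) := fun σ => by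
    refine hF.mono_set ?_
    rintro _ ⟨v, hv, rfl⟩
    rw [he']
    exact fun k => hv.1 _
  rw [setIntegral_congr_set hcov, integral_iUnion_fintype hms hdisj hsub]
  refine Finset.sum_congr rfl fun σ _ => ?_
  have h1 := (hmp σ).setIntegral_image_emb (e σ).measurableEmbedding F A
  have h2 : IntegrableOn (fun u => F (e σ u)) A :=
    ((hmp σ).integrableOn_image (e σ).measurableEmbedding).1 (hsub σ)
  rw [h1, integral_strictAnti h2]
  simp only [he']

end Sectors

section Mellin

variable {m : ℕ} {I : Type} [Fintype I]

lemma prod_prod_Iic {M : Type*} [CommMonoid M] (f : Fin (m + 1) → M) :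
    ∏ k, ∏ j ∈ Finset.Iic k, f j = ∏ j, f j ^ (m + 1 - (j : ℕ)) := by
  rw [Finset.prod_comm' (t' := Finset.univ) (s' := fun j => Finset.Ici j) (by simp)]
  simp

lemma prod_prod_Iio {M : Type*} [CommMonoid M] (f : Fin (m + 1) → M) :
    ∏ k, ∏ j ∈ Finset.Iio k, f j = ∏ j, f j ^ (m - (j : ℕ)) := by
  rw [Finset.prod_comm' (t' := Finset.univ) (s' := fun j => Finset.Ioi j) (by simp)]
  simp

lemma prod_prod_Iic_comp {M : Type*} [CommMonoid M] (κ : I → Fin (m + 1))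
    (f : Fin (m + 1) → M) :
    ∏ i, ∏ j ∈ Finset.Iic (κ i), f j =
      ∏ j, f j ^ (Finset.univ.filter fun i => j ≤ κ i).card := by
  rw [Finset.prod_comm' (t' := Finset.univ)
    (s' := fun j => Finset.univ.filter fun i => j ≤ κ i) (by simp)]
  simp

lemma multilin_sectorMap (c : Fin (m + 1) → ℚ) (σ : Equiv.Perm (Fin (m + 1)))
    (t : Fin (m + 1) → ℝ) :
    ∑ k, (c k : ℝ) * (sectorMap t ∘ σ) k = sectorForm (c ∘ σ.symm) t := by
  unfold sectorForm multilin
  rw [← Equiv.sum_comp σ fun k => ((c ∘ σ.symm) k : ℝ) * ∏ j ∈ Finset.Iic k, t j]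
  simp [sectorMap]

lemma mellin_integrand_sector (c : I → Fin (m + 1) → ℚ) (σ : Equiv.Perm (Fin (m + 1)))
    (κ : I → Fin (m + 1)) (hκ : ∀ i, ∀ k < κ i, (c i ∘ σ.symm) k = 0) (ψ : I → ℝ → ℂ) (s : ℂ)
    {t : Fin (m + 1) → ℝ} (ht : ∀ k, 0 < t k) :
    (sectorJacobian t : ℂ) * ((∏ k, (((sectorMap t ∘ σ) k : ℝ) : ℂ) ^ (s - 1)) *
      ∏ i, ((∑ k, (c i k : ℝ) * (sectorMap t ∘ σ) k : ℝ) : ℂ)⁻¹ *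
        ψ i (∑ k, (c i k : ℝ) * (sectorMap t ∘ σ) k)) =
    mellinKernel (fun k => m + 1 - k) (fun k => (Finset.univ.filter fun i => k ≤ κ i).card) s t *
      (((1 : ℝ) : ℂ) * ∏ i, (sectorUnit (c i ∘ σ.symm) (κ i) t : ℂ)⁻¹ *
        ψ i (sectorForm (c i ∘ σ.symm) t)) := by
  simp only [multilin_sectorMap]
  have h1 : ∏ k, (((sectorMap t ∘ σ) k : ℝ) : ℂ) ^ (s - 1) =
      ∏ j, ((t j : ℂ) ^ (s - 1)) ^ (m + 1 - (j : ℕ)) := by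
    rw [← prod_prod_Iic]
    simp only [Function.comp]
    rw [Equiv.prod_comp σ fun k => ((sectorMap t k : ℝ) : ℂ) ^ (s - 1)]
    refine Finset.prod_congr rfl fun k _ => ?_
    rw [sectorMap]
    induction Finset.Iic k using Finset.induction_on with
    | empty => simp
    | insert j u hj ih =>
      rw [Finset.prod_insert hj, Finset.prod_insert hj, ← ih, ofReal_mul,
        mul_cpow_ofReal_nonneg (ht j).le (Finset.prod_nonneg fun i _ => (ht i).le)]
  have h2 : (sectorJacobian t : ℂ) = ∏ j, (t j : ℂ) ^ (m - (j : ℕ)) := by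
    rw [sectorJacobian, prod_prod_Iio]
    push_cast
    rfl
  have h3 : ∏ i, ((sectorForm (c i ∘ σ.symm) t : ℝ) : ℂ)⁻¹ * ψ i (sectorForm (c i ∘ σ.symm) t) =
      (∏ j, ((t j : ℂ)⁻¹) ^ (Finset.univ.filter fun i => j ≤ κ i).card) *
        ∏ i, (sectorUnit (c i ∘ σ.symm) (κ i) t : ℂ)⁻¹ * ψ i (sectorForm (c i ∘ σ.symm) t) := by
    rw [← prod_prod_Iic_comp κ, ← Finset.prod_mul_distrib]
    refine Finset.prod_congr rfl fun i _ => ?_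
    conv_lhs => rw [show ((sectorForm (c i ∘ σ.symm) t : ℝ) : ℂ)⁻¹ =
      (∏ j ∈ Finset.Iic (κ i), (t j : ℂ)⁻¹) * (sectorUnit (c i ∘ σ.symm) (κ i) t : ℂ)⁻¹ by
        rw [sectorForm_eq (hκ i)]; push_cast; rw [mul_inv, Finset.prod_inv_distrib]]
    rw [mul_assoc]
  rw [h1, h2, h3, ofReal_one, one_mul, ← mul_assoc, ← mul_assoc, ← Finset.prod_mul_distrib,
    ← Finset.prod_mul_distrib, mellinKernel]
  congr 1
  refine Finset.prod_congr rfl fun k _ => ?_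
  have h0 : (t k : ℂ) ≠ 0 := ofReal_ne_zero.2 (ht k).ne'
  rw [← cpow_nat_mul, ← cpow_natCast, ← cpow_natCast, inv_cpow_eq_ite, if_neg, ← cpow_neg,
    ← cpow_add _ _ h0, ← cpow_add _ _ h0]
  · congr 1
    have hk : (k : ℕ) ≤ m := Nat.le_of_lt_succ k.2
    push_cast [hk, hk.trans (Nat.le_succ m)]
    ring
  · rw [arg_ofReal_of_nonneg (ht k).le]
    exact Real.pi_pos.ne

/-- The Mellin-type integral attached to linear forms with non-negative rational coefficients:
its leading coefficient at `s = -ℓ` depends linearly on products of Taylor coefficients of the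
`ψ i`, with rational weights that do not depend on the `ψ i`. -/
lemma hasPolarCoeff_mellin (l : ℕ) (c : I → Fin (m + 1) → ℚ) (hc : ∀ i k, 0 ≤ c i k)
    (hrow : ∀ i, ∃ k, c i k ≠ 0) (hcol : ∀ k, ∃ i, c i k ≠ 0) :
    ∃ ρ : (I → ℕ) → ℚ, ∀ (ψ : I → ℝ → ℂ) (A : I → PowerSeries ℂ) (δ : ℝ) (R : ℝ),
      (∀ i, HasExpansion (ψ i) (A i)) → 0 < δ →
      (∀ i, ∃ A', HasExpansion (fun y => cexp (δ * y) * ψ i y) A') →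
      (∀ s : ℂ, R < s.re → IntegrableOn (fun u : Fin (m + 1) → ℝ =>
        (∏ k, (u k : ℂ) ^ (s - 1)) * ∏ i, ((∑ k, (c i k : ℝ) * u k : ℝ) : ℂ)⁻¹ *
          ψ i (∑ k, (c i k : ℝ) * u k)) {u | ∀ k, 0 < u k}) →
      HasPolarCoeff l (m + 1) (fun s => ∫ u in {u : Fin (m + 1) → ℝ | ∀ k, 0 < u k},
        (∏ k, (u k : ℂ) ^ (s - 1)) * ∏ i, ((∑ k, (c i k : ℝ) * u k : ℝ) : ℂ)⁻¹ *
          ψ i (∑ k, (c i k : ℝ) * u k))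
        (∑ L ∈ Finset.piAntidiag Finset.univ ((m + 1) * l + Fintype.card I),
          (∏ i, PowerSeries.coeff (L i) (A i)) * ρ L) := by
  have hκ : ∀ (σ : Equiv.Perm (Fin (m + 1))) (i : I), ∃ κ : Fin (m + 1),
      (c i ∘ σ.symm) κ ≠ 0 ∧ ∀ k < κ, (c i ∘ σ.symm) k = 0 := fun σ i => by
    obtain ⟨k, hk⟩ := hrow i
    obtain ⟨κ, h1, h2⟩ := WellFounded.has_min (wellFounded_lt (α := Fin (m + 1)))
      {k | (c i ∘ σ.symm) k ≠ 0} ⟨σ k, by simpa using hk⟩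
    exact ⟨κ, h1, fun k hk => by_contra fun h => h2 k h hk⟩
  choose κ hκ0 hκ1 using hκ
  have ha : ∀ k : Fin (m + 1), 1 ≤ m + 1 - (k : ℕ) := fun k => by omega
  have hc' : ∀ (σ : Equiv.Perm (Fin (m + 1))) i k, 0 ≤ (c i ∘ σ.symm) k := fun σ i k => hc i _
  have hκp : ∀ σ i, 0 < (c i ∘ σ.symm) (κ σ i) := fun σ i => (hc' σ i _).lt_of_ne' (hκ0 σ i)
  have hmain := fun σ : Equiv.Perm (Fin (m + 1)) => hasVal_sector_main (l := l)
    (b := fun k => (Finset.univ.filter fun i => k ≤ κ σ i).card) ha (hc' σ) (hκp σ) (hκ1 σ)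
  choose ρ hρ using hmain
  refine ⟨fun L => ∑ σ, ρ σ L, fun ψ A δ R hψ hδ hψ' hInt => ?_⟩
  have h := HasPolarCoeff.sum (Finset.univ : Finset (Equiv.Perm (Fin (m + 1)))) fun σ _ =>
    (hρ σ ψ A hψ).2.add (hasVal_sector_tail (l := l)
      (b := fun k => (Finset.univ.filter fun i => k ≤ κ σ i).card) ha (hc' σ) (hκp σ)
      (by
        obtain ⟨i, hi⟩ := hcol (σ.symm 0)
        exact ⟨i, (hc' σ i _).lt_of_ne' hi⟩) hδ ψ hψ').2
  have hcoef : (∑ L ∈ Finset.piAntidiag Finset.univ ((m + 1) * l + Fintype.card I),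
      (∏ i, PowerSeries.coeff (L i) (A i)) * ((∑ σ, ρ σ L : ℚ) : ℂ)) =
      ∑ σ, ((∑ L ∈ Finset.piAntidiag Finset.univ ((m + 1 - ((0 : Fin (m + 1)) : ℕ)) * l +
        (Finset.univ.filter fun i => 0 ≤ κ σ i).card),
          (∏ i, PowerSeries.coeff (L i) (A i)) * (ρ σ L : ℂ)) + 0) := by
    simp only [add_zero, Fin.zero_le, Finset.filter_true, Finset.card_univ, Fin.val_zero,
      Nat.sub_zero]
    rw [Finset.sum_comm]
    refine Finset.sum_congr rfl fun L _ => ?_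
    push_cast
    rw [Finset.mul_sum]
  rw [hcoef]
  refine h.congr R fun s hs => ?_
  rw [integral_sectors (hInt s hs)]
  refine Finset.sum_congr rfl fun σ _ => ?_
  congr 1 <;>
  · refine integral_congr_ae ?_
    filter_upwards [ae_mem_poleBox _] with t ht
    exact mellin_integrand_sector c σ (κ σ) (hκ1 σ) ψ s (poleBox_pos ht)

end Mellin

section Laplace

lemma exists_pos_forall_le {ι : Type*} [Finite ι] (f : ι → ℝ) (hf : ∀ i, 0 < f i) :
    ∃ ε > 0, ∀ i, ε ≤ f i := by
  rcases isEmpty_or_nonempty ι with h | h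
  · exact ⟨1, one_pos, fun i => h.elim i⟩
  · obtain ⟨i, hi⟩ := Finite.exists_min f
    exact ⟨f i, hf i, hi⟩

lemma integrableOn_cpow_mul_exp {s : ℂ} (hs : 0 < s.re) {L : ℝ} (hL : 0 < L) :
    IntegrableOn (fun u : ℝ => (u : ℂ) ^ (s - 1) * cexp (-(L * u))) (Set.Ioi 0) ∧
    ∫ u in Set.Ioi (0 : ℝ), ‖(u : ℂ) ^ (s - 1) * cexp (-(L * u))‖ =
      (1 / L) ^ s.re * Real.Gamma s.re := by
  have hnorm : ∀ u ∈ Set.Ioi (0 : ℝ), ‖(u : ℂ) ^ (s - 1) * cexp (-(L * u))‖ =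
      u ^ (s.re - 1) * Real.exp (-(L * u)) := fun u hu => by
    rw [norm_mul, norm_cpow_eq_rpow_re_of_pos hu, norm_exp]
    simp
  constructor
  · have h := integrableOn_rpow_mul_exp_neg_mul_rpow (p := 1) (s := s.re - 1) (b := L)
      (by linarith) one_pos hL
    refine (integrable_norm_iff ?_).1 (h.congr_fun (fun u hu => ?_) measurableSet_Ioi)
    · exact Measurable.aestronglyMeasurable (by fun_prop)
    · simp only [hnorm u hu, Real.rpow_one, neg_mul]
  · rw [setIntegral_congr_fun measurableSet_Ioi hnorm, Real.integral_rpow_mul_exp_neg_mul_Ioi hs hL]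

lemma restrict_orthant (m : ℕ) :
    (volume : Measure (Fin m → ℝ)).restrict {u | ∀ k, 0 < u k} =
      Measure.pi fun _ => (volume : Measure ℝ).restrict (Set.Ioi 0) := by
  rw [volume_pi, ← Measure.restrict_pi_pi]
  congr 1
  ext u
  simp

variable {m : ℕ} {I : Type} [Fintype I] {Ω : Type} [MeasurableSpace Ω]

lemma rpow_bound {c : I → Fin (m + 1) → ℝ} (hc : ∀ i k, 0 ≤ c i k)
    (hrow : ∀ i, ∃ k, c i k ≠ 0) (hcol : ∀ k, ∃ i, c i k ≠ 0) {ε : ℝ} (hε : 0 < ε)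
    (hcε : ∀ i k, c i k ≠ 0 → ε ≤ c i k) {σ : ℝ} (hσ : 2 * Fintype.card I ≤ σ)
    {X : I → ℝ} (hX : ∀ i, ε ≤ X i) :
    ∏ k, (1 / ∑ i, c i k * X i) ^ σ ≤
      (∏ _k : Fin (m + 1), (1 / (ε * ε)) ^ σ) * ∏ i, (ε ^ 2 * (X i ^ 2)⁻¹) := by
  have hX0 : ∀ i, 0 < X i := fun i => hε.trans_le (hX i)
  have hL : ∀ i k, c i k ≠ 0 → ε * X i ≤ ∑ i, c i k * X i := fun i k hik =>
    (mul_le_mul_of_nonneg_right (hcε i k hik) (hX0 i).le).trans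
      (Finset.single_le_sum (f := fun i => c i k * X i)
        (fun j _ => mul_nonneg (hc j k) (hX0 j).le) (Finset.mem_univ i))
  have hL1 : ∀ k, ε * ε ≤ ∑ i, c i k * X i := fun k => by
    obtain ⟨i, hi⟩ := hcol k
    exact (mul_le_mul_of_nonneg_left (hX i) hε.le).trans (hL i k hi)
  have hε2 : 0 < ε * ε := mul_pos hε hε
  set M : Fin (m + 1) → ℝ := fun k => (ε * ε) / ∑ i, c i k * X i with hM
  have hM0 : ∀ k, 0 < M k := fun k => div_pos hε2 (hε2.trans_le (hL1 k))
  have hM1 : ∀ k, M k ≤ 1 := fun k => (div_le_one (hε2.trans_le (hL1 k))).2 (hL1 k)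
  have h1 : ∀ k, (1 / ∑ i, c i k * X i) ^ σ = (1 / (ε * ε)) ^ σ * M k ^ σ := fun k => by
    rw [← Real.mul_rpow (by positivity) (hM0 k).le]
    congr 1
    rw [hM]
    field_simp
  simp only [h1]
  rw [Finset.prod_mul_distrib]
  refine mul_le_mul_of_nonneg_left ?_ (Finset.prod_nonneg fun _ _ => by positivity)
  calc ∏ k, M k ^ σ ≤ ∏ k, M k ^ (2 * Fintype.card I) := by
        refine Finset.prod_le_prod (fun k _ => (Real.rpow_pos_of_pos (hM0 k) _).le) fun k _ => ?_
        rw [← Real.rpow_natCast]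
        exact Real.rpow_le_rpow_of_exponent_ge (hM0 k) (hM1 k) (by push_cast; exact hσ)
    _ = ∏ _i : I, (∏ k, M k) ^ 2 := by
        rw [Finset.prod_const, Finset.card_univ, ← pow_mul, Finset.prod_pow]
    _ ≤ ∏ i, (ε ^ 2 * (X i ^ 2)⁻¹) := by
        refine Finset.prod_le_prod (fun i _ => by positivity) fun i _ => ?_
        obtain ⟨k, hk⟩ := hrow i
        have h2 : ∏ k, M k ≤ M k := by
          rw [← Finset.mul_prod_erase _ _ (Finset.mem_univ k)]
          exact mul_le_of_le_one_right (hM0 k).le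
            (Finset.prod_le_one (fun j _ => (hM0 j).le) fun j _ => hM1 j)
        have h3 : M k ≤ ε / X i := by
          rw [hM, div_le_div_iff₀ (hε2.trans_le (hL1 k)) (hX0 i)]
          nlinarith [hL i k hk]
        have h4 : 0 ≤ ∏ k, M k := Finset.prod_nonneg fun k _ => (hM0 k).le
        calc (∏ k, M k) ^ 2 ≤ (ε / X i) ^ 2 := by gcongr; exact h2.trans h3
          _ = _ := by rw [div_pow]; rfl

/-- The Laplace-transform representation of a zeta integral or zeta series attached to linear
forms. -/
lemma laplace_representation (c : I → Fin (m + 1) → ℝ) (hc : ∀ i k, 0 ≤ c i k)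
    (hrow : ∀ i, ∃ k, c i k ≠ 0) (hcol : ∀ k, ∃ i, c i k ≠ 0) (ν : Measure Ω) [SigmaFinite ν]
    (X : I → Ω → ℝ) (hXm : ∀ i, Measurable (X i)) (x : I → ℝ) (hx : ∀ i, 0 < x i)
    (hX : ∀ i ω, x i ≤ X i ω) (hXi : ∀ i, Integrable (fun ω => (X i ω ^ 2)⁻¹) ν)
    {s : ℂ} (hs : 2 * Fintype.card I ≤ s.re) (hs0 : 0 < s.re) :
    IntegrableOn (fun u : Fin (m + 1) → ℝ => (∏ k, (u k : ℂ) ^ (s - 1)) *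
      ∏ i, ∫ ω, cexp (-(X i ω * (∑ k, c i k * u k : ℝ))) ∂ν) {u | ∀ k, 0 < u k} ∧
    ∫ u in {u : Fin (m + 1) → ℝ | ∀ k, 0 < u k}, (∏ k, (u k : ℂ) ^ (s - 1)) *
      ∏ i, ∫ ω, cexp (-(X i ω * (∑ k, c i k * u k : ℝ))) ∂ν =
    Complex.Gamma s ^ (m + 1) *
      ∫ ω, ∏ k, ((∑ i, c i k * X i (ω i) : ℝ) : ℂ) ^ (-s) ∂Measure.pi fun _ : I => ν := by
  obtain ⟨ε, hε, hcε, hXε⟩ : ∃ ε > 0, (∀ i k, c i k ≠ 0 → ε ≤ c i k) ∧ ∀ i ω, ε ≤ X i ω := by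
    obtain ⟨ε₁, h1, h1'⟩ := exists_pos_forall_le x hx
    obtain ⟨ε₂, h2, h2'⟩ := exists_pos_forall_le
      (fun p : {p : I × Fin (m + 1) // c p.1 p.2 ≠ 0} => c p.1.1 p.1.2)
      fun p => (hc _ _).lt_of_ne' p.2
    exact ⟨min ε₁ ε₂, lt_min h1 h2, fun i k hik => (min_le_right _ _).trans (h2' ⟨(i, k), hik⟩),
      fun i ω => (min_le_left _ _).trans ((h1' i).trans (hX i ω))⟩
  set Lf : (I → Ω) → Fin (m + 1) → ℝ := fun ω k => ∑ i, c i k * X i (ω i) with hLf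
  have hLpos : ∀ ω k, 0 < Lf ω k := fun ω k => by
    obtain ⟨i, hi⟩ := hcol k
    exact Finset.sum_pos' (fun j _ => mul_nonneg (hc j k) (hε.le.trans (hXε j _)))
      ⟨i, Finset.mem_univ i, mul_pos ((hc i k).lt_of_ne' hi) (hε.trans_le (hXε i _))⟩
  have hLm : ∀ k, Measurable fun ω => Lf ω k := fun k => by
    refine Finset.measurable_sum _ fun i _ => ?_
    exact ((hXm i).comp (measurable_pi_apply i)).const_mul _
  set P : Measure (Fin (m + 1) → ℝ) :=
    Measure.pi fun _ => (volume : Measure ℝ).restrict (Set.Ioi 0) with hP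
  set G : (Fin (m + 1) → ℝ) → (I → Ω) → ℂ := fun u ω =>
    ∏ k, ((u k : ℂ) ^ (s - 1) * cexp (-(Lf ω k * u k))) with hG
  have hGm : Measurable (Function.uncurry G) := by
    refine Finset.measurable_prod _ fun k _ => ?_
    have h1 : Measurable fun p : (Fin (m + 1) → ℝ) × (I → Ω) => p.1 k :=
      (measurable_pi_apply k).comp measurable_fst
    have h2 : Measurable fun p : (Fin (m + 1) → ℝ) × (I → Ω) => Lf p.2 k :=
      (hLm k).comp measurable_snd
    fun_prop
  have hGu : ∀ u ω, G u ω = (∏ k, (u k : ℂ) ^ (s - 1)) *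
      ∏ i, cexp (-(X i (ω i) * (∑ k, c i k * u k : ℝ))) := fun u ω => by
    simp only [hG, hLf]
    rw [Finset.prod_mul_distrib, ← exp_sum, ← exp_sum]
    congr 2
    push_cast
    simp only [Finset.sum_neg_distrib, Finset.mul_sum, Finset.sum_mul]
    rw [Finset.sum_comm]
    congr 1
    exact Finset.sum_congr rfl fun i _ => Finset.sum_congr rfl fun k _ => by ring
  have hGint : Integrable (Function.uncurry G) (P.prod (Measure.pi fun _ : I => ν)) := by
    refine (integrable_prod_iff' hGm.aestronglyMeasurable).2 ⟨Filter.Eventually.of_forall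
      fun ω => ?_, ?_⟩
    · exact Integrable.fintype_prod (f := fun k (u : ℝ) => (u : ℂ) ^ (s - 1) *
        cexp (-(Lf ω k * u))) (μ := fun _ => volume.restrict (Set.Ioi 0))
        fun k => (integrableOn_cpow_mul_exp hs0 (hLpos ω k)).1
    · have h1 : ∀ ω, ∫ u, ‖Function.uncurry G (u, ω)‖ ∂P =
          ∏ k, ((1 / Lf ω k) ^ s.re * Real.Gamma s.re) := fun ω => by
        simp only [Function.uncurry, hG, norm_prod]
        rw [hP, integral_fintype_prod_eq_prod (f := fun k (u : ℝ) => ‖(u : ℂ) ^ (s - 1) *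
          cexp (-(Lf ω k * u))‖) (μ := fun _ => volume.restrict (Set.Ioi 0))]
        exact Finset.prod_congr rfl fun k _ => (integrableOn_cpow_mul_exp hs0 (hLpos ω k)).2
      simp only [h1, Finset.prod_mul_distrib]
      refine Integrable.mul_const ?_ _
      have h2 : Integrable (fun ω : I → Ω => (∏ _k : Fin (m + 1), (1 / (ε * ε)) ^ s.re) *
          ∏ i, (ε ^ 2 * (X i (ω i) ^ 2)⁻¹)) (Measure.pi fun _ : I => ν) :=
        (Integrable.fintype_prod (f := fun i ω => ε ^ 2 * (X i ω ^ 2)⁻¹) (μ := fun _ => ν)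
          fun i => (hXi i).const_mul _).const_mul _
      refine h2.mono' ?_ (Filter.Eventually.of_forall fun ω => ?_)
      · exact (Finset.measurable_prod _ fun k _ =>
          ((hLm k).const_div 1).pow_const _).aestronglyMeasurable
      · rw [Real.norm_of_nonneg (Finset.prod_nonneg fun k _ =>
          Real.rpow_nonneg (one_div_nonneg.2 (hLpos ω k).le) _)]
        exact rpow_bound hc hrow hcol hε hcε hs fun i => hXε i _
  have hGω : ∀ u, ∫ ω, G u ω ∂(Measure.pi fun _ : I => ν) = (∏ k, (u k : ℂ) ^ (s - 1)) *
      ∏ i, ∫ ω, cexp (-(X i ω * (∑ k, c i k * u k : ℝ))) ∂ν := fun u => by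
    simp only [hGu]
    rw [integral_const_mul, integral_fintype_prod_eq_prod (μ := fun _ => ν)
      (f := fun i ω => cexp (-(X i ω * (∑ k, c i k * u k : ℝ))))]
  have hGu' : ∀ ω, ∫ u, G u ω ∂P = Complex.Gamma s ^ (m + 1) * ∏ k, (Lf ω k : ℂ) ^ (-s) :=
    fun ω => by
    simp only [hG]
    rw [hP, integral_fintype_prod_eq_prod (f := fun k (u : ℝ) => (u : ℂ) ^ (s - 1) *
      cexp (-(Lf ω k * u))) (μ := fun _ => volume.restrict (Set.Ioi 0))]
    have : ∀ k, ∫ u in Set.Ioi (0 : ℝ), (u : ℂ) ^ (s - 1) * cexp (-(Lf ω k * u)) =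
        Complex.Gamma s * (Lf ω k : ℂ) ^ (-s) := fun k => by
      rw [integral_cpow_mul_exp_neg_mul_Ioi hs0 (hLpos ω k), one_div, inv_cpow, cpow_neg, mul_comm]
      rw [arg_ofReal_of_nonneg (hLpos ω k).le]
      exact Real.pi_pos.ne
    simp only [this, Finset.prod_mul_distrib, Finset.prod_const, Finset.card_univ,
      Fintype.card_fin]
  rw [IntegrableOn, restrict_orthant]
  simp only [← hGω]
  refine ⟨hGint.integral_prod_left, ?_⟩
  rw [integral_integral_swap hGint]
  simp only [hGu', integral_const_mul]
  rfl

end Laplace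

section Evaluation

/-- The residue of the Gamma function at `-ℓ`. -/
lemma tendsto_add_mul_Gamma (l : ℕ) :
    Filter.Tendsto (fun s : ℂ => (s + l) * Complex.Gamma s)
      (nhdsWithin (-(l : ℂ)) {-(l : ℂ)}ᶜ) (nhds ((-1) ^ l / (l.factorial : ℂ))) := by
  induction l with
  | zero => simpa using tendsto_self_mul_Gamma_nhds_zero
  | succ l ih =>
    have hmap : Filter.Tendsto (fun s : ℂ => s + 1)
        (nhdsWithin (-((l + 1 : ℕ) : ℂ)) {-((l + 1 : ℕ) : ℂ)}ᶜ)
        (nhdsWithin (-(l : ℂ)) {-(l : ℂ)}ᶜ) := by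
      refine tendsto_nhdsWithin_iff.2 ⟨?_, ?_⟩
      · have : Filter.Tendsto (fun s : ℂ => s + 1) (nhds (-((l + 1 : ℕ) : ℂ)))
            (nhds (-((l + 1 : ℕ) : ℂ) + 1)) := (continuous_id.add continuous_const).tendsto _
        rw [show -((l + 1 : ℕ) : ℂ) + 1 = -(l : ℂ) by push_cast; ring] at this
        exact this.mono_left nhdsWithin_le_nhds
      · filter_upwards [self_mem_nhdsWithin] with s hs h
        refine hs ?_
        have h' : s + 1 = -(l : ℂ) := h
        show s = _
        push_cast
        linear_combination h'
    have hinv : Filter.Tendsto (fun s : ℂ => s⁻¹)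
        (nhdsWithin (-((l + 1 : ℕ) : ℂ)) {-((l + 1 : ℕ) : ℂ)}ᶜ)
        (nhds (-((l + 1 : ℕ) : ℂ))⁻¹) :=
      (tendsto_inv₀ (neg_ne_zero.2 (Nat.cast_ne_zero.2 (Nat.succ_ne_zero l)))).mono_left
        nhdsWithin_le_nhds
    have h := (ih.comp hmap).mul hinv
    have hval : (-1 : ℂ) ^ l / (l.factorial : ℂ) * (-((l + 1 : ℕ) : ℂ))⁻¹ =
        (-1) ^ (l + 1) / ((l + 1).factorial : ℂ) := by
      rw [Nat.factorial_succ]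
      push_cast
      rw [pow_succ, div_mul_eq_mul_div, ← div_eq_mul_inv, div_div, mul_neg_one, neg_div, ← div_neg]
      congr 1
      ring
    rw [hval] at h
    refine h.congr' ?_
    have hne : ∀ᶠ s : ℂ in nhdsWithin (-((l + 1 : ℕ) : ℂ)) {-((l + 1 : ℕ) : ℂ)}ᶜ, s ≠ 0 :=
      Filter.Eventually.filter_mono nhdsWithin_le_nhds (isOpen_ne.mem_nhds
        (neg_ne_zero.2 (Nat.cast_ne_zero.2 (Nat.succ_ne_zero l))))
    filter_upwards [hne] with s hs
    simp only [Function.comp]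
    rw [Complex.Gamma_add_one s hs]
    push_cast
    field_simp
    ring

/-- The value at `-ℓ` of a meromorphic continuation, computed from the leading coefficient of its
product with a power of the Gamma function. -/
lemma HasPolarCoeff.eval {l n : ℕ} {F D : ℂ → ℂ} {κ : ℂ} {R : ℝ}
    (h : HasPolarCoeff l n (fun s => Complex.Gamma s ^ n * D s) κ)
    (hF : ∀ s : ℂ, R < s.re → F s = D s) (hm : MeromorphicOn F Set.univ)
    (ha : AnalyticAt ℂ F (-(l : ℂ))) :
    F (-(l : ℂ)) = ((-1) ^ l * (l.factorial : ℂ)) ^ n * κ := by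
  obtain ⟨R', Φ, hΦ, hΦR, hlim⟩ := h
  set H : ℂ → ℂ := fun s => Φ s * (Complex.Gamma s)⁻¹ ^ n - F s with hH
  have hG : MeromorphicOn (fun s => (Complex.Gamma s)⁻¹) (rightHalf l) := by
    have h1 : AnalyticOnNhd ℂ (fun s => (Complex.Gamma s)⁻¹) Set.univ :=
      (differentiable_one_div_Gamma.differentiableOn).analyticOnNhd isOpen_univ
    exact fun s _ => (h1 s trivial).meromorphicAt
  have hHm : MeromorphicOn H (rightHalf l) :=
    (hΦ.mul (hG.pow n)).sub fun s _ => hm s trivial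
  have hzero : ∀ s : ℂ, max (max R R') 0 < s.re → H s = 0 := fun s hs => by
    have h1 : R < s.re := (le_max_left _ _).trans_lt ((le_max_left _ _).trans_lt hs)
    have h2 : R' < s.re := (le_max_right _ _).trans_lt ((le_max_left _ _).trans_lt hs)
    have h3 : 0 < s.re := (le_max_right _ _).trans_lt hs
    have h4 : Complex.Gamma s ≠ 0 := Complex.Gamma_ne_zero_of_re_pos h3
    simp only [hH, hΦR s h2, hF s h1]
    rw [mul_right_comm, ← mul_pow, mul_inv_cancel₀ h4, one_pow, one_mul, sub_self]
  have hconn : IsPreconnected (rightHalf l) :=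
    (convex_halfSpace_re_gt _).isPreconnected
  have htop : meromorphicOrderAt H (-(l : ℂ)) = ⊤ := by
    by_contra hne
    set z : ℂ := ((max (max R R') 0 + 1 : ℝ) : ℂ) with hz
    have hzre : z.re = max (max R R') 0 + 1 := ofReal_re _
    have hz0 : (0 : ℝ) ≤ max (max R R') 0 := le_max_right _ _
    have hzm : z ∈ rightHalf l := by
      show -((l : ℝ) + 1) < z.re
      rw [hzre]
      have : (0 : ℝ) ≤ l := Nat.cast_nonneg l
      linarith
    refine hHm.meromorphicOrderAt_ne_top_of_isPreconnected hconn (neg_mem_rightHalf l) hzm hne ?_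
    refine meromorphicOrderAt_eq_top_iff.2 ?_
    have : {s : ℂ | max (max R R') 0 < s.re} ∈ nhds z :=
      (isOpen_lt continuous_const continuous_re).mem_nhds (by
        show _ < z.re
        rw [hzre]; linarith)
    exact Filter.Eventually.filter_mono nhdsWithin_le_nhds
      (Filter.mem_of_superset this fun s hs => hzero s hs)
  have hev := meromorphicOrderAt_eq_top_iff.1 htop
  have hGam := tendsto_add_mul_Gamma l
  have hc : ((-1 : ℂ) ^ l / (l.factorial : ℂ)) ≠ 0 :=
    div_ne_zero (pow_ne_zero _ (by norm_num)) (Nat.cast_ne_zero.2 (Nat.factorial_ne_zero l))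
  have hlim2 := hlim.mul ((hGam.inv₀ hc).pow n)
  have hlim3 : Filter.Tendsto F (nhdsWithin (-(l : ℂ)) {-(l : ℂ)}ᶜ)
      (nhds (κ * ((-1 : ℂ) ^ l / (l.factorial : ℂ))⁻¹ ^ n)) := by
    refine hlim2.congr' ?_
    filter_upwards [hev, self_mem_nhdsWithin] with s hs hsl
    have h1 : s + l ≠ 0 := fun h => hsl (eq_neg_of_add_eq_zero_left h)
    have h2 : F s = Φ s * (Complex.Gamma s)⁻¹ ^ n := (sub_eq_zero.1 hs).symm
    rw [h2, mul_inv, mul_pow, inv_pow (s + l)]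
    field_simp
  have hlim4 := ha.continuousAt.tendsto.mono_left
    (nhdsWithin_le_nhds (s := {-(l : ℂ)}ᶜ))
  rw [tendsto_nhds_unique hlim4 hlim3, mul_comm, inv_div]
  congr 2
  have : ((-1 : ℂ) ^ l) * (-1) ^ l = 1 := by rw [← mul_pow]; simp
  rw [div_eq_iff (pow_ne_zero _ (by norm_num))]
  linear_combination -(l.factorial : ℂ) * this

end Evaluation

section Continuation

variable {m : ℕ} {I : Type} [Fintype I]

lemma eval_continuation (l : ℕ) (c : I → Fin (m + 1) → ℚ) (hc : ∀ i k, 0 ≤ c i k)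
    (hrow : ∀ i, ∃ k, c i k ≠ 0) (hcol : ∀ k, ∃ i, c i k ≠ 0) :
    ∃ ρ : (I → ℕ) → ℚ, ∀ (Ω : Type) [MeasurableSpace Ω] (ν : Measure Ω) [SigmaFinite ν]
      (X : I → Ω → ℝ) (x : I → ℝ) (ψ : I → ℝ → ℂ) (A : I → PowerSeries ℂ) (δ R : ℝ) (F : ℂ → ℂ),
      (∀ i, Measurable (X i)) → (∀ i, 0 < x i) → (∀ i ω, x i ≤ X i ω) →
      (∀ i, Integrable (fun ω => (X i ω ^ 2)⁻¹) ν) →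
      (∀ i, ∀ y : ℝ, 0 < y → ∫ ω, cexp (-(X i ω * (y : ℝ))) ∂ν = (y : ℂ)⁻¹ * ψ i y) →
      (∀ i, HasExpansion (ψ i) (A i)) → 0 < δ →
      (∀ i, ∃ A', HasExpansion (fun y => cexp (δ * y) * ψ i y) A') →
      (∀ s : ℂ, R < s.re →
        F s = ∫ ω, ∏ k, ((∑ i, (c i k : ℝ) * X i (ω i) : ℝ) : ℂ) ^ (-s)
          ∂(Measure.pi fun _ : I => ν)) →
      MeromorphicOn F Set.univ → AnalyticAt ℂ F (-(l : ℂ)) →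
      F (-(l : ℂ)) = ((-1) ^ l * (l.factorial : ℂ)) ^ (m + 1) *
        ∑ L ∈ Finset.piAntidiag Finset.univ ((m + 1) * l + Fintype.card I),
          (∏ i, PowerSeries.coeff (L i) (A i)) * ρ L := by
  obtain ⟨ρ, hρ⟩ := hasPolarCoeff_mellin l c hc hrow hcol
  refine ⟨ρ, fun Ω _ ν _ X x ψ A δ R F hXm hx hX hXi hψ hA hδ hA' hF hm ha => ?_⟩
  have hpos : ∀ u ∈ {u : Fin (m + 1) → ℝ | ∀ k, 0 < u k}, ∀ i,
      0 < ∑ k, (c i k : ℝ) * u k := fun u hu i => by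
    obtain ⟨k, hk⟩ := hrow i
    have hc0 : ∀ k, (0 : ℝ) ≤ c i k := fun k => by exact_mod_cast hc i k
    have hck : (0 : ℝ) < c i k := by exact_mod_cast (hc i k).lt_of_ne' hk
    exact Finset.sum_pos' (fun k _ => mul_nonneg (hc0 k) (hu k).le)
      ⟨k, Finset.mem_univ k, mul_pos hck (hu k)⟩
  have hmeas : MeasurableSet {u : Fin (m + 1) → ℝ | ∀ k, 0 < u k} := by
    have : {u : Fin (m + 1) → ℝ | ∀ k, 0 < u k} = Set.univ.pi fun _ => Set.Ioi 0 := by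
      ext u
      simp
    rw [this]
    exact MeasurableSet.univ_pi fun _ => measurableSet_Ioi
  have hlap := fun (s : ℂ) (hs : 2 * (Fintype.card I : ℝ) ≤ s.re) (hs0 : 0 < s.re) =>
    laplace_representation (fun i k => (c i k : ℝ)) (fun i k => by exact_mod_cast hc i k)
      (fun i => by simpa using hrow i) (fun k => by simpa using hcol k) ν X hXm x hx hX hXi hs hs0
  have hcongr : ∀ s : ℂ, ∀ u ∈ {u : Fin (m + 1) → ℝ | ∀ k, 0 < u k},
      (∏ k, (u k : ℂ) ^ (s - 1)) * ∏ i, ∫ ω, cexp (-(X i ω * (∑ k, (c i k : ℝ) * u k : ℝ))) ∂ν =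
      (∏ k, (u k : ℂ) ^ (s - 1)) * ∏ i, ((∑ k, (c i k : ℝ) * u k : ℝ) : ℂ)⁻¹ *
          ψ i (∑ k, (c i k : ℝ) * u k) := fun s u hu => by
    congr 1
    exact Finset.prod_congr rfl fun i _ => hψ i _ (hpos u hu i)
  have hR0 : ∀ s : ℂ, 2 * (Fintype.card I : ℝ) < s.re → 0 < s.re := fun s hs =>
    lt_of_le_of_lt (by positivity) hs
  have hpolar := hρ ψ A δ (2 * (Fintype.card I : ℝ)) hA hδ hA' fun s hs =>
    ((hlap s hs.le (hR0 s hs)).1).congr_fun (hcongr s) hmeas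
  have hpolar' := hpolar.congr (F' := fun s => Complex.Gamma s ^ (m + 1) *
    ∫ ω, ∏ k, ((∑ i, (c i k : ℝ) * X i (ω i) : ℝ) : ℂ) ^ (-s) ∂(Measure.pi fun _ : I => ν))
    (2 * (Fintype.card I : ℝ)) fun s hs => by
      rw [← setIntegral_congr_fun hmeas (hcongr s)]
      exact (hlap s hs.le (hR0 s hs)).2.symm
  exact hpolar'.eval hF hm ha

end Continuation

section Uniqueness

lemma Tame.norm_le {N : ℕ} {G : (Fin 1 → ℝ) → ℂ}
    (h : Tame (Finset.univ : Finset (Fin (0 + 1))) N N G) :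
    ∃ C : ℝ, 0 ≤ C ∧ ∀ y ∈ Set.Ioo (0 : ℝ) 1, ‖G fun _ => y‖ ≤ C * y ^ N := by
  unfold Tame at h
  generalize hG' : (fun _ : Unit => G) = G' at h
  replace hG' : G = G' () := by rw [← hG']
  subst hG'
  induction h with
  | @elem G' h =>
    obtain ⟨P, e, g, C, K, h1, h2, h3, h4, h5, h6, h7⟩ := h
    refine ⟨C, h2, fun y hy => ?_⟩
    have hbox : (fun _ => y) ∈ poleBox (Finset.univ : Finset (Fin (0 + 1))) := fun k => by
      rw [if_pos (Finset.mem_univ k)]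
      exact hy
    have hg := h5 () _ hbox
    rw [h7 () _ hbox, norm_mul]
    simp only [growth, Fin.prod_univ_succ, Fin.prod_univ_zero, Finset.mem_univ, if_true, one_pow,
      mul_one, norm_pow, norm_real, Real.norm_of_nonneg hy.1.le] at hg ⊢
    by_cases hP : 0 ∈ P
    · rw [if_pos hP, mul_one] at hg
      calc y ^ e 0 * ‖g () fun _ => y‖ ≤ y ^ N * C :=
            mul_le_mul (pow_le_pow_of_le_one hy.1.le hy.2.le (h6 hP)) hg (norm_nonneg _)
              (pow_nonneg hy.1.le _)
        _ = _ := mul_comm _ _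
    · rw [if_neg hP] at hg
      calc y ^ e 0 * ‖g () fun _ => y‖ ≤ 1 * (C * y ^ N) :=
            mul_le_mul (pow_le_one₀ hy.1.le hy.2.le) hg (norm_nonneg _) zero_le_one
        _ = _ := one_mul _
  | @add G₁ G₂ G' _ _ h ih1 ih2 =>
    obtain ⟨C₁, hC₁, h₁⟩ := ih1
    obtain ⟨C₂, hC₂, h₂⟩ := ih2
    refine ⟨C₁ + C₂, by positivity, fun y hy => ?_⟩
    have hbox : (fun _ => y) ∈ poleBox (Finset.univ : Finset (Fin (0 + 1))) := fun k => by
      rw [if_pos (Finset.mem_univ k)]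
      exact hy
    rw [h () _ hbox, add_mul]
    exact norm_add_le_of_le (h₁ y hy) (h₂ y hy)

lemma HasExpansion.norm_sub_le {f : ℝ → ℂ} {A : PowerSeries ℂ} (h : HasExpansion f A) (N : ℕ) :
    ∃ C : ℝ, 0 ≤ C ∧ ∀ y ∈ Set.Ioo (0 : ℝ) 1,
      ‖f y - ∑ j ∈ Finset.range N, PowerSeries.coeff j A * (y : ℂ) ^ j‖ ≤ C * y ^ N := by
  have := (h 0 Finset.univ N Unit Finset.univ (fun _ => 1) (fun _ => Finset.univ)
    (by simp) (by simp)).norm_le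
  simpa [multilin] using this

/-- A function has at most one asymptotic expansion. -/
lemma HasExpansion.unique {f : ℝ → ℂ} {A A' : PowerSeries ℂ} (h : HasExpansion f A)
    (h' : HasExpansion f A') : A = A' := by
  ext j
  induction j using Nat.strong_induction_on with
  | _ j ih =>
    obtain ⟨C, hC, h1⟩ := h.norm_sub_le (j + 1)
    obtain ⟨C', hC', h2⟩ := h'.norm_sub_le (j + 1)
    by_contra hne
    set d := ‖PowerSeries.coeff j A - PowerSeries.coeff j A'‖ with hd
    have hd0 : 0 < d := norm_pos_iff.2 (sub_ne_zero.2 hne)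
    have key : ∀ y ∈ Set.Ioo (0 : ℝ) 1, d ≤ (C + C') * y := fun y hy => by
      have h3 := norm_sub_le_of_le (h2 y hy) (h1 y hy)
      rw [sub_sub_sub_cancel_left, Finset.sum_range_succ, Finset.sum_range_succ,
        Finset.sum_congr rfl fun i hi => by rw [ih i (Finset.mem_range.1 hi)],
        add_sub_add_left_eq_sub, ← sub_mul, norm_mul, norm_pow, norm_real,
        Real.norm_of_nonneg hy.1.le, ← add_mul, pow_succ] at h3
      have hyj : 0 < y ^ j := pow_pos hy.1 j
      refine le_of_mul_le_mul_right ?_ hyj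
      calc d * y ^ j ≤ _ := h3
        _ = _ := by ring
    have hpos : 0 < 2 * (C + C' + d + 1) := by positivity
    have := key (d / (2 * (C + C' + d + 1))) ⟨by positivity, by
      rw [div_lt_one hpos]; linarith⟩
    rw [mul_div_assoc', le_div_iff₀ hpos] at this
    nlinarith

end Uniqueness

section Todd

open scoped Real

lemma hasMoments_todd :
    HasMoments ((Measure.count : Measure ℕ).prod (volume.restrict (Set.Ioi (0 : ℝ))))
      (fun q => (((2 * π * (q.1 + 1))⁻¹ * Real.exp (-(2 * π * (q.1 + 1) * q.2)) : ℝ) : ℂ))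
      (fun q => 1 + |q.2|) := by
  have hπ := Real.pi_pos
  have ha : ∀ k : ℕ, 2 * π ≤ 2 * π * (k + 1) := fun k => by
    have : (0 : ℝ) ≤ k := Nat.cast_nonneg k
    nlinarith
  refine ⟨by fun_prop, fun K => ?_⟩
  obtain ⟨C, hC, h⟩ := one_add_pow_mul_exp_le (mul_pos two_pos hπ) K
  have hdom : Integrable (fun q : ℕ × ℝ => (2 * π * (q.1 + 1))⁻¹ *
      (C * Real.exp (-(2 * π * (q.1 + 1) / 2 * q.2))))
      ((Measure.count : Measure ℕ).prod (volume.restrict (Set.Ioi (0 : ℝ)))) := by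
    rw [integrable_prod_iff (by fun_prop)]
    have hInt : ∀ k : ℕ, IntegrableOn (fun v : ℝ => Real.exp (-(2 * π * (k + 1) / 2 * v)))
        (Set.Ioi 0) := fun k => integrableOn_exp_neg_mul (by positivity)
    refine ⟨.of_forall fun k => ((hInt k).const_mul C).const_mul (2 * π * ((k : ℝ) + 1))⁻¹, ?_⟩
    have heval : ∀ k : ℕ, ∫ v in Set.Ioi (0 : ℝ), ‖(2 * π * ((k : ℝ) + 1))⁻¹ *
        (C * Real.exp (-(2 * π * (k + 1) / 2 * v)))‖ =
        (2 * C / (2 * π) ^ 2) * (1 / ((k : ℝ) + 1) ^ 2) := fun k => by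
      have : ∀ v : ℝ, ‖(2 * π * ((k : ℝ) + 1))⁻¹ *
          (C * Real.exp (-(2 * π * (k + 1) / 2 * v)))‖ = (2 * π * ((k : ℝ) + 1))⁻¹ * C *
          Real.exp (-(2 * π * (k + 1) / 2) * v) := fun v => by
        rw [Real.norm_of_nonneg (by positivity), neg_mul]
        ring
      simp only [this]
      rw [integral_const_mul, integral_exp_mul_Ioi (by
        have : (0 : ℝ) < 2 * π * (k + 1) / 2 := by positivity
        linarith)]
      simp
      field_simp
    simp only [heval]
    rw [integrable_count_iff]
    exact (((summable_nat_add_iff 1).2 (Real.summable_one_div_nat_pow.2 one_lt_two)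
      |>.congr fun k => by push_cast; rfl).mul_left (2 * C / (2 * π) ^ 2)).norm
  refine hdom.mono' (by fun_prop) ?_
  have hae : ∀ᵐ q : ℕ × ℝ ∂((Measure.count : Measure ℕ).prod
      (volume.restrict (Set.Ioi (0 : ℝ)))), q.2 ∈ Set.Ioi (0 : ℝ) :=
    Measure.quasiMeasurePreserving_snd.ae (ae_restrict_mem measurableSet_Ioi)
  filter_upwards [hae] with q hq
  have hq' : 0 ≤ q.2 := le_of_lt hq
  rw [norm_real, Real.norm_of_nonneg (by positivity), Real.norm_of_nonneg (by positivity),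
    abs_of_nonneg hq', mul_assoc]
  exact mul_le_mul_of_nonneg_left (h _ (ha q.1) q.2 hq') (by positivity)

lemma integral_count_eq_tsum {ι : Type*} [MeasurableSpace ι] [MeasurableSingletonClass ι]
    [Countable ι] (f : ι → ℂ) : ∫ i, f i ∂Measure.count = ∑' i, f i := by
  by_cases hf : Integrable f Measure.count
  · rw [integral_countable hf]
    simp [measureReal_def]
  · rw [integral_undef hf, tsum_eq_zero_of_not_summable]
    exact fun h => hf (integrable_count_iff.2 h.norm)

lemma integral_todd (ε y : ℝ) :
    HasSum (fun k : ℕ => ((2 * π * (k + 1) : ℝ) : ℂ)⁻¹ *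
      ((2 * π * (k + 1) : ℝ) - ε * y * I : ℂ)⁻¹)
    (∫ q : ℕ × ℝ, (((2 * π * (q.1 + 1))⁻¹ * Real.exp (-(2 * π * (q.1 + 1) * q.2)) : ℝ) : ℂ) *
      cexp ((ε * max q.2 0 * I : ℂ) * y)
        ∂((Measure.count : Measure ℕ).prod (volume.restrict (Set.Ioi (0 : ℝ))))) := by
  have hInt : Integrable (fun q : ℕ × ℝ =>
      (((2 * π * (q.1 + 1))⁻¹ * Real.exp (-(2 * π * (q.1 + 1) * q.2)) : ℝ) : ℂ) *
      cexp ((ε * max q.2 0 * I : ℂ) * y))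
      ((Measure.count : Measure ℕ).prod (volume.restrict (Set.Ioi (0 : ℝ)))) := by
    refine Integrable.mono' (hasMoments_todd.2 0) (by fun_prop) (.of_forall fun q => ?_)
    rw [norm_mul, norm_exp]
    simp
  have hval : ∀ k : ℕ, ∫ v in Set.Ioi (0 : ℝ),
      (((2 * π * (k + 1))⁻¹ * Real.exp (-(2 * π * (k + 1) * v)) : ℝ) : ℂ) *
      cexp ((ε * max v 0 * I : ℂ) * y) = ((2 * π * (k + 1) : ℝ) : ℂ)⁻¹ *
      ((2 * π * (k + 1) : ℝ) - ε * y * I : ℂ)⁻¹ := fun k => by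
    have hk : (0 : ℝ) < 2 * π * (k + 1) := by have := Real.pi_pos; positivity
    have hre : (-((2 * π * (k + 1) : ℝ) - ε * y * I : ℂ)).re < 0 := by
      simpa using hk
    have h1 : ∀ v ∈ Set.Ioi (0 : ℝ),
        (((2 * π * (k + 1))⁻¹ * Real.exp (-(2 * π * (k + 1) * v)) : ℝ) : ℂ) *
        cexp ((ε * max v 0 * I : ℂ) * y) = ((2 * π * (k + 1) : ℝ) : ℂ)⁻¹ *
        cexp (-((2 * π * (k + 1) : ℝ) - ε * y * I : ℂ) * v) := fun v hv => by
      rw [max_eq_left (le_of_lt hv), ofReal_mul, ofReal_inv, mul_assoc, ofReal_exp, ← Complex.exp_add]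
      congr 2
      push_cast
      ring
    rw [setIntegral_congr_fun measurableSet_Ioi h1, integral_const_mul,
      integral_exp_mul_complex_Ioi hre]
    simp [neg_div, one_div, ← inv_neg]
  rw [integral_prod _ hInt, integral_count_eq_tsum]
  have hs := integrable_count_iff.1 hInt.integral_prod_left
  simp only [hval] at hs ⊢
  exact hs.of_norm.hasSum

/-- The integral in the partial fraction expansion of `toddFun`. -/
def toddIntegral (ε : ℝ) (y : ℝ) : ℂ :=
  ∫ q : ℕ × ℝ, (((2 * π * (q.1 + 1))⁻¹ * Real.exp (-(2 * π * (q.1 + 1) * q.2)) : ℝ) : ℂ) *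
    cexp ((ε * max q.2 0 * I : ℂ) * y)
      ∂((Measure.count : Measure ℕ).prod (volume.restrict (Set.Ioi (0 : ℝ))))

/-- The function `y / (1 - exp (-y))` on `[0, ∞)`. -/
def toddFun (y : ℝ) : ℂ :=
  1 + 2⁻¹ * y + (y * y) * (toddIntegral 1 y + toddIntegral (-1) y)

lemma exists_hasExpansion_toddFun : ∃ T, HasExpansion toddFun T := by
  have h : ∀ ε : ℝ, |ε| ≤ 1 → ∃ T, HasExpansion (toddIntegral ε) T := fun ε hε =>
    ⟨_, HasExpansion.integral_exp (B := fun q : ℕ × ℝ => 1 + |q.2|) (C := 1)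
      (fun q => by simp) hasMoments_todd
      (κ := fun q => (ε * max q.2 0 * I : ℂ)) (by fun_prop) (fun q => by
        have h1 : |max q.2 0| ≤ |q.2| := by
          rcases le_total q.2 0 with h | h
          · simp [max_eq_right h]
          · simp [max_eq_left h]
        have h2 : |ε| * |max q.2 0| ≤ 1 * |q.2| := mul_le_mul hε h1 (abs_nonneg _) zero_le_one
        rw [norm_mul, norm_I, mul_one, ← ofReal_mul, norm_real, Real.norm_eq_abs, abs_mul]
        linarith) (fun q => by simp)⟩
  obtain ⟨T₁, h₁⟩ := h 1 (by simp)
  obtain ⟨T₂, h₂⟩ := h (-1) (by simp)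
  exact ⟨_, ((HasExpansion.const 1).add ((HasExpansion.const 2⁻¹).mul HasExpansion.id)).add
    ((HasExpansion.id.mul HasExpansion.id).mul (h₁.add h₂))⟩

lemma one_sub_exp_mul_toddFun {y : ℝ} (hy : 0 ≤ y) : (1 - cexp (-y)) * toddFun y = y := by
  rcases hy.eq_or_lt with rfl | hy'
  · simp
  have hπ : (π : ℂ) ≠ 0 := ofReal_ne_zero.2 Real.pi_ne_zero
  have hyc : (y : ℂ) ≠ 0 := ofReal_ne_zero.2 hy'.ne'
  set z : ℂ := y * I / (2 * π) with hz
  have hz0 : z ≠ 0 := by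
    rw [hz]
    exact div_ne_zero (mul_ne_zero hyc I_ne_zero) (mul_ne_zero two_ne_zero hπ)
  have him : z.im ≠ 0 := by
    have : z = ((y / (2 * π) : ℝ) : ℂ) * I := by
      rw [hz]
      push_cast
      ring
    rw [this, mul_I_im, ofReal_re]
    have := Real.pi_pos
    positivity
  have hzi : z ∈ Complex.integerComplement := by
    rintro ⟨k, hk⟩
    exact him (by rw [← hk]; simp)
  have hsum := ((integral_todd 1 y).add (integral_todd (-1) y)).mul_left ((y : ℂ) * y)
  have hterm : ∀ k : ℕ, (y : ℂ) * y * (((2 * π * (k + 1) : ℝ) : ℂ)⁻¹ *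
      ((2 * π * (k + 1) : ℝ) - (1 : ℝ) * y * I : ℂ)⁻¹ + ((2 * π * (k + 1) : ℝ) : ℂ)⁻¹ *
      ((2 * π * (k + 1) : ℝ) - (-1 : ℝ) * y * I : ℂ)⁻¹) =
      z * (1 / (z - (k + 1)) + 1 / (z + (k + 1))) := fun k => by
    have hπ0 := Real.pi_pos
    have ha : ((2 * π * (k + 1) : ℝ) : ℂ) ≠ 0 := ofReal_ne_zero.2 (by positivity)
    have hM : ((2 * π * (k + 1) : ℝ) - y * I : ℂ) ≠ 0 := fun h => by
      simpa using ha (by simpa using congrArg (fun w : ℂ => (w.re : ℂ)) h)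
    have hP : ((2 * π * (k + 1) : ℝ) + y * I : ℂ) ≠ 0 := fun h => by
      simpa using ha (by simpa using congrArg (fun w : ℂ => (w.re : ℂ)) h)
    have e1 : z - (k + 1) = -((2 * π * (k + 1) : ℝ) - y * I : ℂ) / (2 * π) := by
      rw [hz]
      push_cast
      field_simp
      ring
    have e2 : z + (k + 1) = ((2 * π * (k + 1) : ℝ) + y * I : ℂ) / (2 * π) := by
      rw [hz]
      push_cast
      field_simp
      ring
    have e3 : ((2 * π * (k + 1) : ℝ) - (-1 : ℝ) * y * I : ℂ) = (2 * π * (k + 1) : ℝ) + y * I := by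
      push_cast
      ring
    rw [e1, e2, e3, ofReal_one, one_mul, hz]
    have e4 : (y : ℂ) * y = -(y * I) ^ 2 := by
      linear_combination (y : ℂ) ^ 2 * I_sq
    rw [e4]
    generalize ((2 * π * (k + 1) : ℝ) : ℂ) = a at *
    generalize (y : ℂ) * I = w at *
    field_simp
    ring
  simp only [hterm] at hsum
  have hJ : (y : ℂ) * y * (toddIntegral 1 y + toddIntegral (-1) y) =
      z * (π * Complex.cot (π * z) - 1 / z) := by
    rw [cot_series_rep' hzi, ← tsum_mul_left]
    exact hsum.tsum_eq.symm
  have hexp : cexp (2 * π * I * z) = cexp (-y) := by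
    congr 1
    rw [hz]
    field_simp
    linear_combination I_sq
  have hne : 1 - cexp (-y) ≠ 0 := by
    rw [← ofReal_neg, ← ofReal_exp, ← ofReal_one, ← ofReal_sub]
    exact ofReal_ne_zero.2 (sub_ne_zero.2 (Real.exp_lt_one_iff.2 (neg_lt_zero.2 hy')).ne')
  rw [toddFun, hJ, Complex.cot_pi_eq_exp_ratio, hexp, hz]
  field_simp
  ring

end Todd

section Expansions

lemma hasExpansion_exp_neg {x : ℝ} (hx : 0 ≤ x) :
    HasExpansion (fun y => cexp (-x * y))
      (PowerSeries.mk fun j => (-1) ^ j * (x : ℂ) ^ j / j.factorial) := by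
  have := HasExpansion.exp (κ := -x) (by simpa using hx)
  simpa only [neg_pow (x : ℂ)] using this

lemma hasExpansion_exp_neg_mul_toddFun {x : ℝ} (hx : 0 ≤ x) :
    HasExpansion (fun y => cexp (-x * y) * toddFun y)
      (PowerSeries.mk fun j =>
        (-1) ^ j * Polynomial.aeval (x : ℂ) (Polynomial.bernoulli j) / j.factorial) := by
  obtain ⟨T, hT⟩ := exists_hasExpansion_toddFun
  set B : PowerSeries ℂ := PowerSeries.mk fun j =>
    (-1) ^ j * Polynomial.aeval (x : ℂ) (Polynomial.bernoulli j) / j.factorial with hB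
  set E : PowerSeries ℂ := PowerSeries.mk fun j => (-1) ^ j * (x : ℂ) ^ j / j.factorial with hE
  set D : PowerSeries ℂ := PowerSeries.C 1 +
    PowerSeries.C (-1) * PowerSeries.mk (fun j => (-1 : ℂ) ^ j / j.factorial) with hD
  have h1 : HasExpansion (fun y => (1 : ℂ) + (-1) * cexp ((-1 : ℂ) * y)) D :=
    (HasExpansion.const 1).add ((HasExpansion.const (-1)).mul (HasExpansion.exp (by simp)))
  have hψ := (hasExpansion_exp_neg hx).mul hT
  have h2 := h1.mul hψ
  have h3 : HasExpansion (fun y => (1 + (-1) * cexp ((-1 : ℂ) * y)) * (cexp (-x * y) * toddFun y))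
      (PowerSeries.X * E) :=
    (HasExpansion.id.mul (hasExpansion_exp_neg hx)).congr fun y hy => by
      have := one_sub_exp_mul_toddFun hy
      rw [neg_one_mul (y : ℂ)]
      linear_combination cexp (-x * y) * this
  have hgen := congrArg (PowerSeries.rescale (-1 : ℂ))
    (Polynomial.bernoulli_generating_function (x : ℂ))
  rw [map_mul, map_mul, map_sub, map_one, PowerSeries.rescale_X] at hgen
  have hB' : PowerSeries.rescale (-1 : ℂ) (PowerSeries.mk fun n =>
      Polynomial.aeval (x : ℂ) ((1 / n.factorial : ℚ) • Polynomial.bernoulli n)) = B := by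
    ext j
    rw [PowerSeries.coeff_rescale, hB, PowerSeries.coeff_mk, PowerSeries.coeff_mk, map_smul,
      Algebra.smul_def]
    simp
    ring
  have hE' : PowerSeries.rescale (-1 : ℂ) (PowerSeries.rescale (x : ℂ) (PowerSeries.exp ℂ)) = E := by
    ext j
    rw [PowerSeries.coeff_rescale, PowerSeries.coeff_rescale, hE, PowerSeries.coeff_mk,
      PowerSeries.coeff_exp]
    simp
    ring
  have hD' : PowerSeries.rescale (-1 : ℂ) (PowerSeries.exp ℂ) - 1 = -D := by
    have : PowerSeries.rescale (-1 : ℂ) (PowerSeries.exp ℂ) =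
        PowerSeries.mk fun j => (-1 : ℂ) ^ j / j.factorial := by
      ext j
      rw [PowerSeries.coeff_rescale, PowerSeries.coeff_mk, PowerSeries.coeff_exp]
      simp
      ring
    rw [this, hD, map_neg, map_one]
    ring
  rw [hB', hE', hD', map_neg, map_one] at hgen
  have hD0 : D ≠ 0 := fun h => by
    have := congrArg (PowerSeries.coeff 1) h
    simp [hD] at this
  have hkey : D * (E * T) = D * B := by
    rw [h2.unique h3]
    linear_combination hgen
  rw [← mul_left_cancel₀ hD0 hkey]
  exact hψ

lemma integrableOn_inv_sq {x : ℝ} (hx : 0 < x) :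
    IntegrableOn (fun t : ℝ => ((max t 0 + x) ^ 2)⁻¹) (Set.Ioi 0) := by
  have h := integrableOn_add_rpow_Ioi_of_lt (a := -2) (c := 0) (m := x) (by norm_num)
    (by linarith)
  refine h.congr_fun (fun t ht => ?_) measurableSet_Ioi
  have ht0 : (0 : ℝ) < t := ht
  simp only [max_eq_left ht0.le]
  rw [Real.rpow_neg (by positivity), Real.rpow_two]

lemma summable_inv_sq {x : ℝ} (hx : 0 < x) : Summable fun k : ℕ => (((k : ℝ) + x) ^ 2)⁻¹ := by
  refine (summable_nat_add_iff 1).1 (Summable.of_nonneg_of_le (fun k => by positivity)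
    (fun k => ?_) ((summable_nat_add_iff 1).2 (Real.summable_nat_pow_inv.2 one_lt_two)))
  have : (0 : ℝ) < ((k + 1 : ℕ) : ℝ) := by positivity
  gcongr
  linarith

lemma laplace_Ioi {x y : ℝ} (hy : 0 < y) :
    ∫ t in Set.Ioi (0 : ℝ), cexp (-((max t 0 + x : ℝ) * (y : ℝ))) =
      (y : ℂ)⁻¹ * cexp (-x * y) := by
  have h1 : ∀ t ∈ Set.Ioi (0 : ℝ), cexp (-((max t 0 + x : ℝ) * (y : ℝ))) =
      cexp (-x * y) * cexp (-y * t) := fun t ht => by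
    rw [max_eq_left (le_of_lt ht), ← Complex.exp_add]
    congr 1
    push_cast
    ring
  rw [setIntegral_congr_fun measurableSet_Ioi h1, integral_const_mul,
    integral_exp_mul_complex_Ioi (by simpa using hy)]
  simp [div_eq_mul_inv, inv_neg, mul_comm]

lemma laplace_count {x y : ℝ} (hy : 0 < y) :
    ∫ k : ℕ, cexp (-(((k : ℝ) + x : ℝ) * (y : ℝ))) ∂Measure.count =
      (y : ℂ)⁻¹ * (cexp (-x * y) * toddFun y) := by
  have h1 : ∀ k : ℕ, cexp (-(((k : ℝ) + x : ℝ) * (y : ℝ))) =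
      cexp (-x * y) * cexp (-y) ^ k := fun k => by
    rw [← Complex.exp_nat_mul, ← Complex.exp_add]
    congr 1
    push_cast
    ring
  have hlt : ‖cexp (-y)‖ < 1 := by
    rw [norm_exp]
    simpa using hy
  have hne : 1 - cexp (-y) ≠ 0 := sub_ne_zero.2 fun h => by simp [← h] at hlt
  have hyc : (y : ℂ) ≠ 0 := ofReal_ne_zero.2 hy.ne'
  rw [integral_count_eq_tsum]
  simp only [h1]
  rw [tsum_mul_left, tsum_geometric_of_norm_lt_one hlt]
  have := one_sub_exp_mul_toddFun hy.le
  field_simp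
  linear_combination -this

lemma pi_count (I : Type) [Fintype I] :
    (Measure.pi fun _ : I => (Measure.count : Measure ℕ)) = Measure.count := by
  refine Measure.ext_of_singleton fun f => ?_
  simp

end Expansions

namespace RootSystemData

variable (S : RootSystemData r E)

lemma inner_self_pos {α : E} (hα : α ∈ S.pos) : 0 < ⟪α, α⟫ :=
  real_inner_self_pos.2 (S.ne_zero α (S.pos_subset hα))

lemma inner_weight_simple (i j : Fin r) :
    ⟪S.weight i, S.simple j⟫ = if i = j then ⟪S.simple j, S.simple j⟫ / 2 else 0 := by
  have h := S.weight_dual i j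
  have hp := S.inner_self_pos (S.simple_mem_pos j)
  rw [inner_smul_right] at h
  split_ifs at h ⊢
  · field_simp at h ⊢
    linarith
  · exact (mul_eq_zero.1 h).resolve_left (div_pos two_pos hp).ne'

lemma pairing_eq {α : E} {n : Fin r → ℕ} (hn : α = ∑ j, (n j : ℝ) • S.simple j) (i : Fin r) :
    S.pairing i α = n i * (⟪S.simple i, S.simple i⟫ / ⟪α, α⟫) := by
  have h : ⟪S.weight i, α⟫ = n i * (⟪S.simple i, S.simple i⟫ / 2) := by
    conv_lhs => rw [hn]
    simp [inner_sum, inner_smul_right, inner_weight_simple]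
  rw [pairing, inner_smul_right, h]
  ring

lemma pairing_nonneg {α : E} (hα : α ∈ S.pos) (i : Fin r) : 0 ≤ S.pairing i α := by
  obtain ⟨n, hn⟩ := S.simple_base α hα
  rw [S.pairing_eq hn]
  have h1 := (S.inner_self_pos hα).le
  have h2 := (S.inner_self_pos (S.simple_mem_pos i)).le
  positivity

lemma exists_pairing_ne_zero {α : E} (hα : α ∈ S.pos) : ∃ i, S.pairing i α ≠ 0 := by
  obtain ⟨n, hn⟩ := S.simple_base α hα
  by_contra! h
  refine S.ne_zero α (S.pos_subset hα) ?_
  rw [hn]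
  refine Finset.sum_eq_zero fun i _ => ?_
  have h0 := h i
  rw [S.pairing_eq hn] at h0
  have h1 := S.inner_self_pos hα
  have h2 := S.inner_self_pos (S.simple_mem_pos i)
  rcases mul_eq_zero.1 h0 with h3 | h3
  · rw [h3, zero_smul]
  · exact absurd h3 (div_pos h2 h1).ne'

lemma pairing_simple (i j : Fin r) : S.pairing i (S.simple j) = if i = j then 1 else 0 :=
  S.weight_dual i j

/-- The coroot of `α` is the combination of the simple coroots with coefficients the pairings. -/
lemma coroot_eq_sum {α : E} (hα : α ∈ S.pos) :
    (2 / ⟪α, α⟫) • α =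
      ∑ i, S.pairing i α • ((2 / ⟪S.simple i, S.simple i⟫) • S.simple i) := by
  obtain ⟨n, hn⟩ := S.simple_base α hα
  have h1 := (S.inner_self_pos hα).ne'
  calc (2 / ⟪α, α⟫) • α = (2 / ⟪α, α⟫) • ∑ j, (n j : ℝ) • S.simple j := by rw [← hn]
    _ = _ := by
      rw [Finset.smul_sum]
      refine Finset.sum_congr rfl fun i _ => ?_
      have h2 := (S.inner_self_pos (S.simple_mem_pos i)).ne'
      rw [smul_smul, smul_smul, S.pairing_eq hn]
      congr 1
      field_simp

lemma exists_rat_pairing {α : E} (hα : α ∈ S.pos) : ∃ p : Fin r → ℚ, ∀ i, (p i : ℝ) = S.pairing i α := by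
  have hC : ∀ i j, ∃ z : ℤ, ⟪S.simple j, (2 / ⟪S.simple i, S.simple i⟫) • S.simple i⟫ = (z : ℝ) :=
    fun i j => by
      obtain ⟨z, hz⟩ := S.crystallographic _ (S.pos_subset (S.simple_mem_pos i)) _
        (S.pos_subset (S.simple_mem_pos j))
      refine ⟨z, ?_⟩
      rw [← hz, inner_smul_right]
      ring
  choose C hC using hC
  have hz : ∀ j, ∃ z : ℤ, ⟪S.simple j, (2 / ⟪α, α⟫) • α⟫ = (z : ℝ) := fun j => by
    obtain ⟨z, hz⟩ := S.crystallographic _ (S.pos_subset hα) _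
      (S.pos_subset (S.simple_mem_pos j))
    refine ⟨z, ?_⟩
    rw [← hz, inner_smul_right]
    ring
  choose z hz using hz
  set M : Matrix (Fin r) (Fin r) ℚ := Matrix.of fun j i => (C i j : ℚ) with hM
  set Mr : Matrix (Fin r) (Fin r) ℝ := M.map (algebraMap ℚ ℝ) with hMr
  have hmul : ∀ v : Fin r → ℝ, Mr.mulVec v = fun j =>
      ⟪S.simple j, ∑ i, v i • ((2 / ⟪S.simple i, S.simple i⟫) • S.simple i)⟫ := fun v => by
    ext j
    simp only [inner_sum, inner_smul_right _ _ (v _), hC, Matrix.mulVec, dotProduct, hMr, hM]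
    simp [mul_comm]
  have hinj : Function.Injective Mr.mulVec := by
    refine (injective_iff_map_eq_zero Mr.mulVecLin).2 fun v hv => ?_
    set w := ∑ i, v i • ((2 / ⟪S.simple i, S.simple i⟫) • S.simple i) with hw
    have h0 : ∀ j, ⟪S.simple j, w⟫ = 0 := fun j => by
      have := congrFun ((hmul v).symm.trans hv) j
      exact this
    have hww : ⟪w, w⟫ = 0 := by
      conv_lhs => rw [hw]
      rw [sum_inner]
      exact Finset.sum_eq_zero fun i _ => by
        rw [real_inner_smul_left, real_inner_smul_left, ← hw, h0, mul_zero, mul_zero]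
    have hw0 := inner_self_eq_zero.1 hww
    ext i
    have : ⟪S.weight i, w⟫ = v i := by
      rw [hw, inner_sum]
      simp only [inner_smul_right _ _ (v _), S.weight_dual]
      simp
    rw [← this, hw0, inner_zero_right, Pi.zero_apply]
  have hu : IsUnit M := by
    have h1 := Matrix.mulVec_injective_iff_isUnit.1 hinj
    rw [Matrix.isUnit_iff_isUnit_det] at h1 ⊢
    have h2 : Mr.det = algebraMap ℚ ℝ M.det := (RingHom.map_det _ _).symm
    rw [h2, isUnit_iff_ne_zero] at h1
    exact isUnit_iff_ne_zero.2 fun h => h1 (by rw [h, map_zero])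
  refine ⟨M⁻¹.mulVec fun j => (z j : ℚ), ?_⟩
  set p := M⁻¹.mulVec fun j => (z j : ℚ) with hp
  have hMp : M.mulVec p = fun j => (z j : ℚ) := by
    rw [hp, Matrix.mulVec_mulVec, Matrix.mul_nonsing_inv _ ((Matrix.isUnit_iff_isUnit_det _).1 hu),
      Matrix.one_mulVec]
  have h1 : Mr.mulVec (fun i => (p i : ℝ)) = Mr.mulVec fun i => S.pairing i α := by
    rw [hmul (fun i => S.pairing i α), ← S.coroot_eq_sum hα]
    ext j
    rw [hz]
    have := congrArg (algebraMap ℚ ℝ) (congrFun hMp j)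
    simp only [Matrix.mulVec, dotProduct, map_sum, map_mul] at this
    simpa [Matrix.mulVec, dotProduct, hMr] using this
  exact fun i => congrFun (hinj h1) i

end RootSystemData

/-- Summing a function of the exponents against the coefficients of a homogeneous polynomial given
by its coefficients. -/
lemma sum_support_piAntidiag (d : ℕ) (a : (Fin r → ℕ) → ℚ) (φ : (Fin r → ℕ) → ℂ) :
    ∑ L ∈ (∑ L ∈ Finset.piAntidiag Finset.univ d,
        MvPolynomial.monomial (Finsupp.equivFunOnFinite.symm L) (a L)).support,
      (algebraMap ℚ ℂ) (MvPolynomial.coeff L (∑ L ∈ Finset.piAntidiag Finset.univ d,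
        MvPolynomial.monomial (Finsupp.equivFunOnFinite.symm L) (a L))) * φ L =
      ∑ L ∈ Finset.piAntidiag Finset.univ d, (a L : ℂ) * φ L := by
  set q : MvPolynomial (Fin r) ℚ := ∑ L ∈ Finset.piAntidiag Finset.univ d,
    MvPolynomial.monomial (Finsupp.equivFunOnFinite.symm L) (a L) with hq
  have hcoeff : ∀ L : Fin r →₀ ℕ, MvPolynomial.coeff L q =
      if (L : Fin r → ℕ) ∈ Finset.piAntidiag Finset.univ d then a L else 0 := fun L => by
    rw [hq, MvPolynomial.coeff_sum]
    simp only [MvPolynomial.coeff_monomial, Equiv.symm_apply_eq]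
    rw [Finset.sum_ite_eq']
    rfl
  have hsub : q.support ⊆
      (Finset.piAntidiag Finset.univ d).map Finsupp.equivFunOnFinite.symm.toEmbedding :=
    fun L hL => by
      rw [MvPolynomial.mem_support_iff, hcoeff] at hL
      exact Finset.mem_map.2 ⟨L, by_contra fun h => hL (if_neg h), by simp⟩
  rw [Finset.sum_subset hsub fun L _ hL => by
    rw [MvPolynomial.notMem_support_iff.1 hL, map_zero, zero_mul], Finset.sum_map]
  refine Finset.sum_congr rfl fun L hL => ?_
  rw [hcoeff, Equiv.coe_toEmbedding, Finsupp.coe_equivFunOnFinite_symm, if_pos hL, eq_ratCast]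

lemma isHomogeneous_sum_piAntidiag (d : ℕ) (a : (Fin r → ℕ) → ℚ) :
    (∑ L ∈ Finset.piAntidiag Finset.univ d,
      MvPolynomial.monomial (Finsupp.equivFunOnFinite.symm L) (a L)).IsHomogeneous d := by
  refine MvPolynomial.IsHomogeneous.sum _ _ _ fun L hL => MvPolynomial.isHomogeneous_monomial _ ?_
  rw [← (Finset.mem_piAntidiag.1 hL).1, Finsupp.degree_eq_sum]
  simp

lemma aeval_sum_piAntidiag (d : ℕ) (a : (Fin r → ℕ) → ℚ) (z : Fin r → ℂ) :
    MvPolynomial.aeval z (∑ L ∈ Finset.piAntidiag Finset.univ d,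
      MvPolynomial.monomial (Finsupp.equivFunOnFinite.symm L) (a L)) =
    ∑ L ∈ Finset.piAntidiag Finset.univ d, (a L : ℂ) * ∏ i, z i ^ L i := by
  rw [map_sum]
  refine Finset.sum_congr rfl fun L _ => ?_
  rw [MvPolynomial.aeval_monomial, Finsupp.prod_fintype _ _ fun _ => pow_zero _]
  simp

/-- The matrix of pairings with the positive roots, with its elementary positivity properties. -/
lemma RootSystemData.exists_rat_matrix (hr : 0 < r) (S : RootSystemData r E) :
    ∃ (m : ℕ) (c : Fin r → Fin (m + 1) → ℚ), S.pos.card = m + 1 ∧ (∀ i k, 0 ≤ c i k) ∧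
      (∀ i, ∃ k, c i k ≠ 0) ∧ (∀ k, ∃ i, c i k ≠ 0) ∧
      ∀ (s : ℂ) (u : Fin r → ℝ), ∏ α ∈ S.pos, ((∑ i, u i * S.pairing i α : ℝ) : ℂ) ^ (-s) =
        ∏ k, ((∑ i, (c i k : ℝ) * u i : ℝ) : ℂ) ^ (-s) := by
  obtain ⟨m, hm⟩ := Nat.exists_eq_succ_of_ne_zero
    (Finset.card_pos.2 ⟨_, S.simple_mem_pos ⟨0, hr⟩⟩).ne'
  let e := (Finset.equivFinOfCardEq hm).symm
  choose p hp using fun k => S.exists_rat_pairing (e k).2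
  refine ⟨m, fun i k => p k i, hm, fun i k => ?_, fun i => ?_, fun k => ?_, fun s u => ?_⟩
  · have := S.pairing_nonneg (e k).2 i
    rw [← hp] at this
    exact_mod_cast this
  · refine ⟨e.symm ⟨_, S.simple_mem_pos i⟩, fun h => ?_⟩
    have := hp (e.symm ⟨_, S.simple_mem_pos i⟩) i
    rw [show p _ i = 0 from h, Equiv.apply_symm_apply, S.pairing_simple, if_pos rfl] at this
    simp at this
  · obtain ⟨i, hi⟩ := S.exists_pairing_ne_zero (e k).2
    refine ⟨i, fun h => hi ?_⟩
    rw [← hp, show p k i = 0 from h, Rat.cast_zero]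
  · rw [← Finset.prod_coe_sort, ← e.prod_comp]
    refine Finset.prod_congr rfl fun k _ => ?_
    simp only [hp, mul_comm]

lemma zetaIntRS_eq_integral_pi (S : RootSystemData r E) (s : ℂ) (x : Fin r → ℝ) :
    zetaIntRS S s x = ∫ t, ∏ α ∈ S.pos,
      ((∑ i, (max (t i) 0 + x i) * S.pairing i α : ℝ) : ℂ) ^ (-s)
        ∂Measure.pi fun _ : Fin r => volume.restrict (Set.Ioi (0 : ℝ)) := by
  rw [zetaIntRS, ← restrict_orthant]
  refine setIntegral_congr_fun ?_ fun t ht => ?_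
  · have : {t : Fin r → ℝ | ∀ i, 0 < t i} = Set.univ.pi fun _ => Set.Ioi 0 := by
      ext t
      simp [Set.mem_pi]
    rw [this]
    exact MeasurableSet.univ_pi fun _ => measurableSet_Ioi
  · have ht' : ∀ i, max (t i) 0 = t i := fun i => max_eq_left (ht i).le
    simp only [ht']

lemma zetaRS_eq_integral_pi (S : RootSystemData r E) (s : ℂ) (x : Fin r → ℝ) :
    zetaRS S s x = ∫ m : Fin r → ℕ, ∏ α ∈ S.pos,
      ((∑ i, ((m i : ℝ) + x i) * S.pairing i α : ℝ) : ℂ) ^ (-s)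
        ∂Measure.pi fun _ : Fin r => (Measure.count : Measure ℕ) := by
  rw [pi_count, integral_count_eq_tsum]
  rfl

/-- The Bernoulli expansion: there are rational coefficients `a_L` (the
coefficients of the homogeneous polynomial `Q_ℓ`) such that simultaneously
`Q_ℓ(x) = Σ_L a_L Π_i x_i^{L_i}` and `P_ℓ(x) = Σ_L a_L Π_i B_{L_i}(x_i)`. -/
theorem Pl_bernoulli_expansion {r : ℕ} (hr : 0 < r) {E : Type*} [NormedAddCommGroup E]
    [InnerProductSpace ℝ E] (hdim : Module.finrank ℝ E = r)
    (S : RootSystemData r E) (l : ℕ) :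
    ∃ q : MvPolynomial (Fin r) ℚ,
      q.IsHomogeneous (S.pos.card * l + r) ∧
      (∀ x : Fin r → ℝ, (∀ i, 0 < x i) → ∀ v : ℂ, IsQValue S l x v →
        v = MvPolynomial.aeval (fun i => (x i : ℂ)) q) ∧
      (∀ x : Fin r → ℝ, (∀ i, 0 < x i) → ∀ v : ℂ, IsPValue S l x v →
        v = ∑ L ∈ q.support, (algebraMap ℚ ℂ) (MvPolynomial.coeff L q) *
          ∏ i, Polynomial.aeval ((x i : ℂ)) (Polynomial.bernoulli (L i))) := by
  obtain ⟨m, c, hm, hc, hrow, hcol, hprod⟩ := S.exists_rat_matrix hr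
  obtain ⟨ρ, hρ⟩ := eval_continuation l c hc hrow hcol
  rw [Fintype.card_fin, show (fun i j : Fin r => Classical.propDecidable (i = j)) =
    instDecidableEqFin r from Subsingleton.elim _ _] at hρ
  let a : (Fin r → ℕ) → ℚ := fun L =>
    ((-1) ^ l * (l.factorial : ℚ)) ^ (m + 1) * ((∏ i, (-1) ^ L i / ((L i).factorial : ℚ)) * ρ L)
  have ha : ∀ φ : Fin r → ℕ → ℂ, ((-1) ^ l * (l.factorial : ℂ)) ^ (m + 1) *
      ∑ L ∈ Finset.piAntidiag Finset.univ ((m + 1) * l + r),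
        (∏ i, PowerSeries.coeff (L i)
          (PowerSeries.mk fun j => (-1) ^ j * φ i j / (j.factorial : ℂ))) * ρ L =
      ∑ L ∈ Finset.piAntidiag Finset.univ ((m + 1) * l + r), (a L : ℂ) * ∏ i, φ i (L i) :=
    fun φ => by
      rw [Finset.mul_sum]
      refine Finset.sum_congr rfl fun L _ => ?_
      simp only [PowerSeries.coeff_mk, a, Rat.cast_mul, Rat.cast_pow, Rat.cast_neg, Rat.cast_one,
        Rat.cast_natCast, Rat.cast_prod, Rat.cast_div]
      rw [show ∏ i, (-1) ^ L i * φ i (L i) / ((L i).factorial : ℂ) =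
        (∏ i, (-1) ^ L i / ((L i).factorial : ℂ)) * ∏ i, φ i (L i) by
          rw [← Finset.prod_mul_distrib]
          exact Finset.prod_congr rfl fun i _ => by ring]
      ring
  refine ⟨_, by rw [hm]; exact isHomogeneous_sum_piAntidiag _ a, ?_, ?_⟩
  · rintro x hx v ⟨F, hF, hFm, hFa, rfl⟩
    obtain ⟨δ, hδ, hδx⟩ := exists_pos_forall_le x hx
    rw [aeval_sum_piAntidiag, ← ha fun i j => (x i : ℂ) ^ j]
    refine hρ ℝ (volume.restrict (Set.Ioi 0)) (fun i t => max t 0 + x i) x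
      (fun i y => cexp (-x i * y))
      (fun i => PowerSeries.mk fun j => (-1) ^ j * (x i : ℂ) ^ j / j.factorial) δ r F (fun i => by fun_prop) hx
      (fun i t => le_add_of_nonneg_left (le_max_right _ _)) (fun i => integrableOn_inv_sq (hx i))
      (fun i y hy => laplace_Ioi hy) (fun i => hasExpansion_exp_neg (hx i).le) hδ
      (fun i => ⟨PowerSeries.mk fun j => (-1) ^ j * ((x i - δ : ℝ) : ℂ) ^ j / j.factorial, ?_⟩) (fun s hs => ?_) hFm hFa
    · convert hasExpansion_exp_neg (sub_nonneg.2 (hδx i)) using 2 with y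
      rw [← Complex.exp_add]
      push_cast
      ring_nf
    · rw [hF s hs, zetaIntRS_eq_integral_pi]
      simp only [hprod]
  · rintro x hx v ⟨F, hF, hFm, hFa, rfl⟩
    obtain ⟨δ, hδ, hδx⟩ := exists_pos_forall_le x hx
    rw [sum_support_piAntidiag _ a fun L =>
      ∏ i, Polynomial.aeval ((x i : ℂ)) (Polynomial.bernoulli (L i)),
      ← ha fun i j => Polynomial.aeval ((x i : ℂ)) (Polynomial.bernoulli j)]
    refine hρ ℕ Measure.count (fun i k => (k : ℝ) + x i) x
      (fun i y => cexp (-x i * y) * toddFun y)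
      (fun i => PowerSeries.mk fun j =>
        (-1) ^ j * Polynomial.aeval (x i : ℂ) (Polynomial.bernoulli j) / j.factorial) δ r F (fun i => by fun_prop) hx
      (fun i t => le_add_of_nonneg_left (Nat.cast_nonneg _))
      (fun i => integrable_count_iff.2 (summable_inv_sq (hx i)).norm)
      (fun i y hy => laplace_count hy) (fun i => hasExpansion_exp_neg_mul_toddFun (hx i).le) hδ
      (fun i => ⟨PowerSeries.mk fun j => (-1) ^ j *
        Polynomial.aeval ((x i - δ : ℝ) : ℂ) (Polynomial.bernoulli j) / j.factorial, ?_⟩) (fun s hs => ?_) hFm hFa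
    · convert hasExpansion_exp_neg_mul_toddFun (sub_nonneg.2 (hδx i)) using 2 with y
      rw [← mul_assoc, ← Complex.exp_add]
      push_cast
      ring_nf
    · rw [hF s hs, zetaRS_eq_integral_pi]
      simp only [hprod]
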